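/- For every positive integer k, the pair (2, k) is findable; that is, for every δ > 0 there exists p₀ such that for every prime p ≥ p₀, every red–blue colouring of ℤ/pℤ in which each colour class has at least δ·p elements contains a (2,k)-AP. -/

import Mathlib

/-- A colouring of `ZMod p` (red set `A`, blue its complement) contains an `(a,b)`-AP:
an arithmetic progression with nonzero common difference whose first `a` terms are red
and whose last `b` terms are blue. -/
def HasAP {p : ℕ} (A : Set (ZMod p)) (a b : ℕ) : Prop :=
  ∃ x d : ZMod p, d ≠ 0 ∧
    (∀ i : ℕ, i < a → x + (i : ZMod p) * d ∈ A) ∧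
    (∀ i : ℕ, a ≤ i → i < a + b → x + (i : ZMod p) * d ∉ A)

/-- The pair `(a, b)` is findable: for every `δ > 0` there exists `p₀` such that for every
prime `p ≥ p₀`, every red–blue colouring of `ZMod p` in which each colour class has at
least `δ·p` elements contains an `(a,b)`-AP. -/
def Findable (a b : ℕ) : Prop :=
  ∀ δ : ℝ, 0 < δ → ∃ p₀ : ℕ, ∀ p : ℕ, p.Prime → p₀ ≤ p →
    ∀ A : Set (ZMod p),
      δ * p ≤ Nat.card ↥A → δ * p ≤ Nat.card ↥(Aᶜ) → HasAP A a b

set_option linter.all false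


namespace TwoK

/-! ### Averages -/

noncomputable def avg {X : Type*} (f : X → ℝ) : ℝ := (∑ᶠ x, f x) / (Nat.card X : ℝ)

open Classical in
noncomputable def ind (P : Prop) : ℝ := if P then 1 else 0

lemma ind_true {P : Prop} (h : P) : ind P = 1 := if_pos h
lemma ind_false {P : Prop} (h : ¬ P) : ind P = 0 := if_neg h
lemma ind_nonneg (P : Prop) : 0 ≤ ind P := by unfold ind; split_ifs <;> norm_num
lemma ind_le_one (P : Prop) : ind P ≤ 1 := by unfold ind; split_ifs <;> norm_num
lemma ind_and (P Q : Prop) : ind (P ∧ Q) = ind P * ind Q := by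
  by_cases hP : P <;> by_cases hQ : Q <;> simp [ind, hP, hQ]
lemma ind_mono {P Q : Prop} (h : P → Q) : ind P ≤ ind Q := by
  by_cases hP : P
  · rw [ind_true hP, ind_true (h hP)]
  · rw [ind_false hP]; exact ind_nonneg _

lemma avg_eq {X : Type*} [Fintype X] (f : X → ℝ) :
    avg f = (∑ x, f x) / (Fintype.card X : ℝ) := by
  rw [avg, finsum_eq_sum_of_fintype, Nat.card_eq_fintype_card]

section
variable {X Y : Type*} [Finite X] [Finite Y]

lemma avg_mono {f g : X → ℝ} (h : ∀ x, f x ≤ g x) : avg f ≤ avg g := by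
  have := Fintype.ofFinite X
  rw [avg_eq, avg_eq]
  gcongr
  exact h _

lemma avg_add (f g : X → ℝ) : avg (fun x => f x + g x) = avg f + avg g := by
  have := Fintype.ofFinite X
  simp only [avg_eq, Finset.sum_add_distrib, add_div]

lemma avg_sub (f g : X → ℝ) : avg (fun x => f x - g x) = avg f - avg g := by
  have := Fintype.ofFinite X
  simp only [avg_eq, Finset.sum_sub_distrib, sub_div]

lemma avg_mul_left (c : ℝ) (f : X → ℝ) : avg (fun x => c * f x) = c * avg f := by
  have := Fintype.ofFinite X
  simp only [avg_eq, ← Finset.mul_sum, mul_div_assoc]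

lemma avg_mul_right (c : ℝ) (f : X → ℝ) : avg (fun x => f x * c) = avg f * c := by
  simp only [mul_comm _ c, avg_mul_left]

lemma avg_const [Nonempty X] (c : ℝ) : avg (fun _ : X => c) = c := by
  have := Fintype.ofFinite X
  rw [avg_eq]; simp

lemma avg_sum {I : Type*} (s : Finset I) (f : I → X → ℝ) :
    avg (fun x => ∑ i ∈ s, f i x) = ∑ i ∈ s, avg (f i) := by
  have := Fintype.ofFinite X
  simp only [avg_eq]
  rw [Finset.sum_comm, Finset.sum_div]

lemma avg_equiv (e : X ≃ Y) (f : Y → ℝ) : avg (fun x => f (e x)) = avg f := by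
  have := Fintype.ofFinite X
  have := Fintype.ofFinite Y
  rw [avg_eq, avg_eq, Fintype.card_congr e, e.sum_comp]

lemma avg_prod (f : X × Y → ℝ) : avg f = avg (fun x => avg (fun y => f (x, y))) := by
  have := Fintype.ofFinite X
  have := Fintype.ofFinite Y
  simp only [avg_eq, Fintype.sum_prod_type, Fintype.card_prod, ← Finset.sum_div]
  rw [div_div]; push_cast; ring

lemma avg_comm (f : X → Y → ℝ) :
    avg (fun x => avg (fun y => f x y)) = avg (fun y => avg (fun x => f x y)) := by
  have := Fintype.ofFinite X
  have := Fintype.ofFinite Y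
  simp only [avg_eq, ← Finset.sum_div]
  rw [Finset.sum_comm]; ring

lemma avg_nonneg {f : X → ℝ} (h : ∀ x, 0 ≤ f x) : 0 ≤ avg f := by
  have := Fintype.ofFinite X
  rw [avg_eq]
  exact div_nonneg (Finset.sum_nonneg fun x _ => h x) (Nat.cast_nonneg _)

lemma avg_nonpos {f : X → ℝ} (h : ∀ x, f x ≤ 0) : avg f ≤ 0 := by
  have := avg_nonneg (f := fun x => (-1) * f x) (fun x => by linarith [h x])
  rw [avg_mul_left] at this; linarith

lemma avg_le [Nonempty X] {f : X → ℝ} {c : ℝ} (h : ∀ x, f x ≤ c) : avg f ≤ c := by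
  rw [← avg_const (X := X) c]; exact avg_mono h

lemma le_avg [Nonempty X] {f : X → ℝ} {c : ℝ} (h : ∀ x, c ≤ f x) : c ≤ avg f := by
  rw [← avg_const (X := X) c]; exact avg_mono h

lemma exists_le_of_avg [Nonempty X] {f : X → ℝ} {c : ℝ} (h : c ≤ avg f) : ∃ x, c ≤ f x := by
  by_contra! hc
  have := Fintype.ofFinite X
  rw [avg_eq, le_div_iff₀ (by exact_mod_cast Fintype.card_pos)] at h
  have h2 : ∑ x, f x < ∑ x : X, c := Finset.sum_lt_sum_of_nonempty Finset.univ_nonempty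
    (fun x _ => hc x)
  simp at h2
  nlinarith

lemma markov [Nonempty X] {f : X → ℝ} {c : ℝ} (h1 : ∀ x, f x ≤ 1) (h0 : 0 ≤ c)
    (h : c ≤ avg f) : c / 2 ≤ avg (fun x => ind (c / 2 ≤ f x)) := by
  have : avg f ≤ avg (fun x => ind (c / 2 ≤ f x) + c / 2) := by
    apply avg_mono
    intro x
    by_cases hx : c / 2 ≤ f x
    · rw [ind_true hx]; linarith [h1 x]
    · rw [ind_false hx]; linarith
  rw [avg_add, avg_const] at this
  linarith

lemma avg_pigeon [Nonempty Y] (P : X → Prop) (Q : X → Y → Prop) (h : ∀ x, P x → ∃ y, Q x y)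
    {c : ℝ} (hc : c ≤ avg (fun x => ind (P x))) :
    ∃ y, c / (Nat.card Y : ℝ) ≤ avg (fun x => ind (Q x y)) := by
  have := Fintype.ofFinite Y
  by_contra! hcon
  have h1 : avg (fun x => ind (P x)) ≤ avg (fun x => ∑ y, ind (Q x y)) := by
    apply avg_mono
    intro x
    by_cases hx : P x
    · obtain ⟨y, hy⟩ := h x hx
      rw [ind_true hx, ← ind_true hy]
      exact Finset.single_le_sum (f := fun y => ind (Q x y)) (fun y _ => ind_nonneg _) (Finset.mem_univ y)
    · rw [ind_false hx]; exact Finset.sum_nonneg fun y _ => ind_nonneg _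
  rw [avg_sum] at h1
  have h2 : ∑ y, avg (fun x => ind (Q x y)) < ∑ y : Y, c / (Nat.card Y : ℝ) :=
    Finset.sum_lt_sum_of_nonempty Finset.univ_nonempty (fun y _ => hcon y)
  have hY : (0 : ℝ) < Nat.card Y := by exact_mod_cast Nat.card_pos
  have h3 : ∑ y : Y, c / (Nat.card Y : ℝ) = c := by
    simp only [Finset.sum_const, Finset.card_univ, nsmul_eq_mul, ← Nat.card_eq_fintype_card]
    field_simp
  linarith

lemma avg_range {g : Y → X} (hg : Function.Injective g) [Nonempty X] [Nonempty Y] (f : X → ℝ) :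
    avg (fun x => ind (x ∈ Set.range g) * f x)
      = (Nat.card Y : ℝ) / (Nat.card X : ℝ) * avg (fun y => f (g y)) := by
  classical
  have := Fintype.ofFinite X
  have := Fintype.ofFinite Y
  rw [avg_eq, avg_eq]
  have h1 : ∑ x, ind (x ∈ Set.range g) * f x = ∑ y, f (g y) := by
    rw [← Finset.sum_image (s := Finset.univ) (g := g) (f := f) (fun a _ b _ h => hg h)]
    rw [← Finset.sum_filter_add_sum_filter_not Finset.univ (fun x => x ∈ Set.range g)]
    rw [Finset.sum_eq_zero (s := Finset.univ.filter (fun x => ¬ x ∈ Set.range g)), add_zero]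
    · apply Finset.sum_congr
      · ext x; simp
      · intro x hx
        simp only [Finset.mem_image, Finset.mem_univ, true_and] at hx
        rw [ind_true (by simpa using hx), one_mul]
    · intro x hx
      rw [ind_false (by simpa using hx), zero_mul]
  rw [h1, Nat.card_eq_fintype_card, Nat.card_eq_fintype_card]
  have : (Fintype.card Y : ℝ) ≠ 0 := by exact_mod_cast Fintype.card_ne_zero
  field_simp

end

lemma avg_sumArrow {κ τ α : Type*} [Finite κ] [Finite τ] [Finite α] (f : (κ ⊕ τ → α) → ℝ) :
    avg f = avg (fun x : κ → α => avg (fun t : τ → α => f (Sum.elim x t))) := by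
  rw [← avg_equiv (Equiv.sumArrowEquivProdArrow κ τ α).symm f, avg_prod]
  rfl

lemma avg_sumArrow' {κ τ α : Type*} [Finite κ] [Finite τ] [Finite α] (f : (κ ⊕ τ → α) → ℝ) :
    avg f = avg (fun t : τ → α => avg (fun x : κ → α => f (Sum.elim x t))) := by
  rw [avg_sumArrow, avg_comm]

lemma avg_eval {ι X : Type*} [Finite ι] [Finite X] [Nonempty X] (j : ι) (f : X → ℝ) :
    avg (fun x : ι → X => f (x j)) = avg f := by
  classical
  rw [← avg_equiv (Equiv.funSplitAt j X).symm, avg_prod]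
  have : ∀ (a : X) (b : {i // i ≠ j} → X), (Equiv.funSplitAt j X).symm (a, b) j = a := by
    intro a b; simp [Equiv.funSplitAt, Equiv.piSplitAt]
  simp only [this, avg_const]

lemma avg_arrowEquiv {ι κ α : Type*} [Finite ι] [Finite κ] [Finite α] (e : ι ≃ κ)
    (f : (ι → α) → ℝ) : avg (fun x : κ → α => f (fun i => x (e i))) = avg f := by
  rw [← avg_equiv (e.arrowCongr (Equiv.refl α)).symm f]
  rfl

lemma exists_split {ι κ : Type} [Finite ι] [Finite κ] {n : ℕ} (h : Nat.card κ + n ≤ Nat.card ι) :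
    ∃ m, n ≤ m ∧ Nonempty (ι ≃ κ ⊕ Fin m) := by
  refine ⟨Nat.card ι - Nat.card κ, by omega, ?_⟩
  apply Nonempty.intro
  apply (Finite.equivFinOfCardEq rfl).trans
  apply Equiv.symm
  apply Finite.equivFinOfCardEq
  rw [Nat.card_sum]; simp; omega

end TwoK


namespace TwoK

/-! ### Combinatorial lines and subspaces -/

def lev {ι α : Type*} (l : ι → Option α) (a : α) (i : ι) : α := (l i).getD a

def sev {ι α η : Type*} (V : ι → α ⊕ η) (x : η → α) (i : ι) : α := Sum.elim id x (V i)

def SProper {ι α η : Type*} (V : ι → α ⊕ η) : Prop := ∀ e, ∃ i, V i = Sum.inr e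

def LineProp (α : Type) (δ : ℝ) (ι : Type) : Prop :=
  ∀ A : Set (ι → α), δ ≤ avg (fun x => ind (x ∈ A)) →
    ∃ l : ι → Option α, (∃ i, l i = none) ∧ ∀ a, lev l a ∈ A

def DHJ (α : Type) (δ : ℝ) : Prop :=
  ∃ n0 : ℕ, ∀ ι : Type, Finite ι → n0 ≤ Nat.card ι → LineProp α δ ι

def MDHJ (α : Type) (δ : ℝ) (d : ℕ) : Prop :=
  ∃ n0 : ℕ, ∀ n : ℕ, n0 ≤ n → ∀ A : Set (Fin n → α), δ ≤ avg (fun x => ind (x ∈ A)) →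
    ∃ V : Fin n → α ⊕ Fin d, SProper V ∧ ∀ x, sev V x ∈ A

lemma sev_injective {ι α η : Type*} {V : ι → α ⊕ η} (hV : SProper V) :
    Function.Injective (sev V) := by
  intro x y h
  funext e
  obtain ⟨i, hi⟩ := hV e
  have := congrFun h i
  simpa [sev, hi] using this

lemma mdhj_of_dhj {α : Type} [Finite α] [Nonempty α] (H : ∀ δ : ℝ, 0 < δ → DHJ α δ) (d : ℕ) :
    ∀ δ : ℝ, 0 < δ → MDHJ α δ d := by
  induction d with
  | zero =>
    intro δ hδ
    refine ⟨0, fun n _ A hA => ?_⟩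
    obtain ⟨x, hx⟩ := exists_le_of_avg hA
    have hxA : x ∈ A := by
      by_contra hxA
      rw [ind_false hxA] at hx; linarith
    refine ⟨fun i => Sum.inl (x i), fun e => e.elim0, fun y => ?_⟩
    exact hxA
  | succ d ih =>
    intro δ hδ
    obtain ⟨n1, h1⟩ := ih (δ / 2) (by linarith)
    set c : ℝ := δ / 2 / (Nat.card (Fin n1 → α ⊕ Fin d) : ℝ) with hc
    have hcpos : 0 < c := by
      have : (0 : ℝ) < Nat.card (Fin n1 → α ⊕ Fin d) := by exact_mod_cast Nat.card_pos
      positivity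
    obtain ⟨n2, h2⟩ := H c hcpos
    refine ⟨n1 + n2, fun n hn A hA => ?_⟩
    obtain ⟨m, hm, ⟨e⟩⟩ := exists_split (ι := Fin n) (κ := Fin n1) (n := n2) (by simpa using hn)
    rw [← avg_arrowEquiv e, avg_sumArrow'] at hA
    have hA2 := markov (fun t => avg_le (fun x => ind_le_one _)) hδ.le hA
    obtain ⟨V, hV⟩ := avg_pigeon (Y := Fin n1 → α ⊕ Fin d) _
      (fun t V => SProper V ∧ ∀ x, (fun i => Sum.elim (sev V x) t (e i)) ∈ A)
      (fun t ht => by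
        obtain ⟨V, hV, hV2⟩ := h1 n1 le_rfl
          {x | (fun i => Sum.elim x t (e i)) ∈ A} ht
        exact ⟨V, hV, hV2⟩) hA2
    obtain ⟨l, ⟨i0, hi0⟩, hl⟩ := h2 (Fin m) inferInstance (by simpa using hm)
      {t | SProper V ∧ ∀ x, (fun i => Sum.elim (sev V x) t (e i)) ∈ A} hV
    obtain ⟨a0⟩ := ‹Nonempty α›
    have hVp := (hl a0).1
    refine ⟨fun i => Sum.elim (fun i => Sum.map id Fin.castSucc (V i))
      (fun j => (l j).elim (Sum.inr (Fin.last d)) Sum.inl) (e i), ?_, ?_⟩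
    · intro q
      refine Fin.lastCases ?_ (fun q => ?_) q
      · exact ⟨e.symm (Sum.inr i0), by simp [hi0]⟩
      · obtain ⟨i, hi⟩ := hVp q
        exact ⟨e.symm (Sum.inl i), by simp [hi]⟩
    · intro x
      convert (hl (x (Fin.last d))).2 (fun q => x q.castSucc) using 1
      funext i
      simp only [sev]
      rcases e i with j | j
      · simp only [Sum.elim_inl, sev]
        cases V j <;> simp
      · simp only [Sum.elim_inr, lev]
        cases l j <;> simp

/-! ### Insensitive sets -/

def Sim {α κ : Type*} (a : α) (x y : κ → Option α) : Prop :=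
  ∀ i, x i = y i ∨ ((x i = none ∨ x i = some a) ∧ (y i = none ∨ y i = some a))

def Insens {α κ : Type*} (a : α) (S : Set (κ → Option α)) : Prop :=
  ∀ x y, Sim a x y → x ∈ S → y ∈ S

lemma Sim.symm {α κ : Type*} {a : α} {x y : κ → Option α} (h : Sim a x y) : Sim a y x := by
  intro i
  rcases h i with h | h
  · exact Or.inl h.symm
  · exact Or.inr ⟨h.2, h.1⟩

lemma Sim.refl {α κ : Type*} (a : α) (x : κ → Option α) : Sim a x x := fun i => Or.inl rfl

lemma Sim.sev {α κ η : Type*} {a : α} (V : κ → Option α ⊕ η) {x y : η → Option α}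
    (h : Sim a x y) : Sim a (TwoK.sev V x) (TwoK.sev V y) := by
  intro i
  unfold TwoK.sev
  cases V i with
  | inl b => left; rfl
  | inr e => exact h e

lemma Sim.elim {α κ τ : Type*} {a : α} {x y : κ → Option α} {s t : τ → Option α}
    (h : Sim a x y) (h' : Sim a s t) : Sim a (Sum.elim x s) (Sum.elim y t) := by
  intro i
  cases i with
  | inl i => exact h i
  | inr i => exact h' i

open Classical in
noncomputable def firstC {b : ℕ} {α : Type} (hb : 0 < b) (y : Fin b → Option α) : Fin b :=
  if h : ∃ c, y c ≠ none then (Finset.univ.filter (fun c => y c ≠ none)).min' (by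
    obtain ⟨c, hc⟩ := h; exact ⟨c, by simp [hc]⟩) else ⟨0, hb⟩

lemma firstC_ne {b : ℕ} {α : Type} (hb : 0 < b) (y : Fin b → Option α) (h : ∃ c, y c ≠ none) :
    y (firstC hb y) ≠ none := by
  unfold firstC
  rw [dif_pos h]
  have := Finset.min'_mem (Finset.univ.filter (fun c => y c ≠ none)) (by
    obtain ⟨c, hc⟩ := h; exact ⟨c, by simp [hc]⟩)
  exact (Finset.mem_filter.1 this).2

lemma firstC_congr {b : ℕ} {α : Type} (hb : 0 < b) (y z : Fin b → Option α)
    (h : ∀ c, y c = none ↔ z c = none) : firstC hb y = firstC hb z := by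
  unfold firstC
  simp only [ne_eq, h]

open Classical in
noncomputable def swapB {b : ℕ} {α : Type} (hb : 0 < b) (p : (Fin b → Option α) × α) :
    (Fin b → Option α) × α :=
  if (∃ c, p.1 c ≠ none) then
    (Function.update p.1 (firstC hb p.1) (some p.2), (p.1 (firstC hb p.1)).getD p.2)
  else p

lemma update_none_iff {b : ℕ} {α : Type} (hb : 0 < b) (y : Fin b → Option α) (w : α)
    (h : ∃ c, y c ≠ none) (c : Fin b) :
    Function.update y (firstC hb y) (some w) c = none ↔ y c = none := by
  by_cases hc : c = firstC hb y
  · subst hc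
    simp [firstC_ne hb y h]
  · rw [Function.update_of_ne hc]

lemma swapB_invol {b : ℕ} {α : Type} (hb : 0 < b) :
    Function.Involutive (swapB (α := α) hb) := by
  rintro ⟨y, w⟩
  by_cases h : ∃ c, y c ≠ none
  · have e : swapB hb (y, w) = (Function.update y (firstC hb y) (some w), (y (firstC hb y)).getD w) :=
      if_pos h
    have hiff := update_none_iff hb y w h
    have h' : ∃ c, (Function.update y (firstC hb y) (some w)) c ≠ none := by
      obtain ⟨c, hc⟩ := h
      exact ⟨c, fun h => hc ((hiff c).1 h)⟩
    have hf : firstC hb (Function.update y (firstC hb y) (some w)) = firstC hb y :=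
      firstC_congr hb _ _ hiff
    rw [e, swapB, if_pos h']
    simp only [hf]
    rw [Function.update_idem, Function.update_self]
    obtain ⟨v, hv⟩ := Option.ne_none_iff_exists'.1 (firstC_ne hb y h)
    simp only [hv, Option.getD_some]
    rw [← hv, Function.update_eq_self]
  · have e : swapB hb (y, w) = (y, w) := if_neg h
    rw [e, e]

lemma insens_subspace {α : Type} [Finite α] [Nonempty α] (H : ∀ δ : ℝ, 0 < δ → DHJ α δ)
    (a : α) (d : ℕ) (c : ℝ) (hc : 0 < c) :
    ∃ n : ℕ, ∀ S : Set (Fin n → Option α), Insens a S → c ≤ avg (fun x => ind (x ∈ S)) →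
      ∃ V : Fin n → Option α ⊕ Fin d, SProper V ∧ ∀ x, sev V x ∈ S := by
  classical
  obtain ⟨m, hm⟩ := mdhj_of_dhj H d (c / 2) (by linarith)
  have hk : (2 : ℝ) ≤ Nat.card (Option α) := by
    have h1 : 0 < Nat.card α := Nat.card_pos
    rw [Finite.card_option]
    exact_mod_cast (by omega : 2 ≤ Nat.card α + 1)
  obtain ⟨b, hb0, hb⟩ : ∃ b : ℕ, 0 < b ∧ (m : ℝ) * (1 / (Nat.card (Option α) : ℝ)) ^ b < c / 2 := by
    have ht : Filter.Tendsto (fun b : ℕ => (m : ℝ) * (1 / (Nat.card (Option α) : ℝ)) ^ b)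
        Filter.atTop (nhds ((m : ℝ) * 0)) := by
      apply Filter.Tendsto.const_mul
      apply tendsto_pow_atTop_nhds_zero_of_lt_one
      · positivity
      · rw [div_lt_one (by linarith)]; linarith
    rw [mul_zero] at ht
    have := (ht.eventually (gt_mem_nhds (show 0 < c / 2 by linarith))).and
      (Filter.eventually_gt_atTop 0)
    obtain ⟨b, hb⟩ := this.exists
    exact ⟨b, hb.2, hb.1⟩
  refine ⟨m * b, fun S hS hdens => ?_⟩
  set e : Fin (m * b) ≃ Fin m × Fin b := finProdFinEquiv.symm with he
  -- pass to curried words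
  set f : (Fin m → Fin b → Option α) → ℝ :=
    fun z => ind ((fun i => z (e i).1 (e i).2) ∈ S) with hf
  have h1 : avg f = avg (fun x => ind (x ∈ S)) := by
    rw [← avg_arrowEquiv e, ← avg_equiv (Equiv.curry (Fin m) (Fin b) (Option α)) f]
    rfl
  -- resampling
  have h2 : avg (fun z : Fin m → Fin b → Option α => avg (fun w : Fin m → α =>
      f (fun j => (swapB hb0 (z j, w j)).1))) = avg f := by
    have h3 : avg f = avg (fun z : Fin m → Fin b → Option α => avg (fun w : Fin m → α => f z)) := by
      simp only [avg_const]
    rw [h3, ← avg_prod (fun p : (Fin m → Fin b → Option α) × (Fin m → α) => f p.1),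
      ← avg_prod (fun p : (Fin m → Fin b → Option α) × (Fin m → α) =>
        f (fun j => (swapB hb0 (p.1 j, p.2 j)).1))]
    rw [← avg_equiv (Equiv.arrowProdEquivProdArrow (Fin m) (fun _ => Fin b → Option α) (fun _ => α)) _,
      ← avg_equiv (Equiv.arrowProdEquivProdArrow (Fin m) (fun _ => Fin b → Option α) (fun _ => α))
        (fun p => f p.1)]
    rw [← avg_equiv (Equiv.arrowCongr (Equiv.refl (Fin m)) (Function.Involutive.toPerm _ (swapB_invol (α := α) hb0)))
      (fun x => f ((Equiv.arrowProdEquivProdArrow (Fin m) (fun _ => Fin b → Option α) (fun _ => α)) x).1)]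
    rfl
  -- bad words
  have h4 : avg (fun z : Fin m → Fin b → Option α => ind (∃ j, ∀ c, z j c = none)) < c / 2 := by
    refine lt_of_le_of_lt ?_ hb
    calc _ ≤ avg (fun z : Fin m → Fin b → Option α => ∑ j, ind (∀ c, z j c = none)) := by
          apply avg_mono
          intro z
          by_cases hz : ∃ j, ∀ c, z j c = none
          · obtain ⟨j, hj⟩ := hz
            rw [ind_true ⟨j, hj⟩, ← ind_true hj]
            exact Finset.single_le_sum (f := fun j => ind (∀ c, z j c = none))
              (fun y _ => ind_nonneg _) (Finset.mem_univ j)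
          · rw [ind_false hz]; exact Finset.sum_nonneg fun y _ => ind_nonneg _
      _ = ∑ j : Fin m, avg (fun y : Fin b → Option α => ind (∀ c, y c = none)) := by
          rw [avg_sum]
          exact Finset.sum_congr rfl fun j _ =>
            avg_eval j (fun y : Fin b → Option α => ind (∀ c, y c = none))
      _ = _ := by
          rw [Finset.sum_const, Finset.card_univ, Fintype.card_fin, nsmul_eq_mul]
          congr 1
          have := Fintype.ofFinite α
          rw [avg_eq, Finset.sum_eq_single (fun _ => none)]
          · rw [ind_true (fun _ => rfl)]
            simp [Nat.card_eq_fintype_card]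
          · intro y _ hy
            apply ind_false
            intro h; exact hy (funext h)
          · simp
  obtain ⟨z, hz⟩ : ∃ z : Fin m → Fin b → Option α, c / 2 ≤ avg (fun w : Fin m → α =>
      f (fun j => (swapB hb0 (z j, w j)).1)) - ind (∃ j, ∀ c, z j c = none) := by
    apply exists_le_of_avg
    rw [avg_sub, h2, h1]
    linarith
  have hgood : ∀ j, ∃ c, z j c ≠ none := by
    by_contra! hbad
    have h5 := hz
    rw [ind_true hbad] at h5
    have h6 : avg (fun w : Fin m → α => f (fun j => (swapB hb0 (z j, w j)).1)) ≤ 1 :=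
      avg_le fun w => ind_le_one _
    linarith
  rw [ind_false (by push Not; exact hgood), sub_zero] at hz
  obtain ⟨V, hV, hV2⟩ := hm m le_rfl
    {w | (fun i => (swapB hb0 (z (e i).1, w (e i).1)).1 (e i).2) ∈ S} hz
  have hsw : ∀ j w, (swapB hb0 (z j, w)).1 = Function.update (z j) (firstC hb0 (z j)) (some w) := by
    intro j w
    rw [swapB, if_pos (hgood j)]
  simp only [hsw] at hV2
  refine ⟨fun i => if (e i).2 = firstC hb0 (z (e i).1) then Sum.map some id (V (e i).1)
    else Sum.inl (z (e i).1 (e i).2), ?_, ?_⟩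
  · intro q
    obtain ⟨j, hj⟩ := hV q
    refine ⟨e.symm (j, firstC hb0 (z j)), ?_⟩
    simp [hj]
  · intro x
    refine hS _ _ ?_ (hV2 (fun q => (x q).getD a))
    intro i
    simp only [sev]
    by_cases hi : (e i).2 = firstC hb0 (z (e i).1)
    · rw [if_pos hi, hi, Function.update_self]
      cases V (e i).1 with
      | inl v => left; simp [sev]
      | inr q =>
        simp only [Sum.map_inr, id, Sum.elim_inr]
        cases hx : x q with
        | none => right; simp [hx]
        | some v => left; simp [hx]
    · rw [if_neg hi, Function.update_of_ne hi]
      left; rfl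

end TwoK


namespace TwoK

def SubNeg {α : Type} (d : ℕ) {κ : Type} (φ : (κ → Option α) → ℝ) : Prop :=
  (∀ x, φ x ≤ 1) ∧ ∀ V : κ → Option α ⊕ Fin d, SProper V → avg (fun w => φ (sev V w)) ≤ 0

def GoodAt {α : Type} (a : α) (d : ℕ) (β0 lam : ℝ) (κ : Type) : Prop :=
  ∀ φ : (κ → Option α) → ℝ, SubNeg d φ → ∀ S : Set (κ → Option α), Insens a S →
    avg (fun x => ind (x ∈ S) * φ x) ≤ β0 + lam * avg (fun x => ind (x ∈ S))

lemma SubNeg.transport {α κ κ' : Type} {d : ℕ} (e : κ ≃ κ') {φ : (κ → Option α) → ℝ}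
    (h : SubNeg d φ) : SubNeg d (fun x : κ' → Option α => φ (fun i => x (e i))) := by
  refine ⟨fun x => h.1 _, fun V hV => ?_⟩
  have := h.2 (fun i => V (e i)) (fun q => by
    obtain ⟨i, hi⟩ := hV q
    exact ⟨e.symm i, by simpa using hi⟩)
  exact this

lemma Insens.transport {α κ κ' : Type} {a : α} (e : κ ≃ κ') {S : Set (κ → Option α)}
    (h : Insens a S) : Insens a {x : κ' → Option α | (fun i => x (e i)) ∈ S} := by
  intro x y hxy hx
  exact h _ _ (fun i => hxy (e i)) hx

lemma GoodAt.transport {α κ κ' : Type} [Finite α] [Finite κ] [Finite κ'] {a : α} {d : ℕ} {β0 lam : ℝ}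
    (e : κ ≃ κ') (h : GoodAt a d β0 lam κ') : GoodAt a d β0 lam κ := by
  intro φ hφ S hS
  rw [← avg_arrowEquiv e, ← avg_arrowEquiv e (fun x => ind (x ∈ S))]
  exact h _ (hφ.transport e) _ (hS.transport e)

/-- slices of negative functions -/
lemma SubNeg.slice {α κ τ : Type} {d : ℕ} {φ : (κ ⊕ τ → Option α) → ℝ} (h : SubNeg d φ)
    (t : κ → Option α) : SubNeg d (fun x : τ → Option α => φ (Sum.elim t x)) := by
  refine ⟨fun x => h.1 _, fun V hV => ?_⟩
  have := h.2 (Sum.elim (fun i => Sum.inl (t i)) V) (fun q => by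
    obtain ⟨i, hi⟩ := hV q
    exact ⟨Sum.inr i, by simpa using hi⟩)
  convert this using 3 with w
  show φ _ = φ _
  congr 1
  funext i
  cases i <;> simp [sev]

lemma SubNeg.slice' {α κ τ : Type} {d : ℕ} {φ : (κ ⊕ τ → Option α) → ℝ} (h : SubNeg d φ)
    (x : τ → Option α) : SubNeg d (fun t : κ → Option α => φ (Sum.elim t x)) := by
  refine ⟨fun x => h.1 _, fun V hV => ?_⟩
  have := h.2 (Sum.elim V (fun i => Sum.inl (x i))) (fun q => by
    obtain ⟨i, hi⟩ := hV q
    exact ⟨Sum.inl i, by simpa using hi⟩)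
  convert this using 3 with w
  show φ _ = φ _
  congr 1
  funext i
  cases i <;> simp [sev]

lemma good_step {α : Type} [Finite α] [Nonempty α] (H : ∀ δ : ℝ, 0 < δ → DHJ α δ)
    (a : α) (d : ℕ) (β0 : ℝ) (hβ0 : 0 < β0) :
    ∃ ρ : ℝ, 0 < ρ ∧ ρ ≤ 1 ∧ ∀ (lam : ℝ) (_ : 0 ≤ lam) (_ : lam ≤ 1) (M0 : ℕ),
      (∀ κ : Type, Finite κ → M0 ≤ Nat.card κ → GoodAt a d β0 lam κ) →
      ∃ M1 : ℕ, (∀ κ : Type, Finite κ → M1 ≤ Nat.card κ → GoodAt a d β0 (lam * (1 - ρ)) κ) := by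
  obtain ⟨n, hn⟩ := insens_subspace H a d (β0 / 2) (by linarith)
  set q : ℝ := (Nat.card (Fin d → Option α) : ℝ) / (Nat.card (Fin n → Option α) : ℝ) with hq
  set r : ℝ := β0 / 2 / (Nat.card (Fin n → Option α ⊕ Fin d) : ℝ) with hr
  have hqpos : 0 < q := by
    have h1 : (0 : ℝ) < Nat.card (Fin d → Option α) := by exact_mod_cast Nat.card_pos
    have h2 : (0 : ℝ) < Nat.card (Fin n → Option α) := by exact_mod_cast Nat.card_pos
    positivity
  have hrpos : 0 < r := by
    have h1 : (0 : ℝ) < Nat.card (Fin n → Option α ⊕ Fin d) := by exact_mod_cast Nat.card_pos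
    positivity
  refine ⟨min 1 (q * r), by positivity, min_le_left _ _, fun lam hl0 hl1 M0 hM0 => ?_⟩
  refine ⟨n + M0, fun κ _ hκ => ?_⟩
  obtain ⟨m, hm, ⟨e⟩⟩ := exists_split (ι := κ) (κ := Fin n) (n := M0) (by simpa using hκ)
  refine GoodAt.transport e ?_
  intro φ hφ S hS
  set ρ := min 1 (q * r) with hρ
  have hρ1 : ρ ≤ 1 := min_le_left _ _
  have hD0 : 0 ≤ avg (fun x => ind (x ∈ S)) := avg_nonneg fun x => ind_nonneg _
  have hD1 : avg (fun x => ind (x ∈ S)) ≤ 1 := avg_le fun x => ind_le_one _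
  by_cases hsmall : avg (fun x => ind (x ∈ S)) ≤ β0
  · have h1 : avg (fun x => ind (x ∈ S) * φ x) ≤ avg (fun x => ind (x ∈ S)) := by
      apply avg_mono
      intro x
      nlinarith [ind_nonneg (x ∈ S), hφ.1 x]
    have h2 : 0 ≤ lam * (1 - ρ) * avg (fun x => ind (x ∈ S)) :=
      mul_nonneg (mul_nonneg hl0 (by linarith)) hD0
    linarith
  push Not at hsmall
  have hA := hsmall.le
  rw [avg_sumArrow'] at hA
  have hA2 := markov (fun t => avg_le (fun x => ind_le_one _)) hβ0.le hA
  obtain ⟨V, hV⟩ := avg_pigeon (Y := Fin n → Option α ⊕ Fin d) _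
    (fun t V => SProper V ∧ ∀ x, Sum.elim (sev V x) t ∈ S)
    (fun t ht => by
      obtain ⟨V, hV, hV2⟩ := hn {x | Sum.elim x t ∈ S}
        (fun x y hxy hx => hS _ _ (hxy.elim (Sim.refl a t)) hx) ht
      exact ⟨V, hV, hV2⟩) hA2
  rw [← hr] at hV
  have hVp : SProper V := by
    by_contra hVp
    have : avg (fun x => ind (SProper V ∧ ∀ (x_1 : Fin d → Option α), Sum.elim (sev V x_1) x ∈ S)) ≤ 0 :=
      avg_nonpos fun x => by rw [ind_false (fun h => hVp h.1)]
    linarith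
  set X : Set (Fin m → Option α) := {t | SProper V ∧ ∀ x, Sum.elim (sev V x) t ∈ S} with hX
  have hXi : Insens a X := fun x y hxy hx =>
    ⟨hVp, fun w => hS _ _ ((Sim.refl a _).elim hxy) (hx.2 w)⟩
  have hpt : ∀ (t : Fin n → Option α) (x : Fin m → Option α),
      ind (Sum.elim t x ∈ S) =
        ind (Sum.elim t x ∈ S ∧ ¬ (t ∈ Set.range (sev V) ∧ x ∈ X))
          + ind (t ∈ Set.range (sev V)) * ind (x ∈ X) := by
    intro t x
    rw [← ind_and]
    by_cases h : t ∈ Set.range (sev V) ∧ x ∈ X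
    · rw [ind_true h, ind_false (P := Sum.elim t x ∈ S ∧ ¬ (t ∈ Set.range (sev V) ∧ x ∈ X)) (fun h' => h'.2 h), zero_add]
      obtain ⟨⟨w, rfl⟩, hx⟩ := h
      exact ind_true (hx.2 w)
    · rw [ind_false h, add_zero]
      congr 1
      exact propext ⟨fun h' => ⟨h', h⟩, fun h' => h'.1⟩
  have hSd : avg (fun x => ind (x ∈ S)) = avg (fun t : Fin n → Option α => avg (fun x : Fin m → Option α =>
      ind (Sum.elim t x ∈ S ∧ ¬ (t ∈ Set.range (sev V) ∧ x ∈ X)))) + q * avg (fun x => ind (x ∈ X)) := by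
    rw [avg_sumArrow]
    simp only [hpt, avg_add, avg_mul_left]
    congr 1
    rw [avg_range (sev_injective hVp), avg_const]
  have hSφ : avg (fun x => ind (x ∈ S) * φ x) = avg (fun t : Fin n → Option α => avg (fun x : Fin m → Option α =>
      ind (Sum.elim t x ∈ S ∧ ¬ (t ∈ Set.range (sev V) ∧ x ∈ X)) * φ (Sum.elim t x)))
      + avg (fun x => ind (x ∈ X) * (q * avg (fun w => φ (Sum.elim (sev V w) x)))) := by
    rw [avg_sumArrow]
    simp only [hpt, add_mul, avg_add]
    congr 1
    rw [avg_comm]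
    congr 1
    funext x
    have := avg_range (sev_injective hVp) (fun t => φ (Sum.elim t x))
    rw [← hq] at this
    rw [← this, ← avg_mul_left]
    congr 1
    funext t
    ring
  have h2 : avg (fun x => ind (x ∈ X) * (q * avg (fun w => φ (Sum.elim (sev V w) x)))) ≤ 0 := by
    apply avg_nonpos
    intro x
    have h3 := (hφ.slice' x).2 V hVp
    have h4 := ind_nonneg (x ∈ X)
    have h5 : q * avg (fun w => φ (Sum.elim (sev V w) x)) ≤ 0 :=
      mul_nonpos_of_nonneg_of_nonpos hqpos.le h3
    exact mul_nonpos_of_nonneg_of_nonpos h4 h5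
  have h1 : avg (fun t : Fin n → Option α => avg (fun x : Fin m → Option α =>
      ind (Sum.elim t x ∈ S ∧ ¬ (t ∈ Set.range (sev V) ∧ x ∈ X)) * φ (Sum.elim t x)))
      ≤ avg (fun t : Fin n → Option α => β0 + lam * avg (fun x : Fin m → Option α =>
      ind (Sum.elim t x ∈ S ∧ ¬ (t ∈ Set.range (sev V) ∧ x ∈ X)))) := by
    apply avg_mono
    intro t
    refine hM0 (Fin m) inferInstance (by simpa using hm) _ (hφ.slice t)
      {x | Sum.elim t x ∈ S ∧ ¬ (t ∈ Set.range (sev V) ∧ x ∈ X)} ?_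
    rintro x y hxy ⟨hx1, hx2⟩
    exact ⟨hS _ _ ((Sim.refl a _).elim hxy) hx1, fun h => hx2 ⟨h.1, hXi _ _ hxy.symm h.2⟩⟩
  rw [avg_add, avg_const, avg_mul_left] at h1
  rw [hSφ]
  set D' := avg (fun t : Fin n → Option α => avg (fun x : Fin m → Option α =>
      ind (Sum.elim t x ∈ S ∧ ¬ (t ∈ Set.range (sev V) ∧ x ∈ X)))) with hD'
  have h6 : D' ≤ (1 - ρ) * avg (fun x => ind (x ∈ S)) := by
    have h7 : ρ ≤ q * r := min_le_right _ _
    have h8 : q * r ≤ q * avg (fun x => ind (x ∈ X)) := by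
      apply mul_le_mul_of_nonneg_left _ hqpos.le
      exact hV
    have hρ0 : 0 ≤ ρ := le_min zero_le_one (by positivity)
    nlinarith
  have h7 := mul_le_mul_of_nonneg_left h6 hl0
  rw [mul_assoc]
  linarith

lemma PL1 {α : Type} [Finite α] [Nonempty α] (H : ∀ δ : ℝ, 0 < δ → DHJ α δ)
    (a : α) (d : ℕ) (β0 : ℝ) (hβ0 : 0 < β0) :
    ∃ M0 : ℕ, ∀ κ : Type, Finite κ → M0 ≤ Nat.card κ → ∀ φ : (κ → Option α) → ℝ, SubNeg d φ →
      ∀ S : Set (κ → Option α), Insens a S → avg (fun x => ind (x ∈ S) * φ x) ≤ β0 := by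
  obtain ⟨ρ, hρ0, hρ1, hstep⟩ := good_step H a d (β0 / 2) (by linarith)
  have key : ∀ j : ℕ, ∃ M : ℕ, ∀ κ : Type, Finite κ → M ≤ Nat.card κ →
      GoodAt a d (β0 / 2) ((1 - ρ) ^ j) κ := by
    intro j
    induction j with
    | zero =>
      refine ⟨0, fun κ _ _ φ hφ S hS => ?_⟩
      have h1 : avg (fun x => ind (x ∈ S) * φ x) ≤ avg (fun x => ind (x ∈ S)) := by
        apply avg_mono
        intro x
        nlinarith [ind_nonneg (x ∈ S), hφ.1 x]
      simp only [pow_zero, one_mul]; linarith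
    | succ j ih =>
      obtain ⟨M, hM⟩ := ih
      have := hstep ((1 - ρ) ^ j) (pow_nonneg (by linarith) _)
        (pow_le_one₀ (by linarith) (by linarith)) M hM
      simpa only [pow_succ] using this
  obtain ⟨j, hj⟩ := exists_pow_lt_of_lt_one (show 0 < β0 / 2 by linarith) (show 1 - ρ < 1 by linarith)
  obtain ⟨M, hM⟩ := key j
  refine ⟨M, fun κ _ hκ φ hφ S hS => ?_⟩
  have h1 := hM κ ‹_› hκ φ hφ S hS
  have h2 : avg (fun x => ind (x ∈ S)) ≤ 1 := avg_le fun x => ind_le_one _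
  have h3 : 0 ≤ avg (fun x => ind (x ∈ S)) := avg_nonneg fun x => ind_nonneg _
  have h4 : 0 ≤ (1 - ρ) ^ j := pow_nonneg (by linarith) _
  nlinarith

def scomp {κ α : Type} {d1 d : ℕ} (V : κ → α ⊕ Fin d1) (W : Fin d1 → α ⊕ Fin d) : κ → α ⊕ Fin d :=
  fun i => Sum.elim Sum.inl W (V i)

lemma scomp_proper {κ α : Type} {d1 d : ℕ} {V : κ → α ⊕ Fin d1} {W : Fin d1 → α ⊕ Fin d}
    (hV : SProper V) (hW : SProper W) : SProper (scomp V W) := by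
  intro q
  obtain ⟨j, hj⟩ := hW q
  obtain ⟨i, hi⟩ := hV j
  exact ⟨i, by simp [scomp, hi, hj]⟩

lemma sev_scomp {κ α : Type} {d1 d : ℕ} (V : κ → α ⊕ Fin d1) (W : Fin d1 → α ⊕ Fin d)
    (x : Fin d → α) : sev (scomp V W) x = sev V (sev W x) := by
  funext i
  simp only [sev, scomp]
  cases V i <;> simp [sev]

lemma PL {α : Type} [Finite α] [Nonempty α] (H : ∀ δ : ℝ, 0 < δ → DHJ α δ)
    (F : Finset α) : ∀ (d : ℕ) (β0 : ℝ) (hβ0 : 0 < β0),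
    ∃ M0 : ℕ, ∀ κ : Type, Finite κ → M0 ≤ Nat.card κ → ∀ φ : (κ → Option α) → ℝ, SubNeg d φ →
      ∀ S : α → Set (κ → Option α), (∀ b ∈ F, Insens b (S b)) →
        avg (fun x => ind (∀ b ∈ F, x ∈ S b) * φ x) ≤ β0 := by
  classical
  induction F using Finset.induction_on with
  | empty =>
    intro d β0 hβ0
    refine ⟨d, fun κ _ hκ φ hφ S _ => ?_⟩
    obtain ⟨m, hm, ⟨e⟩⟩ := exists_split (ι := κ) (κ := Fin d) (n := 0) (by simpa using hκ)
    have h1 : (fun x => ind (∀ b ∈ (∅ : Finset α), x ∈ S b) * φ x) = φ := by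
      funext x
      rw [ind_true (by simp), one_mul]
    rw [h1, ← avg_arrowEquiv e, avg_sumArrow']
    refine le_trans (avg_nonpos fun t => ?_) hβ0.le
    exact ((hφ.transport e).slice' t).2 Sum.inr (fun q => ⟨q, rfl⟩)
  | insert a F ha ih =>
    intro d β0 hβ0
    obtain ⟨d1, hd1⟩ := ih d (β0 / 2) (by linarith)
    obtain ⟨M, hM⟩ := PL1 H a d1 (β0 / 2) (by linarith)
    refine ⟨M, fun κ _ hκ φ hφ S hS => ?_⟩
    set ψ : (κ → Option α) → ℝ := fun x => ind (∀ b ∈ F, x ∈ S b) * φ x - β0 / 2 with hψ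
    have h1 : SubNeg d1 ψ := by
      refine ⟨fun x => ?_, fun V hV => ?_⟩
      · have := hφ.1 x
        have h2 := ind_nonneg (∀ b ∈ F, x ∈ S b)
        have h3 := ind_le_one (∀ b ∈ F, x ∈ S b)
        simp only [hψ]
        nlinarith
      · simp only [hψ]
        rw [avg_sub, avg_const]
        have := hd1 (Fin d1) inferInstance (by simp) (fun w => φ (sev V w))
          ⟨fun x => hφ.1 _, fun W hW => by
            have := hφ.2 _ (scomp_proper hV hW)
            simpa only [sev_scomp] using this⟩ (fun b => {w | sev V w ∈ S b})
          (fun b hb x y hxy hx => hS b (Finset.mem_insert_of_mem hb) _ _ (hxy.sev V) hx)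
        simp only [Set.mem_setOf_eq] at this
        linarith
    have h2 := hM κ ‹_› hκ ψ h1 (S a) (hS a (Finset.mem_insert_self _ _))
    have h3 : (fun x => ind (x ∈ S a) * ψ x) = fun x =>
        ind (∀ b ∈ insert a F, x ∈ S b) * φ x - β0 / 2 * ind (x ∈ S a) := by
      funext x
      have : ind (∀ b ∈ insert a F, x ∈ S b) = ind (x ∈ S a) * ind (∀ b ∈ F, x ∈ S b) := by
        rw [← ind_and]; congr 1; simp
      rw [this]; simp only [hψ]; ring
    rw [h3, avg_sub, avg_mul_left] at h2
    have h4 : avg (fun x => ind (x ∈ S a)) ≤ 1 := avg_le fun x => ind_le_one _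
    nlinarith

end TwoK


namespace TwoK

lemma LineProp.transport {α ι ι' : Type} [Finite α] [Finite ι] [Finite ι'] {δ : ℝ} (e : ι ≃ ι')
    (h : LineProp α δ ι') : LineProp α δ ι := by
  intro A hA
  rw [← avg_arrowEquiv e] at hA
  obtain ⟨l, ⟨i, hi⟩, hl⟩ := h {x | (fun i => x (e i)) ∈ A} hA
  exact ⟨fun i => l (e i), ⟨e.symm i, by simpa using hi⟩, hl⟩

lemma avg_update {m : ℕ} {Y : Type} [Finite Y] [Nonempty Y] (j : Fin m) (f : (Fin m → Y) → ℝ) :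
    avg (fun z : Fin m → Y => avg (fun y : Y => f (Function.update z j y))) = avg f := by
  classical
  rw [← avg_equiv (Equiv.funSplitAt j Y).symm f, avg_prod,
    ← avg_equiv (Equiv.funSplitAt j Y).symm, avg_prod]
  have : ∀ (a y : Y) (b : {i // i ≠ j} → Y), Function.update ((Equiv.funSplitAt j Y).symm (a, b)) j y
      = (Equiv.funSplitAt j Y).symm (y, b) := by
    intro a y b
    funext i
    by_cases hi : i = j
    · subst hi; simp [Equiv.funSplitAt, Equiv.piSplitAt]
    · simp [Equiv.funSplitAt, Equiv.piSplitAt, hi]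
  simp only [this]
  rw [avg_const, avg_comm]

lemma avg_lower {X : Type} [Finite X] [Nonempty X] (f : X → ℝ) (c η : ℝ) (hη : 0 ≤ η)
    (h1 : ∀ x, f x ≤ c + η) (h2 : c - η ≤ avg f) (x : X) : c - 2 * (Nat.card X : ℝ) * η ≤ f x := by
  classical
  have := Fintype.ofFinite X
  have hpos : (0 : ℝ) < Fintype.card X := by exact_mod_cast Fintype.card_pos
  rw [avg_eq, le_div_iff₀ hpos, ← Finset.add_sum_erase _ _ (Finset.mem_univ x)] at h2
  have h3 : ∑ y ∈ Finset.univ.erase x, f y ≤ ∑ y ∈ Finset.univ.erase x, (c + η) :=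
    Finset.sum_le_sum fun y _ => h1 y
  rw [Finset.sum_const, Finset.card_erase_of_mem (Finset.mem_univ x), nsmul_eq_mul,
    Finset.card_univ, Nat.cast_sub (Fintype.card_pos)] at h3
  rw [Nat.card_eq_fintype_card]
  push_cast at h3
  nlinarith

def zx {m M : ℕ} {α : Type} (z : Fin m → Fin M → Option α) (j : Fin m) (c : Option (Fin M)) :
    Option α := c.elim none (z j)

def eW {m M : ℕ} {α : Type} (z : Fin m → Fin M → Option α) (w : Fin m → α)
    (p : Fin m × Option (Fin M)) : Option α := some ((zx z p.1 p.2).getD (w p.1))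

def lineW {m M : ℕ} {α : Type} (l : Fin m → Option α) (z : Fin m → Fin M → Option α)
    (p : Fin m × Option (Fin M)) : Option (Option α) :=
  (l p.1).elim ((zx z p.1 p.2).elim none (fun b => some (some b)))
    (fun b => some (some ((zx z p.1 p.2).getD b)))

def qW {m M : ℕ} {α : Type} (l : Fin m → Option α) (z : Fin m → Fin M → Option α)
    (p : Fin m × Option (Fin M)) : Option α := lev (lineW l z) none p

lemma lineW_some {m M : ℕ} {α : Type} (l : Fin m → Option α) (z : Fin m → Fin M → Option α) (a : α) :
    lev (lineW l z) (some a) = eW z (lev l a) := by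
  funext p
  simp only [lev, lineW, eW]
  cases l p.1 <;> cases zx z p.1 p.2 <;> simp

lemma dhj_step {α : Type} [Finite α] [Nonempty α] (H : ∀ δ : ℝ, 0 < δ → DHJ α δ)
    (δ : ℝ) (hδ : 0 < δ) (hδ1 : δ ≤ 1) (hgood : ∀ δ' : ℝ, δ < δ' → DHJ (Option α) δ') :
    ∃ η : ℝ, 0 < η ∧ DHJ (Option α) (δ - η) := by
  classical
  obtain ⟨m, hm⟩ := H (δ / 4) (by linarith)
  have hm' := hm (Fin m) inferInstance (by simp)
  have hcl : (1 : ℝ) ≤ Nat.card (Fin m → Option α) := by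
    exact_mod_cast (Nat.card_pos : 0 < Nat.card (Fin m → Option α))
  obtain ⟨θ, hθ⟩ : ∃ θ : ℝ, θ = δ / 4 / (Nat.card (Fin m → Option α) : ℝ) := ⟨_, rfl⟩
  have hθ0 : 0 < θ := by rw [hθ]; positivity
  have hθ1 : θ ≤ 1 / 4 := by
    rw [hθ, div_le_iff₀ (by linarith)]; nlinarith
  obtain ⟨N1, hN1⟩ := hgood (δ + δ * θ / 8) (by nlinarith [mul_pos hδ hθ0])
  have hka : (1 : ℝ) ≤ Nat.card α := by exact_mod_cast (Nat.card_pos : 0 < Nat.card α)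
  obtain ⟨β0, hβ0⟩ : ∃ β0 : ℝ, β0 = δ * θ / 8 / (Nat.card α : ℝ) := ⟨_, rfl⟩
  have hβpos : 0 < β0 := by rw [hβ0]; positivity
  have hkβ : (Nat.card α : ℝ) * β0 = δ * θ / 8 := by rw [hβ0]; field_simp
  have hft := Fintype.ofFinite α
  let en : α ≃ Fin (Fintype.card α) := Fintype.equivFin α
  let Fa : α → Finset α := fun a => Finset.univ.filter (fun b => en b ≤ en a)
  choose M0 hM0 using fun a => PL H (Fa a) N1 β0 hβpos
  obtain ⟨M, hM⟩ : ∃ M : ℕ, ∀ a, M0 a ≤ M :=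
    ⟨∑ a, M0 a, fun a => Finset.single_le_sum (f := M0) (fun _ _ => Nat.zero_le _) (Finset.mem_univ a)⟩
  let κ : Type := Fin m × Option (Fin M)
  obtain ⟨T, hT⟩ : ∃ T : ℝ, T = Nat.card (κ → Option α) := ⟨_, rfl⟩
  have hT1 : 1 ≤ T := by
    rw [hT]; exact_mod_cast (Nat.card_pos : 0 < Nat.card (κ → Option α))
  obtain ⟨η, hη⟩ : ∃ η : ℝ, η = δ * θ / 16 / T := ⟨_, rfl⟩
  have hηpos : 0 < η := by rw [hη]; positivity
  have hTη : 2 * T * η = δ * θ / 8 := by rw [hη]; field_simp; norm_num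
  refine ⟨η, hηpos, ?_⟩
  obtain ⟨N2, hN2⟩ := hgood (δ + η) (by linarith)
  refine ⟨Nat.card κ + N2, fun ι _ hι => ?_⟩
  obtain ⟨n, hn, ⟨e⟩⟩ := exists_split (ι := ι) (κ := κ) (n := N2) hι
  refine LineProp.transport e ?_
  intro A hA
  by_contra hline
  -- section densities
  have hup : ∀ t : κ → Option α, avg (fun x : Fin n → Option α => ind (Sum.elim t x ∈ A)) ≤ δ + η := by
    intro t
    by_contra! hc
    obtain ⟨l, ⟨i, hi⟩, hl⟩ := hN2 (Fin n) inferInstance (by simpa using hn)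
      {x | Sum.elim t x ∈ A} hc.le
    refine hline ⟨Sum.elim (fun p => some (t p)) l, ⟨Sum.inr i, hi⟩, fun a => ?_⟩
    have h5 : Sum.elim t (lev l a) ∈ A := hl a
    convert h5 using 1
    funext i
    cases i <;> simp [lev]
  rw [avg_sumArrow] at hA
  have hlow : ∀ t : κ → Option α,
      δ - δ * θ / 8 ≤ avg (fun x : Fin n → Option α => ind (Sum.elim t x ∈ A)) := by
    intro t
    have := avg_lower _ δ η hηpos.le hup hA t
    rw [← hT, hTη] at this
    exact this
  -- find the line l
  have h1 : ∀ z : Fin m → Fin M → Option α, δ / 4 ≤ avg (fun x : Fin n → Option α =>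
      ind (δ / 4 ≤ avg (fun w : Fin m → α => ind (Sum.elim (eW z w) x ∈ A)))) := by
    intro z
    have h2 : δ / 2 ≤ avg (fun x : Fin n → Option α =>
        avg (fun w : Fin m → α => ind (Sum.elim (eW z w) x ∈ A))) := by
      rw [avg_comm]
      apply le_avg
      intro w
      refine le_trans ?_ (hlow (eW z w))
      nlinarith
    have h3 := markov (fun x => avg_le (fun w => ind_le_one _)) (by linarith) h2
    have h4 : δ / 2 / 2 = δ / 4 := by ring
    rwa [h4] at h3
  have h2 : δ / 4 ≤ avg (fun p : (Fin m → Fin M → Option α) × (Fin n → Option α) =>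
      ind (δ / 4 ≤ avg (fun w : Fin m → α => ind (Sum.elim (eW p.1 w) p.2 ∈ A)))) := by
    rw [avg_prod]
    exact le_avg h1
  obtain ⟨l, hl⟩ := avg_pigeon (Y := Fin m → Option α) _
    (fun p l => (∃ i, l i = none) ∧ ∀ a, Sum.elim (eW p.1 (lev l a)) p.2 ∈ A)
    (fun p hp => by
      obtain ⟨l, hl1, hl2⟩ := hm' {w | Sum.elim (eW p.1 w) p.2 ∈ A} hp
      exact ⟨l, hl1, hl2⟩) h2
  rw [← hθ, avg_prod] at hl
  have hlp : ∃ i, l i = none := by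
    by_contra hlp
    have : avg (fun x : Fin m → Fin M → Option α => avg fun y : Fin n → Option α =>
        ind ((∃ i, l i = none) ∧ ∀ a, Sum.elim (eW x (lev l a)) y ∈ A)) ≤ 0 :=
      avg_nonpos fun x => avg_nonpos fun y => by rw [ind_false (fun h => hlp h.1)]
    simp only [] at hl
    linarith
  obtain ⟨j0, hj0⟩ := hlp
  rw [← avg_update j0] at hl
  obtain ⟨z, hz⟩ := exists_le_of_avg hl
  clear hl
  let zy : (Fin M → Option α) → (Fin m → Fin M → Option α) := fun y => Function.update z j0 y
  let D : (Fin n → Option α) → α → Set (Fin M → Option α) :=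
    fun x a => {y | Sum.elim (eW (zy y) (lev l a)) x ∈ A}
  let E : (Fin n → Option α) → Set (Fin M → Option α) := fun x => {y | Sum.elim (qW l (zy y)) x ∈ A}
  have hDavg : θ ≤ avg (fun x => avg (fun y => ind (∀ a, y ∈ D x a))) := by
    rw [avg_comm]
    refine le_trans hz (avg_mono fun y => avg_mono fun x => ind_mono fun h => h.2)
  have hEavg : δ - δ * θ / 8 ≤ avg (fun x => avg (fun y => ind (y ∈ E x))) := by
    rw [avg_comm]
    exact le_avg fun y => hlow (qW l (zy y))
  have hdisj : ∀ x y, y ∈ E x → ¬ ∀ a, y ∈ D x a := by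
    intro x y hyE hyD
    refine hline ⟨Sum.elim (lineW l (zy y)) (fun i => some (x i)), ⟨Sum.inl (j0, none), ?_⟩, fun b => ?_⟩
    · simp [lineW, hj0, zx]
    · have : lev (Sum.elim (lineW l (zy y)) (fun i => some (x i))) b
          = Sum.elim (lev (lineW l (zy y)) b) x := by
        funext i
        cases i <;> simp [lev]
      rw [this]
      cases b with
      | none => exact hyE
      | some a => rw [lineW_some]; exact hyD a
  have hDins : ∀ x a, Insens a (D x a) := by
    intro x a y y' hyy hy
    have : eW (zy y) (lev l a) = eW (zy y') (lev l a) := by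
      funext ⟨j, c⟩
      simp only [eW, zx]
      by_cases hj : j = j0
      · subst hj
        cases c with
        | none => rfl
        | some c =>
          simp only [zy, Function.update_self, Option.elim, lev, hj0, Option.getD_none]
          rcases hyy c with h | ⟨h, h'⟩
          · rw [h]
          · rcases h with h | h <;> rcases h' with h' | h' <;> rw [h, h'] <;> rfl
      · cases c with
        | none => rfl
        | some c => simp [zy, Function.update_of_ne hj]
    show Sum.elim (eW (zy y') (lev l a)) x ∈ A
    rw [← this]; exact hy
  have hDcins : ∀ x a, Insens a (D x a)ᶜ := fun x a y y' hyy hy hy' => hy (hDins x a _ _ hyy.symm hy')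
  set c : ℝ := δ + δ * θ / 8 with hc
  have hsub : ∀ x, SubNeg N1 (fun y => ind (y ∈ E x) - c) := by
    intro x
    refine ⟨fun y => ?_, fun V hV => ?_⟩
    · have := ind_le_one (y ∈ E x)
      have : 0 < c := by positivity
      linarith
    · rw [avg_sub, avg_const]
      by_contra! hcon
      obtain ⟨l', ⟨i', hi'⟩, hl'⟩ := hN1 (Fin N1) inferInstance (by simp)
        {w | sev V w ∈ E x} (sub_pos.1 hcon).le
      obtain ⟨i'', hi''⟩ := hV i'
      refine hline ⟨Sum.elim (fun p : κ => if p.1 = j0 then p.2.elim (some none)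
        (fun c => (V c).elim some l') else some (qW l z p)) (fun i => some (x i)),
        ⟨Sum.inl (j0, some i''), ?_⟩, fun b => ?_⟩
      · simp [hi'', hi']
      · have h5 := hl' b
        simp only [Set.mem_setOf_eq, E] at h5
        convert h5 using 1
        funext i
        cases i with
        | inr i => simp [lev]
        | inl p =>
          obtain ⟨j, c⟩ := p
          simp only [lev, Sum.elim_inl, qW, lineW, zx]
          by_cases hj : j = j0
          · subst hj
            cases c with
            | none => simp [hj0]
            | some c =>
              simp only [if_true, Option.elim, hj0, zy, Function.update_self, sev, lev]
              cases V c with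
              | inl v => cases v <;> simp
              | inr q =>
                simp only [Sum.elim_inr, lev]
                generalize (l' q).getD b = v
                cases v <;> simp
          · simp [hj, zy]
  have hfin : ∀ x, avg (fun y => ind (y ∈ E x)) ≤
      c * (1 - avg (fun y => ind (∀ a, y ∈ D x a))) + δ * θ / 8 := by
    intro x
    let Sa : α → α → Set (Fin M → Option α) := fun a b => if b = a then (D x a)ᶜ else D x b
    let P : α → (Fin M → Option α) → Prop := fun a y => ∀ b ∈ Fa a, y ∈ Sa a b
    have hP : ∀ a, avg (fun y => ind (P a y) * (ind (y ∈ E x) - c)) ≤ β0 := by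
      intro a
      refine hM0 a (Fin M) inferInstance (by simpa using hM a) _ (hsub x) (Sa a) (fun b _ => ?_)
      simp only [Sa]
      split_ifs with hb
      · subst hb; exact hDcins x b
      · exact hDins x b
    have hPD : ∀ y, (∑ a, ind (P a y)) = 1 - ind (∀ a, y ∈ D x a) := by
      intro y
      by_cases hy : ∀ a, y ∈ D x a
      · rw [ind_true hy, Finset.sum_eq_zero, sub_self]
        intro a _
        apply ind_false
        intro h
        have := h a (by simp [Fa])
        simp only [Sa, if_true] at this
        exact this (hy a)
      · rw [ind_false hy, sub_zero]
        push Not at hy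
        have hne : (Finset.univ.filter (fun a => y ∉ D x a)).Nonempty := by
          obtain ⟨a, ha⟩ := hy; exact ⟨a, by simp [ha]⟩
        obtain ⟨a, ha, hmin⟩ := Finset.exists_min_image _ en hne
        simp only [Finset.mem_filter, Finset.mem_univ, true_and] at ha hmin
        rw [Finset.sum_eq_single a]
        · apply ind_true
          intro b hb
          simp only [Fa, Finset.mem_filter, Finset.mem_univ, true_and] at hb
          simp only [Sa]
          split_ifs with hba
          · exact ha
          · by_contra hbD
            have := hmin b hbD
            exact hba (en.injective (le_antisymm hb this))
        · intro b _ hba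
          apply ind_false
          intro h
          have h6 := h b (by simp [Fa])
          simp only [Sa, if_true] at h6
          have h7 := hmin b h6
          have h8 := h a (by simp [Fa, h7])
          simp only [Sa, if_neg (Ne.symm hba)] at h8
          exact ha h8
        · simp
    have h8 : avg (fun y => ind (y ∈ E x)) ≤ avg (fun y => ∑ a, (ind (P a y) * (ind (y ∈ E x) - c))
        + c * (1 - ind (∀ a, y ∈ D x a))) := by
      apply avg_mono
      intro y
      rw [← Finset.sum_mul, hPD]
      by_cases hy : y ∈ E x
      · rw [ind_false (hdisj x y hy)]; linarith
      · rw [ind_false hy]; linarith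
    rw [avg_add, avg_sum, avg_mul_left, avg_sub, avg_const] at h8
    have h9 : ∑ a, avg (fun y => ind (P a y) * (ind (y ∈ E x) - c)) ≤ ∑ a : α, β0 :=
      Finset.sum_le_sum fun a _ => hP a
    rw [Finset.sum_const, Finset.card_univ, nsmul_eq_mul, ← Nat.card_eq_fintype_card, hkβ] at h9
    linarith
  have hall := avg_mono hfin
  rw [avg_add, avg_mul_left, avg_sub, avg_const, avg_const] at hall
  have hc0 : 0 < c := by positivity
  have h10 : c * θ ≤ c * avg (fun x => avg (fun y => ind (∀ a, y ∈ D x a))) :=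
    mul_le_mul_of_nonneg_left hDavg hc0.le
  have h11 : δ - δ * θ / 8 ≤ c * (1 - θ) + δ * θ / 8 := by linarith
  have h12 : 0 < δ * θ := by positivity
  rw [hc] at h11
  nlinarith

lemma dhj_mono {α : Type} {δ δ' : ℝ} (h : DHJ α δ) (hle : δ ≤ δ') : DHJ α δ' := by
  obtain ⟨n, hn⟩ := h
  exact ⟨n, fun ι _ hι A hA => hn ι ‹_› hι A (hle.trans hA)⟩

lemma dhj_option {α : Type} [Finite α] [Nonempty α] (H : ∀ δ : ℝ, 0 < δ → DHJ α δ) :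
    ∀ δ : ℝ, 0 < δ → DHJ (Option α) δ := by
  by_contra! hcon
  obtain ⟨δ0, hδ0, hbad⟩ := hcon
  set B : Set ℝ := {δ | ¬ DHJ (Option α) δ} with hB
  have hbdd : ∀ δ ∈ B, δ ≤ 1 := by
    intro δ hδ
    by_contra! h1
    refine hδ ⟨0, fun ι _ _ A hA => ?_⟩
    have : avg (fun x => ind (x ∈ A)) ≤ 1 := avg_le fun x => ind_le_one _
    linarith
  have hne : B.Nonempty := ⟨δ0, hbad⟩
  have hBdd : BddAbove B := ⟨1, hbdd⟩
  have h0 : δ0 ≤ sSup B := le_csSup hBdd hbad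
  have h1 : sSup B ≤ 1 := csSup_le hne hbdd
  obtain ⟨η, hη, hg⟩ := dhj_step H (sSup B) (by linarith) h1 (fun δ' hδ' => by
    by_contra hb
    exact absurd (le_csSup hBdd hb) (not_le.2 hδ'))
  obtain ⟨b, hb, hlt⟩ := exists_lt_of_lt_csSup hne (show sSup B - η < sSup B by linarith)
  exact hb (dhj_mono hg hlt.le)

lemma dhj_one {α : Type} [Finite α] [Nonempty α] [Subsingleton α] (δ : ℝ) (hδ : 0 < δ) : DHJ α δ := by
  refine ⟨1, fun ι _ hι A hA => ?_⟩
  obtain ⟨x, hx⟩ := exists_le_of_avg hA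
  have hxA : x ∈ A := by
    by_contra hxA
    rw [ind_false hxA] at hx; linarith
  have : Nonempty ι := by
    by_contra h
    rw [not_nonempty_iff] at h
    simp at hι
  obtain ⟨i⟩ := this
  refine ⟨fun _ => none, ⟨i, rfl⟩, fun a => ?_⟩
  convert hxA

theorem dhj_fin (k : ℕ) : ∀ δ : ℝ, 0 < δ → DHJ (Fin (k + 1)) δ := by
  have key : ∀ k : ℕ, ∃ (α : Type) (_ : Finite α) (_ : Nonempty α), Nat.card α = k + 1 ∧
      ∀ δ : ℝ, 0 < δ → DHJ α δ := by
    intro k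
    induction k with
    | zero => exact ⟨Unit, inferInstance, inferInstance, by simp, dhj_one⟩
    | succ k ih =>
      obtain ⟨α, h1, h2, h3, h4⟩ := ih
      exact ⟨Option α, inferInstance, inferInstance, by rw [Finite.card_option, h3], dhj_option h4⟩
  obtain ⟨α, h1, h2, h3, h4⟩ := key k
  have e : α ≃ Fin (k + 1) := Finite.equivFinOfCardEq h3
  intro δ hδ
  obtain ⟨n, hn⟩ := h4 δ hδ
  refine ⟨n, fun ι _ hι A hA => ?_⟩
  rw [← avg_equiv (Equiv.arrowCongr (Equiv.refl ι) e)] at hA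
  obtain ⟨l, ⟨i, hi⟩, hl⟩ := hn ι ‹_› hι {x | (fun i => e (x i)) ∈ A} hA
  refine ⟨fun i => (l i).map e, ⟨i, by simp [hi]⟩, fun a => ?_⟩
  have h5 : (fun i => e (lev l (e.symm a) i)) ∈ A := hl (e.symm a)
  convert h5 using 1
  funext i
  simp only [lev]
  cases l i <;> simp

/-- Szemerédi's theorem in `ZMod p`. -/
theorem szem (δ : ℝ) (hδ : 0 < δ) (L : ℕ) : ∃ p0 : ℕ, ∀ p : ℕ, p.Prime → p0 ≤ p →
    ∀ B : Set (ZMod p), δ * p ≤ Nat.card B →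
      ∃ x d : ZMod p, d ≠ 0 ∧ ∀ i : ℕ, i < L → x + (i : ZMod p) * d ∈ B := by
  obtain ⟨n, hn⟩ := dhj_fin L δ hδ
  refine ⟨n + 1, fun p hp hpn B hB => ?_⟩
  have : NeZero p := ⟨hp.ne_zero⟩
  have h1 : δ ≤ avg (fun x : ZMod p => ind (x ∈ B)) := by
    classical
    rw [avg_eq, le_div_iff₀ (by exact_mod_cast Fintype.card_pos), ZMod.card]
    have h0 : ∑ x : ZMod p, ind (x ∈ B) = (Nat.card B : ℝ) := by
      unfold ind
      rw [Finset.sum_boole, Nat.card_eq_fintype_card, Fintype.card_subtype]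
    rw [h0]
    exact hB
  have h2 : δ ≤ avg (fun x : ZMod p => avg (fun w : Fin n → Fin (L + 1) =>
      ind (x + ∑ i, ((w i : ℕ) : ZMod p) ∈ B))) := by
    rw [avg_comm]
    apply le_avg
    intro w
    have h0 := avg_equiv (Equiv.addRight (∑ i, ((w i : ℕ) : ZMod p))) (fun x => ind (x ∈ B))
    simp only [Equiv.coe_addRight] at h0
    rw [h0]
    exact h1
  obtain ⟨x, hx⟩ := exists_le_of_avg h2
  obtain ⟨l, ⟨i0, hi0⟩, hl⟩ := hn (Fin n) inferInstance (by simp)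
    {w | x + ∑ i, ((w i : ℕ) : ZMod p) ∈ B} hx
  set J : Finset (Fin n) := Finset.univ.filter (fun i => l i = none) with hJ
  have hJ1 : 1 ≤ J.card := Finset.card_pos.2 ⟨i0, by simp [hJ, hi0]⟩
  have hJ2 : J.card < p := by
    have : J.card ≤ n := (Finset.card_le_univ J).trans (by simp)
    omega
  refine ⟨x + ∑ i, ((((l i).getD 0 : Fin (L + 1)) : ℕ) : ZMod p), (J.card : ZMod p), ?_, ?_⟩
  · rw [Ne, ZMod.natCast_eq_zero_iff]
    intro h
    exact absurd (Nat.le_of_dvd hJ1 h) (by omega)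
  · intro i hi
    have h3 := hl ⟨i, by omega⟩
    simp only [Set.mem_setOf_eq] at h3
    convert h3 using 1
    rw [add_assoc]
    congr 1
    have h4 : (i : ZMod p) * (J.card : ZMod p) = ∑ j : Fin n, if l j = none then (i : ZMod p) else 0 := by
      rw [← Finset.sum_filter, Finset.sum_const, nsmul_eq_mul, mul_comm]
    rw [h4, ← Finset.sum_add_distrib]
    apply Finset.sum_congr rfl
    intro j _
    simp only [lev]
    cases l j <;> simp

end TwoK


namespace TwoK

/-! ### The integer problem: ladder -/

def FOne (k : ℕ) (R : Set ℤ) : Prop :=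
  ∀ x ∈ R, ∀ y ∈ R, ∃ i : ℕ, 1 ≤ i ∧ i ≤ k ∧ y + (i : ℤ) * (y - x) ∈ R

lemma FOne.affine {k : ℕ} {R : Set ℤ} (h : FOne k R) (q v : ℤ) : FOne k {n | q + n * v ∈ R} := by
  intro x hx y hy
  obtain ⟨i, h1, h2, h3⟩ := h _ hx _ hy
  refine ⟨i, h1, h2, ?_⟩
  show q + (y + (i : ℤ) * (y - x)) * v ∈ R
  convert h3 using 1
  ring

open Classical in
noncomputable def red (R : Set ℤ) (F : Finset ℤ) : Finset ℤ := F.filter (fun n => n ∈ R)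

lemma mem_red {R : Set ℤ} {F : Finset ℤ} {n : ℤ} : n ∈ red R F ↔ n ∈ F ∧ n ∈ R := by
  simp [red]

lemma ladder_step {k : ℕ} {R : Set ℤ} (h : FOne k R) (M : ℕ) (g X : ℤ) (hg : 0 ≤ g) (hgM : k * g ≤ M)
    (hX : (M : ℤ) ≤ X) :
    (red R (Finset.Icc 1 (X + g))).card ≤ (k + 1) * (red R (Finset.Icc 1 X)).card + 1 := by
  classical
  by_cases hne : ∃ y, y ∈ red R (Finset.Icc (X + 1) (X + g))
  swap
  · push Not at hne
    have : red R (Finset.Icc 1 (X + g)) ⊆ red R (Finset.Icc 1 X) := by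
      intro z hz
      rw [mem_red, Finset.mem_Icc] at hz ⊢
      refine ⟨⟨hz.1.1, ?_⟩, hz.2⟩
      by_contra hc
      exact hne z (mem_red.2 ⟨Finset.mem_Icc.2 ⟨by omega, hz.1.2⟩, hz.2⟩)
    have := Finset.card_le_card this
    nlinarith
  obtain ⟨y, hy, hmin⟩ := Finset.exists_min_image (red R (Finset.Icc (X + 1) (X + g))) id hne
  simp only [id] at hmin
  have hy' := hy
  rw [mem_red, Finset.mem_Icc] at hy
  have hsub : red R (Finset.Icc 1 (X + g)) ⊆ red R (Finset.Icc 1 X) ∪ ({y} ∪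
      red R (Finset.Icc (y + 1) (X + g))) := by
    intro z hz
    simp only [Finset.mem_union, mem_red, Finset.mem_Icc, Finset.mem_singleton] at hz ⊢
    by_cases h1 : z ≤ X
    · left; exact ⟨⟨hz.1.1, h1⟩, hz.2⟩
    · right
      have := hmin z (mem_red.2 ⟨Finset.mem_Icc.2 ⟨by omega, hz.1.2⟩, hz.2⟩)
      by_cases h2 : z = y
      · left; exact h2
      · right; exact ⟨⟨by omega, hz.1.2⟩, hz.2⟩
  have hinj : (red R (Finset.Icc (y + 1) (X + g))).card ≤ k * (red R (Finset.Icc 1 X)).card := by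
    have hex : ∀ z ∈ red R (Finset.Icc (y + 1) (X + g)), ∃ p : ℕ × ℤ,
        p ∈ (Finset.Icc 1 k) ×ˢ red R (Finset.Icc 1 X) ∧ p.2 = y + (p.1 : ℤ) * (y - z) := by
      intro z hz
      rw [mem_red, Finset.mem_Icc] at hz
      obtain ⟨i, hi1, hi2, hi3⟩ := h z hz.2 y hy.2
      refine ⟨(i, y + (i : ℤ) * (y - z)), ?_, rfl⟩
      rw [Finset.mem_product, Finset.mem_Icc, mem_red, Finset.mem_Icc]
      refine ⟨⟨hi1, hi2⟩, ⟨?_, ?_⟩, hi3⟩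
      · have h1 : (i : ℤ) * (z - y) ≤ k * g := by
          apply mul_le_mul <;> [exact_mod_cast hi2; linarith [hy.1.1]; linarith; positivity]
        show 1 ≤ y + (i : ℤ) * (y - z)
        nlinarith [hy.1.1]
      · show y + (i : ℤ) * (y - z) ≤ X
        by_contra hc
        have h1 : (1 : ℤ) ≤ i := by exact_mod_cast hi1
        have h2 : y + (i : ℤ) * (y - z) ≤ y - 1 := by nlinarith
        have := hmin (y + (i : ℤ) * (y - z)) (mem_red.2 ⟨Finset.mem_Icc.2 ⟨by omega, by omega⟩, hi3⟩)
        omega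
    choose! p hp1 hp2 using hex
    have := Finset.card_le_card_of_injOn p hp1 (by
      intro z hz z' hz' heq
      have h1 := hp2 z hz
      have h2 := hp2 z' hz'
      have h3 := (Finset.mem_Icc.1 (Finset.mem_product.1 (hp1 z hz)).1).1
      rw [← heq, h1] at h2
      have h4 : ((p z).1 : ℤ) ≠ 0 := by
        have : (p z).1 ≠ 0 := by omega
        exact_mod_cast this
      have h5 : ((p z).1 : ℤ) * (y - z) = ((p z).1 : ℤ) * (y - z') := by linarith
      have := mul_left_cancel₀ h4 h5
      linarith)
    rwa [Finset.card_product, Nat.card_Icc, Nat.add_sub_cancel] at this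
  have h1 := Finset.card_le_card hsub
  have h2 := Finset.card_union_le (red R (Finset.Icc 1 X)) ({y} ∪ red R (Finset.Icc (y + 1) (X + g)))
  have h3 := Finset.card_union_le {y} (red R (Finset.Icc (y + 1) (X + g)))
  rw [Finset.card_singleton] at h3
  linarith

lemma ladder {k : ℕ} (hk : 1 ≤ k) {R : Set ℤ} (h : FOne k R) (M : ℕ) (hM : k ≤ M)
    (hblue : ∀ n : ℤ, 1 ≤ n → n ≤ M → n ∉ R) (K : ℕ) :
    (red R (Finset.Icc 1 ((K : ℤ) * M))).card ≤ (k + 2) ^ (2 * k * K) := by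
  classical
  have key : ∀ j : ℕ, (red R (Finset.Icc 1 ((M : ℤ) + j * ((M / k : ℕ) : ℤ)))).card ≤ (k + 2) ^ j := by
    intro j
    induction j with
    | zero =>
      have : red R (Finset.Icc 1 ((M : ℤ) + (0 : ℕ) * ((M / k : ℕ) : ℤ))) = ∅ := by
        rw [Finset.eq_empty_iff_forall_notMem]
        intro z hz
        rw [mem_red, Finset.mem_Icc] at hz
        exact hblue z hz.1.1 (by simpa using hz.1.2) hz.2
      rw [this]; simp
    | succ j ih =>
      have h1 := ladder_step h M ((M / k : ℕ) : ℤ) ((M : ℤ) + j * ((M / k : ℕ) : ℤ)) (by positivity)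
        (by exact_mod_cast Nat.mul_div_le M k) (by
          have : (0 : ℤ) ≤ j * ((M / k : ℕ) : ℤ) := by positivity
          linarith)
      have h2 : (M : ℤ) + (j + 1 : ℕ) * ((M / k : ℕ) : ℤ) = (M : ℤ) + j * ((M / k : ℕ) : ℤ) + ((M / k : ℕ) : ℤ) := by
        push_cast; ring
      rw [h2, pow_succ]
      have h3 : 1 ≤ (k + 2) ^ j := Nat.one_le_pow _ _ (by omega)
      nlinarith
  refine le_trans (Finset.card_le_card ?_) (key (2 * k * K))
  intro z hz
  rw [mem_red, Finset.mem_Icc] at hz ⊢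
  refine ⟨⟨hz.1.1, hz.1.2.trans ?_⟩, hz.2⟩
  have h1 : M < k * (M / k) + k := by
    have := Nat.div_add_mod M k
    have := Nat.mod_lt M (show 0 < k by omega)
    omega
  have h2 : 1 ≤ M / k := Nat.div_pos hM (by omega)
  have h3 : M ≤ 2 * k * (M / k) := by nlinarith
  have h4 : K * M ≤ M + 2 * k * K * (M / k) := by nlinarith
  exact_mod_cast h4

/-! ### Sparseness along progressions -/

lemma sparse {k : ℕ} {R : Set ℤ} (hF : FOne k R) (M U N T : ℕ) (θ : ℝ) (s h : ℤ) (hh : 1 ≤ h)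
    (hMcond : ∀ y : ℤ, ∃ n : ℕ, n ≤ M ∧ y + n * h ∈ R)
    (hR : ((red R (Finset.Icc 1 (N : ℤ))).card : ℝ) ≤ 2 * θ * N)
    (hU : 1 ≤ U) (hMU : 2 * M ≤ U) (hT : (N : ℝ) ≤ 40 * (k + 1) * T) (hT0 : 1 ≤ T)
    (hup : s ≤ N + T) (hlow : (k + 1) * (2 * h * U + 2 * T) + 1 ≤ s) (hN : 1 ≤ N) :
    ((red R ((Finset.Icc (1 : ℤ) U).image (fun n => s - h * n))).card : ℝ) ≤ 240 * k * (k + 1) ^ 2 * θ * U := by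
  classical
  -- the set of good indices
  set P : Finset ℤ := (Finset.Icc (1 : ℤ) U).filter (fun n => s - h * n ∈ R) with hP
  have hcard : (red R ((Finset.Icc (1 : ℤ) U).image (fun n => s - h * n))).card ≤ P.card := by
    have : red R ((Finset.Icc (1 : ℤ) U).image (fun n => s - h * n)) ⊆ P.image (fun n => s - h * n) := by
      intro z hz
      rw [mem_red, Finset.mem_image] at hz
      obtain ⟨⟨n, hn, rfl⟩, hz⟩ := hz
      exact Finset.mem_image_of_mem _ (Finset.mem_filter.2 ⟨hn, hz⟩)
    exact (Finset.card_le_card this).trans Finset.card_image_le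
  choose ny hny1 hny2 using fun t : ℤ => hMcond (s - h * U - t - h * M)
  -- y t = s - h U - t - h (M - ny t)
  have hex : ∀ q ∈ (Finset.Ico (T : ℤ) (2 * T)) ×ˢ P, ∃ w : ℕ × (ℤ × ℤ),
      w ∈ (Finset.Icc 1 k) ×ˢ ((Finset.Icc (-((k + 1) * M : ℤ)) (k * U)) ×ˢ red R (Finset.Icc 1 (N : ℤ))) ∧
      w.2.1 = w.1 * q.2 - (w.1 + 1) * (M - ny q.1) ∧
      w.2.2 = s - (w.1 + 1) * (h * U + q.1) + h * w.2.1 := by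
    rintro ⟨t, n⟩ hq
    simp only [Finset.mem_product, Finset.mem_Ico, hP, Finset.mem_filter, Finset.mem_Icc] at hq
    obtain ⟨⟨ht1, ht2⟩, ⟨hn1, hn2⟩, hnR⟩ := hq
    obtain ⟨i, hi1, hi2, hi3⟩ := hF _ hnR _ (hny2 t)
    have hi1' : (1 : ℤ) ≤ i := by exact_mod_cast hi1
    have hi2' : (i : ℤ) ≤ k := by exact_mod_cast hi2
    have hny : (0 : ℤ) ≤ M - ny t := by have := hny1 t; omega
    have hny' : (M : ℤ) - ny t ≤ M := by omega
    have hMU' : (2 : ℤ) * M ≤ U := by exact_mod_cast hMU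
    have hz : s - h * U - t - h * M + ny t * h + (i : ℤ) * (s - h * U - t - h * M + ny t * h - (s - h * n))
        = s - (i + 1) * (h * U + t) + h * (i * n - (i + 1) * (M - ny t)) := by ring
    rw [hz] at hi3
    refine ⟨(i, (i * n - (i + 1) * (M - ny t), s - (i + 1) * (h * U + t) + h * (i * n - (i + 1) * (M - ny t)))),
      ?_, rfl, rfl⟩
    simp only [Finset.mem_product, Finset.mem_Icc, mem_red]
    refine ⟨⟨hi1, hi2⟩, ⟨?_, ?_⟩, ⟨?_, ?_⟩, hi3⟩
    · have h1 : ((i : ℤ) + 1) * (M - ny t) ≤ (k + 1) * M :=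
        mul_le_mul (by linarith) hny' hny (by positivity)
      have h2 : (0 : ℤ) ≤ i * n := by positivity
      linarith
    · have h1 : (i : ℤ) * n ≤ k * U := mul_le_mul hi2' hn2 (by linarith) (by positivity)
      have h2 : 0 ≤ ((i : ℤ) + 1) * (M - ny t) := by positivity
      linarith
    · have h1 : ((i : ℤ) + 1) * (h * U + t + h * (M - ny t)) ≤ (k + 1) * (2 * h * U + 2 * T) := by
        apply mul_le_mul (by linarith)
        · have : h * (M - ny t) ≤ h * U := mul_le_mul_of_nonneg_left (by linarith) (by linarith)
          linarith
        · have : (0 : ℤ) ≤ T := by positivity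
          have : 0 ≤ h * (M - ny t) := by positivity
          have : 0 ≤ h * (U : ℤ) := by positivity
          linarith
        · positivity
      have h2 : 0 ≤ h * (i * n) := by positivity
      have h3 : s - (i + 1) * (h * U + t) + h * (i * n - (i + 1) * (M - ny t))
        = s - ((i : ℤ) + 1) * (h * U + t + h * (M - ny t)) + h * (i * n) := by ring
      linarith
    · have h3 : s - (i + 1) * (h * U + t) + h * (i * n - (i + 1) * (M - ny t))
        = s - t - h * U - i * (h * (U - n)) - i * t - (i + 1) * (h * (M - ny t)) := by ring
      have h4 : 0 ≤ (i : ℤ) * (h * (U - n)) := by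
        have : 0 ≤ (U : ℤ) - n := by linarith
        positivity
      have h5 : 0 ≤ ((i : ℤ) + 1) * (h * (M - ny t)) := by positivity
      have h6 : 0 ≤ h * (U : ℤ) := by positivity
      have h7 : 0 ≤ (i : ℤ) * t := by
        have : 0 ≤ t := by linarith [Int.natCast_nonneg T]
        positivity
      linarith
  choose! w hw1 hw2 hw3 using hex
  have hinj := Finset.card_le_card_of_injOn w hw1 (by
    rintro ⟨t, n⟩ hq ⟨t', n'⟩ hq' heq
    have a1 := hw2 _ hq
    have a2 := hw3 _ hq
    have b1 := hw2 _ hq'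
    have b2 := hw3 _ hq'
    have hi := (Finset.mem_Icc.1 (Finset.mem_product.1 (hw1 _ hq)).1).1
    rw [← heq] at b1 b2
    simp only at a1 a2 b1 b2
    have hi' : (1 : ℤ) ≤ ((w (t, n)).1 : ℤ) := by exact_mod_cast hi
    have c1 : (((w (t, n)).1 : ℤ) + 1) * t = (((w (t, n)).1 : ℤ) + 1) * t' := by linarith
    have c2 := mul_left_cancel₀ (by positivity) c1
    subst c2
    have c3 : ((w (t, n)).1 : ℤ) * n = ((w (t, n)).1 : ℤ) * n' := by linarith
    have c4 := mul_left_cancel₀ (by positivity) c3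
    rw [c4])
  rw [Finset.card_product, Finset.card_product, Finset.card_product, Int.card_Ico, Nat.card_Icc,
    Int.card_Icc] at hinj
  have e1 : (2 * (T : ℤ) - T).toNat = T := by omega
  have e2 : ((k : ℤ) * U + 1 - -((k + 1) * M : ℤ)).toNat = k * U + 1 + (k + 1) * M := by
    have : (k : ℤ) * U + 1 - -((k + 1) * M : ℤ) = ((k * U + 1 + (k + 1) * M : ℕ) : ℤ) := by
      push_cast; ring
    rw [this, Int.toNat_natCast]
  rw [e1, e2, Nat.add_sub_cancel] at hinj
  have hinj' : (T : ℝ) * P.card ≤ k * ((k * U + 1 + (k + 1) * M) * (red R (Finset.Icc 1 (N : ℤ))).card) := by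
    exact_mod_cast hinj
  have f1 : (k * U + 1 + (k + 1) * M : ℝ) ≤ (3 * (k + 1)) * U := by
    have a1 : (1 : ℝ) ≤ U := by exact_mod_cast hU
    have a2 : (2 : ℝ) * M ≤ U := by exact_mod_cast hMU
    have a3 : (0 : ℝ) ≤ k := by positivity
    have a4 : (k + 1 : ℝ) * (2 * M) ≤ (k + 1) * U := by gcongr
    nlinarith
  have f2 : (T : ℝ) * P.card ≤ k * ((3 * (k + 1)) * U * (2 * θ * N)) := by
    refine hinj'.trans ?_
    gcongr
  have hθ : 0 ≤ 2 * θ * N := le_trans (by positivity) hR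
  have hNpos : (0 : ℝ) < N := by exact_mod_cast hN
  have hθ0 : 0 ≤ θ := by
    by_contra hc
    push Not at hc
    nlinarith
  have f3 : (T : ℝ) * P.card ≤ (T : ℝ) * (240 * k * (k + 1) ^ 2 * θ * U) := by
    refine f2.trans ?_
    have : (k : ℝ) * ((3 * (k + 1)) * U * (2 * θ * N)) = (k * (3 * (k + 1)) * U * (2 * θ)) * N := by ring
    rw [this]
    have h2 : (k * (3 * (k + 1)) * U * (2 * θ)) * (N : ℝ) ≤ (k * (3 * (k + 1)) * U * (2 * θ)) * (40 * (k + 1) * T) := by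
      gcongr
    refine h2.trans (le_of_eq (by ring))
  have hTpos : (0 : ℝ) < T := by exact_mod_cast hT0
  have f4 := le_of_mul_le_mul_left f3 hTpos
  exact le_trans (by exact_mod_cast hcard) f4

end TwoK


namespace TwoK

/-! ### Fourier analysis on `ZMod m` -/

noncomputable def expSum {m : ℕ} [NeZero m] (A : Finset (ZMod m)) (ξ : ZMod m) : ℂ :=
  ∑ x ∈ A, ZMod.stdAddChar (ξ * x)

lemma norm_stdAddChar {m : ℕ} [NeZero m] (x : ZMod m) : ‖(ZMod.stdAddChar x : ℂ)‖ = 1 := by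
  rw [ZMod.stdAddChar_apply]; exact Circle.norm_coe _

lemma sum_stdAddChar {m : ℕ} [NeZero m] (t : ZMod m) :
    ∑ ξ : ZMod m, (ZMod.stdAddChar (ξ * t) : ℂ) = if t = 0 then (m : ℂ) else 0 := by
  have := AddChar.sum_mulShift t (ZMod.isPrimitive_stdAddChar m)
  rw [this]; simp

lemma conj_stdAddChar {m : ℕ} [NeZero m] (x : ZMod m) :
    (starRingEnd ℂ) (ZMod.stdAddChar x : ℂ) = ZMod.stdAddChar (-x) := by
  rw [ZMod.stdAddChar_apply, ZMod.stdAddChar_apply, AddChar.map_neg_eq_inv, Circle.coe_inv_eq_conj]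

lemma conj_expSum {m : ℕ} [NeZero m] (A : Finset (ZMod m)) (ξ : ZMod m) :
    (starRingEnd ℂ) (expSum A ξ) = expSum A (-ξ) := by
  simp only [expSum, map_sum, conj_stdAddChar, neg_mul]

lemma norm_expSum_neg {m : ℕ} [NeZero m] (A : Finset (ZMod m)) (ξ : ZMod m) :
    ‖expSum A (-ξ)‖ = ‖expSum A ξ‖ := by
  rw [← conj_expSum]; simp

lemma norm_expSum_le {m : ℕ} [NeZero m] (A : Finset (ZMod m)) (ξ : ZMod m) :
    ‖expSum A ξ‖ ≤ m := by
  calc ‖expSum A ξ‖ ≤ ∑ x ∈ A, ‖(ZMod.stdAddChar (ξ * x) : ℂ)‖ := norm_sum_le _ _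
    _ = A.card := by simp [norm_stdAddChar]
    _ ≤ m := by
      have := Finset.card_le_univ A
      rw [ZMod.card] at this
      exact_mod_cast this

lemma parseval {m : ℕ} [NeZero m] (A : Finset (ZMod m)) :
    ∑ ξ : ZMod m, ‖expSum A ξ‖ ^ 2 = m * A.card := by
  have : ((∑ ξ : ZMod m, ‖expSum A ξ‖ ^ 2 : ℝ) : ℂ) = ((m * A.card : ℝ) : ℂ) := by
    push_cast
    have h1 : ∀ ξ : ZMod m, ((‖expSum A ξ‖ : ℂ)) ^ 2
        = ∑ x ∈ A, ∑ y ∈ A, (ZMod.stdAddChar (ξ * (x - y)) : ℂ) := by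
      intro ξ
      rw [← Complex.mul_conj', conj_expSum, expSum, expSum, Finset.sum_mul_sum]
      refine Finset.sum_congr rfl fun x _ => Finset.sum_congr rfl fun y _ => ?_
      rw [← AddChar.map_add_eq_mul]; congr 1; ring
    rw [Finset.sum_congr rfl fun ξ _ => h1 ξ, Finset.sum_comm]
    have h2 : ∀ x ∈ A, ∑ ξ : ZMod m, ∑ y ∈ A, (ZMod.stdAddChar (ξ * (x - y)) : ℂ) = m := by
      intro x hx
      rw [Finset.sum_comm]
      simp only [sum_stdAddChar, sub_eq_zero]
      rw [Finset.sum_ite_eq]; simp [hx]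
    rw [Finset.sum_congr rfl h2]; simp [mul_comm]
  exact_mod_cast this

open Classical in
lemma spectrum_card {m : ℕ} [NeZero m] (A : Finset (ZMod m)) (ε : ℝ) (hε : 0 < ε) :
    ((Finset.univ.filter fun ξ : ZMod m => ε * m ≤ ‖expSum A ξ‖).card : ℝ) ≤ 1 / ε ^ 2 := by
  have hm : (0 : ℝ) < m := by exact_mod_cast NeZero.pos m
  have h := parseval A
  have hA : (A.card : ℝ) ≤ m := by
    have := Finset.card_le_univ A
    rw [ZMod.card] at this
    exact_mod_cast this
  set G := Finset.univ.filter fun ξ : ZMod m => ε * m ≤ ‖expSum A ξ‖ with hG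
  have h1 : (G.card : ℝ) * (ε * m) ^ 2 ≤ m * m := by
    calc (G.card : ℝ) * (ε * m) ^ 2 = ∑ ξ ∈ G, (ε * m) ^ 2 := by simp
      _ ≤ ∑ ξ ∈ G, ‖expSum A ξ‖ ^ 2 := by
        refine Finset.sum_le_sum fun ξ hξ => ?_
        have := (Finset.mem_filter.1 hξ).2
        exact pow_le_pow_left₀ (by positivity) this 2
      _ ≤ ∑ ξ : ZMod m, ‖expSum A ξ‖ ^ 2 :=
        Finset.sum_le_sum_of_subset_of_nonneg (Finset.subset_univ _) fun _ _ _ => by positivity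
      _ ≤ m * m := by rw [h]; gcongr
  rw [le_div_iff₀ (by positivity)]
  have h2 : (G.card : ℝ) * ε ^ 2 * (m * m) ≤ 1 * (m * m) := by nlinarith
  exact le_of_mul_le_mul_right h2 (by positivity)

open Classical in
/-- number of triples -/
noncomputable def trip {m : ℕ} (A F : Finset (ZMod m)) (s t w : ZMod m) : ℕ :=
  ((A ×ˢ A).filter fun q => s * q.2 - t * q.1 + w ∈ F).card

lemma trip_fourier {m : ℕ} [NeZero m] (A F : Finset (ZMod m)) (s t w : ZMod m) :
    (m : ℂ) * trip A F s t w = ∑ ξ : ZMod m, ZMod.stdAddChar (ξ * w) *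
      (expSum A (s * ξ) * expSum A (-(t * ξ)) * expSum F (-ξ)) := by
  classical
  have h1 : (m : ℂ) * trip A F s t w = ∑ x ∈ A, ∑ y ∈ A, ∑ z ∈ F,
      (if s * y - t * x + w - z = 0 then (m : ℂ) else 0) := by
    rw [trip, Finset.card_filter, Finset.sum_product]
    push_cast
    rw [Finset.mul_sum]
    refine Finset.sum_congr rfl fun x _ => ?_
    rw [Finset.mul_sum]
    refine Finset.sum_congr rfl fun y _ => ?_
    simp only [sub_eq_zero, Finset.sum_ite_eq]
    simp
  rw [h1]
  simp only [← sum_stdAddChar]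
  have h2 : ∀ ξ : ZMod m, ZMod.stdAddChar (ξ * w) *
      (expSum A (s * ξ) * expSum A (-(t * ξ)) * expSum F (-ξ)) =
      ∑ x ∈ A, ∑ y ∈ A, ∑ z ∈ F, (ZMod.stdAddChar (ξ * (s * y - t * x + w - z)) : ℂ) := by
    intro ξ
    simp only [expSum]
    rw [mul_comm (∑ x ∈ A, _) (∑ x ∈ A, _), Finset.sum_mul_sum, Finset.sum_mul, Finset.mul_sum]
    refine Finset.sum_congr rfl fun x _ => ?_
    rw [Finset.sum_mul, Finset.mul_sum]
    refine Finset.sum_congr rfl fun y _ => ?_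
    rw [Finset.mul_sum, Finset.mul_sum]
    refine Finset.sum_congr rfl fun z _ => ?_
    rw [← AddChar.map_add_eq_mul, ← AddChar.map_add_eq_mul, ← AddChar.map_add_eq_mul]
    congr 1; ring
  simp only [h2]
  symm
  rw [Finset.sum_comm]
  refine Finset.sum_congr rfl fun x _ => ?_
  rw [Finset.sum_comm]
  refine Finset.sum_congr rfl fun y _ => ?_
  rw [Finset.sum_comm]

lemma cs_expSum {m : ℕ} [Fact m.Prime] (A : Finset (ZMod m)) (s t : ZMod m) (hs : s ≠ 0)
    (ht : t ≠ 0) :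
    ∑ ξ : ZMod m, ‖expSum A (s * ξ)‖ * ‖expSum A (-(t * ξ))‖ ≤ m * A.card := by
  have h := parseval A
  have h1 : ∑ ξ : ZMod m, ‖expSum A (s * ξ)‖ ^ 2 = m * A.card := by
    rw [← h]
    exact Equiv.sum_comp (Equiv.mulLeft₀ s hs) (fun ξ => ‖expSum A ξ‖ ^ 2)
  have h2 : ∑ ξ : ZMod m, ‖expSum A (-(t * ξ))‖ ^ 2 = m * A.card := by
    simp only [norm_expSum_neg]
    rw [← h]
    exact Equiv.sum_comp (Equiv.mulLeft₀ t ht) (fun ξ => ‖expSum A ξ‖ ^ 2)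
  have h3 : ∑ ξ : ZMod m, ‖expSum A (s * ξ)‖ * ‖expSum A (-(t * ξ))‖
      ≤ ∑ ξ : ZMod m, (‖expSum A (s * ξ)‖ ^ 2 + ‖expSum A (-(t * ξ))‖ ^ 2) / 2 := by
    refine Finset.sum_le_sum fun ξ _ => ?_
    nlinarith [sq_nonneg (‖expSum A (s * ξ)‖ - ‖expSum A (-(t * ξ))‖)]
  rw [← Finset.sum_div, Finset.sum_add_distrib, h1, h2] at h3
  linarith

lemma trip_avg {m : ℕ} [Fact m.Prime] (A F : Finset (ZMod m)) (s t : ZMod m) (hs : s ≠ 0)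
    (ht : t ≠ 0) (ε : ℝ) (hε : 0 < ε) (Ω : Finset ℤ)
    (hΩ : ∀ ξ : ZMod m, ε * m ≤ ‖expSum F ξ‖ → ∀ ω ∈ Ω,
      ‖(ZMod.stdAddChar (ξ * (ω : ZMod m)) : ℂ) - 1‖ ≤ 2 * ε) :
    (Ω.card : ℝ) * trip A F s t 0 ≤ ∑ ω ∈ Ω, (trip A F s t (ω : ZMod m) : ℝ)
      + Ω.card * (2 * ε * m * A.card) := by
  have hm : (0 : ℝ) < m := by exact_mod_cast (Fact.out : m.Prime).pos
  have h1 : (m : ℂ) * ((Ω.card : ℂ) * trip A F s t 0 - ∑ ω ∈ Ω, (trip A F s t (ω : ZMod m) : ℂ))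
      = ∑ ξ : ZMod m, (expSum A (s * ξ) * expSum A (-(t * ξ)) * expSum F (-ξ)) *
        ∑ ω ∈ Ω, (1 - ZMod.stdAddChar (ξ * (ω : ZMod m))) := by
    have h0 : (m : ℂ) * ((Ω.card : ℂ) * trip A F s t 0 - ∑ ω ∈ Ω, (trip A F s t (ω : ZMod m) : ℂ))
        = ∑ ω ∈ Ω, ((m : ℂ) * trip A F s t 0 - (m : ℂ) * trip A F s t (ω : ZMod m)) := by
      rw [Finset.sum_sub_distrib, mul_sub, Finset.mul_sum]; simp; ring
    rw [h0]
    simp only [trip_fourier, ← Finset.sum_sub_distrib, Finset.mul_sum]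
    rw [Finset.sum_comm]
    refine Finset.sum_congr rfl fun ξ _ => Finset.sum_congr rfl fun ω _ => ?_
    simp; ring
  have h2 : ∀ ξ : ZMod m, ‖expSum F (-ξ) *
        ∑ ω ∈ Ω, (1 - (ZMod.stdAddChar (ξ * (ω : ZMod m)) : ℂ))‖ ≤ Ω.card * (2 * ε * m) := by
    intro ξ
    rw [norm_mul, norm_expSum_neg]
    by_cases hξ : ε * m ≤ ‖expSum F ξ‖
    · have h3 : ‖∑ ω ∈ Ω, (1 - (ZMod.stdAddChar (ξ * (ω : ZMod m)) : ℂ))‖ ≤ Ω.card * (2 * ε) := by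
        refine (norm_sum_le_of_le Ω (n := fun _ => 2 * ε) fun ω hω => ?_).trans (by simp)
        rw [norm_sub_rev]; exact hΩ ξ hξ ω hω
      calc _ ≤ (m : ℝ) * (Ω.card * (2 * ε)) :=
            mul_le_mul (norm_expSum_le F ξ) h3 (norm_nonneg _) hm.le
        _ = _ := by ring
    · have h3 : ‖∑ ω ∈ Ω, (1 - (ZMod.stdAddChar (ξ * (ω : ZMod m)) : ℂ))‖ ≤ Ω.card * 2 := by
        refine (norm_sum_le_of_le Ω (n := fun _ => 2) fun ω hω => ?_).trans (by simp)
        refine (norm_sub_le _ _).trans ?_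
        rw [norm_stdAddChar]; norm_num
      calc _ ≤ (ε * m) * (Ω.card * 2) :=
            mul_le_mul (not_le.1 hξ).le h3 (norm_nonneg _) (by positivity)
        _ = _ := by ring
  have h4 : ‖(m : ℂ) * ((Ω.card : ℂ) * trip A F s t 0
      - ∑ ω ∈ Ω, (trip A F s t (ω : ZMod m) : ℂ))‖ ≤ (Ω.card * (2 * ε * m)) * (m * A.card) := by
    rw [h1]
    calc _ ≤ ∑ ξ : ZMod m, (Ω.card * (2 * ε * m)) *
          (‖expSum A (s * ξ)‖ * ‖expSum A (-(t * ξ))‖) := by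
          refine norm_sum_le_of_le _ fun ξ _ => ?_
          rw [mul_assoc, norm_mul, norm_mul, mul_comm]
          exact mul_le_mul_of_nonneg_right (h2 ξ) (by positivity)
      _ ≤ _ := by
          rw [← Finset.mul_sum]
          exact mul_le_mul_of_nonneg_left (cs_expSum A s t hs ht) (by positivity)
  have h5 : (m : ℝ) * ((Ω.card : ℝ) * trip A F s t 0
      - ∑ ω ∈ Ω, (trip A F s t (ω : ZMod m) : ℝ)) ≤ (Ω.card * (2 * ε * m)) * (m * A.card) := by
    refine le_trans (le_abs_self _) ?_
    rw [← Real.norm_eq_abs, ← Complex.norm_real]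
    push_cast
    exact h4
  have h6 : (m : ℝ) * ((Ω.card : ℝ) * trip A F s t 0
      - ∑ ω ∈ Ω, (trip A F s t (ω : ZMod m) : ℝ)) ≤ m * (Ω.card * (2 * ε * m * A.card)) := by
    refine h5.trans (le_of_eq (by ring))
  have := le_of_mul_le_mul_left h6 hm
  linarith

open Classical in
lemma fourier_core {m : ℕ} [Fact m.Prime] (A F : Finset (ZMod m)) (hA : A.Nonempty)
    (s t : ZMod m) (hs : s ≠ 0)
    (ht : t ≠ 0) (ε c : ℝ) (hε : 0 < ε) (hc : 0 < c) (Ω : Finset ℤ)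
    (hΩ : ∀ ξ : ZMod m, ε * m ≤ ‖expSum F ξ‖ → ∀ ω ∈ Ω,
      ‖(ZMod.stdAddChar (ξ * (ω : ZMod m)) : ℂ) - 1‖ ≤ 2 * ε)
    (hT : 2 * c * (A.card : ℝ) ^ 2 ≤ trip A F s t 0) (hεA : 2 * ε * m ≤ c * A.card) :
    ∃ x ∈ A, ∃ y ∈ A, c * Ω.card ≤ (Ω.filter fun ω : ℤ => s * y - t * x + (ω : ZMod m) ∈ F).card := by
  have h := trip_avg A F s t hs ht ε hε Ω hΩ
  by_contra hcon
  push Not at hcon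
  have h1 : ∑ ω ∈ Ω, (trip A F s t (ω : ZMod m) : ℝ)
      = ∑ x ∈ A, ∑ y ∈ A, ((Ω.filter fun ω : ℤ => s * y - t * x + (ω : ZMod m) ∈ F).card : ℝ) := by
    simp only [trip, Finset.card_filter, Finset.sum_product]
    push_cast
    rw [Finset.sum_comm]
    refine Finset.sum_congr rfl fun x _ => ?_
    rw [Finset.sum_comm]
  have h2 : ∑ x ∈ A, ∑ y ∈ A, ((Ω.filter fun ω : ℤ => s * y - t * x + (ω : ZMod m) ∈ F).card : ℝ)
      < ∑ x ∈ A, ∑ y ∈ A, c * Ω.card := by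
    refine Finset.sum_lt_sum_of_nonempty hA fun x hx => ?_
    exact Finset.sum_lt_sum_of_nonempty hA fun y hy => hcon x hx y hy
  simp only [Finset.sum_const, nsmul_eq_mul] at h2
  have hA0 : (0 : ℝ) < A.card := by exact_mod_cast hA.card_pos
  have h3 : (Ω.card : ℝ) * (2 * c * (A.card : ℝ) ^ 2) ≤ Ω.card * trip A F s t 0 := by gcongr
  have h4 : (Ω.card : ℝ) * (2 * ε * m * A.card) ≤ Ω.card * (c * A.card * A.card) := by gcongr
  nlinarith

end TwoK


namespace TwoK

lemma stdAddChar_near {m : ℕ} [NeZero m] (ξ : ZMod m) (ω t : ℤ) (ε : ℝ)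
    (h : |(ξ.val : ℝ) / m * ω - t| ≤ ε / 4) :
    ‖(ZMod.stdAddChar (ξ * (ω : ZMod m)) : ℂ) - 1‖ ≤ 2 * ε := by
  have hm : (m : ℂ) ≠ 0 := by exact_mod_cast NeZero.ne m
  have h1 : ξ * (ω : ZMod m) = (((ξ.val : ℤ) * ω : ℤ) : ZMod m) := by
    push_cast; rw [ZMod.natCast_zmod_val]
  rw [h1, ZMod.stdAddChar_coe]
  have h2 : Complex.exp (2 * Real.pi * Complex.I * (((ξ.val : ℤ) * ω : ℤ) : ℂ) / m)
      = Complex.exp (Complex.I * ((2 * Real.pi * ((ξ.val : ℝ) / m * ω - t) : ℝ) : ℂ)) := by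
    rw [Complex.exp_eq_exp_iff_exists_int]
    refine ⟨t, ?_⟩
    push_cast; field_simp; ring
  rw [h2]
  refine (Real.norm_exp_I_mul_ofReal_sub_one_le).trans ?_
  rw [Real.norm_eq_abs, abs_mul, abs_of_pos (by positivity : 0 < 2 * Real.pi)]
  have h3 := Real.pi_le_four
  have h4 : 2 * Real.pi * |(ξ.val : ℝ) / m * ω - t| ≤ 2 * 4 * (ε / 4) := by
    gcongr
  linarith

lemma exists_cluster (N D : ℕ) (hN : 1 ≤ N) (B : Finset ℤ)
    (hB : ∀ n ∈ B, 1 ≤ n ∧ n ≤ (N : ℤ)) :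
    ∃ A0 ⊆ B, (B.card : ℝ) ≤ (D + 1) * A0.card ∧ ∀ x ∈ A0, ∀ y ∈ A0, (x - y) * D ≤ (N : ℤ) := by
  classical
  have hN' : (0 : ℤ) < N := by exact_mod_cast hN
  obtain ⟨j, hj, hj2⟩ := Finset.exists_le_card_fiber_of_nsmul_le_card_of_maps_to (s := B)
    (t := Finset.Icc (0 : ℤ) D) (f := fun n => n * D / N) (b := (B.card : ℝ) / (D + 1))
    (by
      intro n hn
      obtain ⟨h1, h2⟩ := hB n hn
      rw [Finset.mem_Icc]
      refine ⟨by positivity, ?_⟩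
      apply Int.ediv_le_of_le_mul hN'
      nlinarith) ⟨0, by simp⟩
    (by
      rw [Int.card_Icc]; simp
      have : (0 : ℝ) < D + 1 := by positivity
      rw [mul_div_cancel₀ _ this.ne'])
  refine ⟨_, Finset.filter_subset (fun n => n * D / N = j) _, ?_, ?_⟩
  · rw [div_le_iff₀ (by positivity)] at hj2
    linarith
  · intro x hx y hy
    have hx' := (Finset.mem_filter.1 hx).2
    have hy' := (Finset.mem_filter.1 hy).2
    have e1 := Int.emod_add_mul_ediv (x * D) N
    have e2 := Int.emod_add_mul_ediv (y * D) N
    have b1 := Int.emod_lt_of_pos (x * D) hN'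
    have b2 := Int.emod_nonneg (y * D) hN'.ne'
    rw [hx'] at e1
    rw [hy'] at e2
    linarith [sub_mul x y (D : ℤ)]

lemma exists_enum {α : Type*} [Inhabited α] (G : Finset α) (r : ℕ) (h : G.card ≤ r) :
    ∃ g : Fin r → α, ∀ x ∈ G, ∃ i, g i = x := by
  classical
  refine ⟨fun i => if h : (i : ℕ) < G.card then (G.equivFin.symm ⟨i, h⟩ : α) else default, ?_⟩
  intro x hx
  refine ⟨⟨G.equivFin ⟨x, hx⟩, lt_of_lt_of_le (G.equivFin ⟨x, hx⟩).2 h⟩, ?_⟩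
  simp

lemma cast_eq_of_close {m : ℕ} (a b : ℤ) (h : (a : ZMod m) = b) (h1 : a - b < m) (h2 : b - a < m) :
    a = b := by
  rw [ZMod.intCast_eq_intCast_iff_dvd_sub] at h
  obtain ⟨c, hc⟩ := h
  have hm : (0 : ℤ) < m := by
    by_contra hcon
    have : (0 : ℤ) ≤ m := by positivity
    omega
  have : c < 1 := by nlinarith
  have : -1 < c := by nlinarith
  have : c = 0 := by omega
  subst this; linarith

open Classical in
lemma pairs_half (A0 : Finset ℤ) :
    (A0.card : ℝ) ^ 2 / 2 ≤ ((A0 ×ˢ A0).filter fun q => q.2 ≤ q.1).card := by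
  have h1 : ((A0 ×ˢ A0).filter fun q => q.1 ≤ q.2).card = ((A0 ×ˢ A0).filter fun q => q.2 ≤ q.1).card := by
    refine Finset.card_bij (fun q _ => (q.2, q.1)) ?_ ?_ ?_
    · intro q hq; simp at hq ⊢; tauto
    · rintro ⟨a, b⟩ _ ⟨c, d⟩ _ h; simp at h ⊢; tauto
    · rintro ⟨a, b⟩ h; refine ⟨(b, a), ?_, rfl⟩; simp at h ⊢; tauto
  have h2 : (A0 ×ˢ A0) ⊆ ((A0 ×ˢ A0).filter fun q => q.1 ≤ q.2) ∪ ((A0 ×ˢ A0).filter fun q => q.2 ≤ q.1) := by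
    intro q hq
    rw [Finset.mem_union, Finset.mem_filter, Finset.mem_filter]
    rcases le_total q.1 q.2 with h | h <;> simp [hq, h]
  have h3 := (Finset.card_le_card h2).trans (Finset.card_union_le _ _)
  rw [h1, Finset.card_product] at h3
  have h4 : (A0.card : ℝ) * A0.card ≤ ((A0 ×ˢ A0).filter fun q => q.2 ≤ q.1).card
    + ((A0 ×ˢ A0).filter fun q => q.2 ≤ q.1).card := by exact_mod_cast h3
  nlinarith

open Classical in
/-- The density statement. -/
theorem dense (k : ℕ) (hk : 1 ≤ k) (θ : ℝ) (hθ : 0 < θ) :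
    ∃ (ε1 : ℝ) (r : ℕ), 0 < ε1 ∧ ∀ (R : Set ℤ) (N : ℕ), FOne k R → k + 1 ≤ N →
      θ * N / 2 ≤ (red R (Finset.Ioc ((N : ℤ) / 2) N)).card →
      ∃ (m : ℕ) (α : Fin r → ℝ), 2 * N < m ∧ m ≤ 4 * N ∧
        ∀ Ω : Finset ℤ, (∀ ω ∈ Ω, 10 * |ω| ≤ N ∧ ∀ γ, ∃ t : ℤ, |α γ * ω - t| ≤ ε1) →
        ∃ x0 : ℤ, 40 * (k + 1) * N ≤ 80 * (k + 1) * x0 + N ∧ 80 * (k + 1) * x0 ≤ 80 * (k + 1) * N + N ∧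
          (Ω.card : ℝ) ≤ 4 * k * (Ω.filter fun ω => x0 + ω ∈ R).card := by
  set D : ℕ := 80 * k * (k + 1) with hD
  have hkR : (1 : ℝ) ≤ k := by exact_mod_cast hk
  set ε : ℝ := θ / (64 * k * (D + 1)) with hεdef
  have hε : 0 < ε := by positivity
  refine ⟨ε / 4, ⌈1 / ε ^ 2⌉₊, by positivity, ?_⟩
  intro R N hF hN hB
  have hN1 : 1 ≤ N := by omega
  have hNR : (0 : ℝ) < N := by exact_mod_cast hN1
  obtain ⟨A0, hA0sub, hA0card, hA0diam⟩ := exists_cluster N D hN1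
    (red R (Finset.Ioc ((N : ℤ) / 2) N)) (by
      intro n hn
      rw [mem_red, Finset.mem_Ioc] at hn
      omega)
  obtain ⟨m, hmp, hm1, hm2⟩ := Nat.exists_prime_lt_and_le_two_mul (2 * N) (by omega)
  haveI : Fact m.Prime := ⟨hmp⟩
  have hmR : (m : ℝ) ≤ 4 * N := by exact_mod_cast (by omega : m ≤ 4 * N)
  have hA0R : ∀ x ∈ A0, x ∈ R ∧ (N : ℤ) < 2 * x ∧ x ≤ N := by
    intro x hx
    have := hA0sub hx
    rw [mem_red, Finset.mem_Ioc] at this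
    refine ⟨this.2, by omega, this.1.2⟩
  have hcard : θ * N / 2 ≤ (D + 1) * A0.card := hB.trans hA0card
  have hA0pos : 0 < A0.card := by
    have : (0 : ℝ) < (D + 1) * A0.card := lt_of_lt_of_le (by positivity) hcard
    have : (0 : ℝ) < A0.card := by
      by_contra h
      push Not at h
      have : (0 : ℝ) ≤ D + 1 := by positivity
      nlinarith
    exact_mod_cast this
  have hcastinj : ∀ x ∈ A0, ∀ y ∈ A0, (x : ZMod m) = y → x = y := by
    intro x hx y hy h
    have h1 := hA0R x hx
    have h2 := hA0R y hy
    exact cast_eq_of_close x y h (by omega) (by omega)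
  set A : Finset (ZMod m) := A0.image (fun x : ℤ => (x : ZMod m)) with hA
  have hAcard : A.card = A0.card := Finset.card_image_of_injOn (fun x hx y hy h => hcastinj x hx y hy h)
  set F : Finset (ZMod m) := (red R (Finset.Icc 1 (N : ℤ))).image (fun x : ℤ => (x : ZMod m)) with hFdef
  -- spectrum
  set Γ := Finset.univ.filter fun ξ : ZMod m => ε * m ≤ ‖expSum F ξ‖ with hΓ
  have hΓc : Γ.card ≤ ⌈1 / ε ^ 2⌉₊ := by
    have := (spectrum_card F ε hε).trans (Nat.le_ceil _)
    exact_mod_cast this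
  obtain ⟨g, hg⟩ := exists_enum Γ _ hΓc
  refine ⟨m, fun γ => ((g γ).val : ℝ) / m, hm1, by omega, ?_⟩
  intro Ω hΩ
  -- geometry of the third point
  have hgeo : ∀ x ∈ A0, ∀ y ∈ A0, ∀ i : ℕ, i ≤ k → 80 * ((k : ℤ) + 1) * |(i : ℤ) * (y - x)| ≤ N := by
    intro x hx y hy i hi
    have h1 := hA0diam x hx y hy
    have h2 := hA0diam y hy x hx
    have hi' : (i : ℤ) ≤ k := by exact_mod_cast hi
    have h3 : |y - x| * (D : ℤ) ≤ N := by
      rcases abs_cases (y - x) with ⟨h, _⟩ | ⟨h, _⟩ <;> rw [h] <;> linarith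
    rw [abs_mul, abs_of_nonneg (by positivity : (0 : ℤ) ≤ i)]
    have hDc : (D : ℤ) = 80 * k * (k + 1) := by rw [hD]; push_cast; ring
    rw [hDc] at h3
    have h4 : 80 * ((k : ℤ) + 1) * (i * |y - x|) ≤ 80 * ((k : ℤ) + 1) * (k * |y - x|) := by gcongr
    linarith
  have hgeo2 : ∀ x ∈ A0, ∀ y ∈ A0, ∀ i : ℕ, i ≤ k → 160 * |(i : ℤ) * (y - x)| ≤ N := by
    intro x hx y hy i hi
    have h1 := hgeo x hx y hy i hi
    have hk' : (1 : ℤ) ≤ k := by exact_mod_cast hk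
    nlinarith [abs_nonneg ((i : ℤ) * (y - x))]
  -- choose i
  have hsum : (A0.card : ℝ) ^ 2 / 2 ≤ ∑ i ∈ Finset.Icc 1 k,
      (trip A F ((i + 1 : ℕ) : ZMod m) (i : ZMod m) 0 : ℝ) := by
    refine (pairs_half A0).trans ?_
    have h1 : ((A0 ×ˢ A0).filter fun q => q.2 ≤ q.1) ⊆ (Finset.Icc 1 k).biUnion fun i =>
        (A0 ×ˢ A0).filter fun q => q.2 + (i : ℤ) * (q.2 - q.1) ∈ red R (Finset.Icc 1 (N : ℤ)) := by
      rintro ⟨x, y⟩ hq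
      rw [Finset.mem_filter, Finset.mem_product] at hq
      obtain ⟨⟨hx, hy⟩, hle⟩ := hq
      simp only at hx hy hle
      obtain ⟨i, hi1, hi2, hi3⟩ := hF x (hA0R x hx).1 y (hA0R y hy).1
      rw [Finset.mem_biUnion]
      refine ⟨i, Finset.mem_Icc.2 ⟨hi1, hi2⟩, ?_⟩
      rw [Finset.mem_filter, Finset.mem_product, mem_red, Finset.mem_Icc]
      have h2 := hgeo2 x hx y hy i hi2
      have h3 := hA0R y hy
      have h4 : (i : ℤ) * (y - x) ≤ 0 := mul_nonpos_of_nonneg_of_nonpos (by positivity) (by linarith)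
      rw [abs_of_nonpos h4] at h2
      refine ⟨⟨hx, hy⟩, ⟨?_, ?_⟩, hi3⟩
      · simp only; omega
      · simp only; omega
    have h2 := (Finset.card_le_card h1).trans Finset.card_biUnion_le
    have h3 : ∀ i ∈ Finset.Icc 1 k, ((A0 ×ˢ A0).filter fun q =>
        q.2 + (i : ℤ) * (q.2 - q.1) ∈ red R (Finset.Icc 1 (N : ℤ))).card
        ≤ trip A F ((i + 1 : ℕ) : ZMod m) (i : ZMod m) 0 := by
      intro i hi
      rw [trip]
      refine Finset.card_le_card_of_injOn (fun q => ((q.1 : ZMod m), (q.2 : ZMod m))) ?_ ?_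
      · rintro ⟨x, y⟩ hq
        rw [Finset.mem_coe, Finset.mem_filter, Finset.mem_product] at hq
        obtain ⟨⟨hx, hy⟩, hz⟩ := hq
        rw [Finset.mem_coe, Finset.mem_filter, Finset.mem_product]
        refine ⟨⟨Finset.mem_image_of_mem _ hx, Finset.mem_image_of_mem _ hy⟩, ?_⟩
        have := Finset.mem_image_of_mem (fun x : ℤ => (x : ZMod m)) hz
        rw [hFdef]
        convert this using 1
        push_cast; ring
      · rintro ⟨x, y⟩ hq ⟨x', y'⟩ hq' h
        rw [Finset.mem_coe, Finset.mem_filter, Finset.mem_product] at hq hq'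
        rw [Prod.mk.injEq] at h
        rw [hcastinj x hq.1.1 x' hq'.1.1 h.1, hcastinj y hq.1.2 y' hq'.1.2 h.2]
    have h4 := h2.trans (Finset.sum_le_sum h3)
    exact_mod_cast h4
  obtain ⟨i, hi, hiT⟩ : ∃ i ∈ Finset.Icc 1 k, (A0.card : ℝ) ^ 2 / 2 / k ≤
      (trip A F ((i + 1 : ℕ) : ZMod m) (i : ZMod m) 0 : ℝ) := by
    by_contra hcon
    push Not at hcon
    have := Finset.sum_lt_sum_of_nonempty ⟨1, Finset.mem_Icc.2 ⟨le_rfl, hk⟩⟩ hcon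
    rw [Finset.sum_const, Nat.card_Icc, nsmul_eq_mul] at this
    simp only [Nat.add_sub_cancel] at this
    rw [mul_div_cancel₀ _ (by positivity)] at this
    linarith
  rw [Finset.mem_Icc] at hi
  have hne : ∀ j : ℕ, 1 ≤ j → j ≤ k + 1 → ((j : ℕ) : ZMod m) ≠ 0 := by
    intro j hj1 hj2 h
    rw [ZMod.natCast_eq_zero_iff] at h
    have := Nat.le_of_dvd (by omega) h
    omega
  have hkpos : (0 : ℝ) < k := by linarith
  obtain ⟨x, hx, y, hy, hxy⟩ := fourier_core A F (by rw [← Finset.card_pos, hAcard]; exact hA0pos)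
    ((i + 1 : ℕ) : ZMod m) (i : ZMod m) (hne _ (by omega) (by omega)) (hne _ (by omega) (by omega))
    ε (1 / (4 * k)) hε (by positivity) Ω
    (by
      intro ξ hξ ω hω
      obtain ⟨γ, hγ⟩ := hg ξ (Finset.mem_filter.2 ⟨Finset.mem_univ _, hξ⟩)
      obtain ⟨t, ht⟩ := (hΩ ω hω).2 γ
      refine stdAddChar_near ξ ω t ε ?_
      rw [← hγ]; exact ht)
    (by
      rw [hAcard]
      refine le_trans (le_of_eq ?_) hiT
      field_simp; norm_num)
    (by
      rw [hAcard]
      have h1 : 2 * ε * m ≤ 2 * ε * (4 * N) := by gcongr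
      have h2 : 2 * ε * (4 * N) = (θ * N / 2) / (4 * k * (D + 1)) := by
        rw [hεdef]; field_simp; norm_num
      have h3 : (θ * N / 2) / (4 * k * (D + 1)) ≤ ((D + 1) * A0.card) / (4 * k * (D + 1)) := by
        gcongr
      have h4 : ((D + 1) * (A0.card : ℝ)) / (4 * k * (D + 1)) = 1 / (4 * k) * A0.card := by
        field_simp
      linarith)
  obtain ⟨x', hx', rfl⟩ := Finset.mem_image.1 hx
  obtain ⟨y', hy', rfl⟩ := Finset.mem_image.1 hy
  have g1 := hgeo x' hx' y' hy' i hi.2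
  have g2 := hgeo2 x' hx' y' hy' i hi.2
  have hy2 := hA0R y' hy'
  set w := (i : ℤ) * (y' - x') with hw
  have g3 := abs_le.1 (le_refl |w|)
  have hk1 : (1 : ℤ) ≤ k := by exact_mod_cast hk
  refine ⟨y' + w, ?_, ?_, ?_⟩
  · have : 80 * ((k : ℤ) + 1) * (-|w|) ≤ 80 * (k + 1) * w := by
      apply mul_le_mul_of_nonneg_left g3.1 (by positivity)
    nlinarith
  · have : 80 * ((k : ℤ) + 1) * w ≤ 80 * (k + 1) * |w| := by
      apply mul_le_mul_of_nonneg_left g3.2 (by positivity)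
    nlinarith
  · have hsub : (Ω.filter fun ω : ℤ => ((i + 1 : ℕ) : ZMod m) * (y' : ZMod m) - (i : ZMod m) * (x' : ZMod m)
        + (ω : ZMod m) ∈ F) ⊆ Ω.filter fun ω => y' + w + ω ∈ R := by
      intro ω hω
      rw [Finset.mem_filter] at hω ⊢
      refine ⟨hω.1, ?_⟩
      obtain ⟨n, hn, hn2⟩ := Finset.mem_image.1 hω.2
      rw [mem_red, Finset.mem_Icc] at hn
      have hcast : ((n : ℤ) : ZMod m) = ((y' + w + ω : ℤ) : ZMod m) := by
        rw [hn2, hw]; push_cast; ring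
      have hω2 := (hΩ ω hω.1).1
      have g4 := abs_le.1 (le_refl |ω|)
      have := cast_eq_of_close _ _ hcast (by omega) (by omega)
      rw [← this]; exact hn.2
    have := Finset.card_le_card hsub
    have h2 : ((Ω.filter fun ω : ℤ => ((i + 1 : ℕ) : ZMod m) * (y' : ZMod m) - (i : ZMod m) * (x' : ZMod m)
        + (ω : ZMod m) ∈ F).card : ℝ) ≤ (Ω.filter fun ω => y' + w + ω ∈ R).card := by exact_mod_cast this
    have h3 := hxy.trans h2
    rw [div_mul_eq_mul_div, one_mul, div_le_iff₀ (by positivity)] at h3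
    linarith

end TwoK


namespace TwoK

/-! ### Bohr sets and lifts -/

/-- `x` is a lift of the integer `v` for the frequencies `α` -/
def IsLift {r : ℕ} (m : ℕ) (α : Fin r → ℝ) (v : ℤ) (x : ℝ × (Fin r → ℝ)) : Prop :=
  x.1 = (v : ℝ) / m ∧ ∀ γ, ∃ t : ℤ, x.2 γ = α γ * v - t

section
variable {r m : ℕ} {α : Fin r → ℝ}

lemma IsLift.zero : IsLift m α 0 0 :=
  ⟨by simp, fun γ => ⟨0, by simp⟩⟩

lemma IsLift.add {v w : ℤ} {x y : ℝ × (Fin r → ℝ)} (h : IsLift m α v x) (h' : IsLift m α w y) :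
    IsLift m α (v + w) (x + y) := by
  refine ⟨?_, fun γ => ?_⟩
  · rw [Prod.fst_add, h.1, h'.1]; push_cast; ring
  · obtain ⟨t, ht⟩ := h.2 γ
    obtain ⟨t', ht'⟩ := h'.2 γ
    refine ⟨t + t', ?_⟩
    rw [Prod.snd_add, Pi.add_apply, ht, ht']; push_cast; ring

lemma IsLift.smul {v : ℤ} {x : ℝ × (Fin r → ℝ)} (h : IsLift m α v x) (n : ℤ) :
    IsLift m α (n * v) ((n : ℝ) • x) := by
  refine ⟨?_, fun γ => ?_⟩
  · rw [Prod.smul_fst, h.1]; push_cast; rw [smul_eq_mul]; ring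
  · obtain ⟨t, ht⟩ := h.2 γ
    refine ⟨n * t, ?_⟩
    rw [Prod.smul_snd, Pi.smul_apply, ht]; push_cast; rw [smul_eq_mul]; ring

lemma IsLift.sub {v w : ℤ} {x y : ℝ × (Fin r → ℝ)} (h : IsLift m α v x) (h' : IsLift m α w y) :
    IsLift m α (v - w) (x - y) := by
  have := h.add (h'.smul (-1))
  convert this using 1
  · ring
  · push_cast; rw [neg_smul, one_smul, sub_eq_add_neg]

lemma IsLift.sum {ι : Type*} (s : Finset ι) (v : ι → ℤ) (x : ι → ℝ × (Fin r → ℝ))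
    (h : ∀ i ∈ s, IsLift m α (v i) (x i)) : IsLift m α (∑ i ∈ s, v i) (∑ i ∈ s, x i) := by
  classical
  induction s using Finset.induction_on with
  | empty => simpa using IsLift.zero
  | insert a s ha ih =>
    rw [Finset.sum_insert ha, Finset.sum_insert ha]
    exact (h a (Finset.mem_insert_self _ _)).add (ih fun i hi => h i (Finset.mem_insert_of_mem hi))

lemma IsLift.of_close {v : ℤ} {η : ℝ} (hm : 0 < m) (hη : 0 ≤ η) (h1 : |(v : ℝ)| ≤ η * m)
    (h2 : ∀ γ, ∃ t : ℤ, |α γ * v - t| ≤ η) : ∃ x, IsLift m α v x ∧ ‖x‖ ≤ η := by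
  choose t ht using h2
  refine ⟨((v : ℝ) / m, fun γ => α γ * v - t γ), ⟨rfl, fun γ => ⟨t γ, rfl⟩⟩, ?_⟩
  have hmR : (0 : ℝ) < m := by exact_mod_cast hm
  rw [Prod.norm_def]
  refine max_le ?_ ((pi_norm_le_iff_of_nonneg hη).2 fun γ => ?_)
  · rw [Real.norm_eq_abs, abs_div, abs_of_pos hmR, div_le_iff₀ hmR]; exact h1
  · rw [Real.norm_eq_abs]; exact ht γ

lemma IsLift.close {v : ℤ} {η : ℝ} {x : ℝ × (Fin r → ℝ)} (hm : 0 < m) (h : IsLift m α v x)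
    (hx : ‖x‖ ≤ η) : |(v : ℝ)| ≤ η * m ∧ ∀ γ, ∃ t : ℤ, |α γ * v - t| ≤ η := by
  have hmR : (0 : ℝ) < m := by exact_mod_cast hm
  rw [Prod.norm_def, max_le_iff] at hx
  refine ⟨?_, fun γ => ?_⟩
  · have := hx.1
    rw [h.1, Real.norm_eq_abs, abs_div, abs_of_pos hmR, div_le_iff₀ hmR] at this
    exact this
  · obtain ⟨t, ht⟩ := h.2 γ
    refine ⟨t, ?_⟩
    rw [← ht, ← Real.norm_eq_abs]
    exact (norm_le_pi_norm x.2 γ).trans hx.2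

/-- binning -/
lemma bin_close (B : ℕ) (hB : 0 < B) (f g : Fin r → ℝ)
    (h : (fun γ => ⌊(B : ℝ) * Int.fract (f γ)⌋) = fun γ => ⌊(B : ℝ) * Int.fract (g γ)⌋) :
    ∀ γ, ∃ t : ℤ, |f γ - g γ - t| ≤ 1 / B := by
  intro γ
  have hB' : (0 : ℝ) < B := by exact_mod_cast hB
  have h1 := congrFun h γ
  have h2 := Int.abs_sub_lt_one_of_floor_eq_floor h1
  refine ⟨⌊f γ⌋ - ⌊g γ⌋, ?_⟩
  rw [← mul_sub, abs_mul, abs_of_pos hB'] at h2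
  rw [le_div_iff₀ hB']
  have h3 : f γ - g γ - ((⌊f γ⌋ - ⌊g γ⌋ : ℤ) : ℝ) = Int.fract (f γ) - Int.fract (g γ) := by
    rw [← Int.self_sub_floor, ← Int.self_sub_floor]; push_cast; ring
  rw [h3, mul_comm]; exact h2.le

lemma bin_mem (B : ℕ) (hB : 0 < B) (f : Fin r → ℝ) :
    (fun γ => ⌊(B : ℝ) * Int.fract (f γ)⌋) ∈ Fintype.piFinset (fun _ : Fin r => Finset.Ico (0 : ℤ) B) := by
  have hB' : (0 : ℝ) < B := by exact_mod_cast hB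
  rw [Fintype.mem_piFinset]
  intro γ
  rw [Finset.mem_Ico]
  refine ⟨Int.floor_nonneg.2 (mul_nonneg hB'.le (Int.fract_nonneg _)), ?_⟩
  rw [Int.floor_lt]
  push_cast
  have := Int.fract_lt_one (f γ)
  nlinarith

lemma bin_card (B : ℕ) : (Fintype.piFinset (fun _ : Fin r => Finset.Ico (0 : ℤ) B)).card = B ^ r := by
  rw [Fintype.card_piFinset]; simp

/-- Dirichlet -/
lemma dirichlet (hm : 0 < m) (a : ℝ) (ha : 0 < a) (B : ℕ) (hB : 0 < B) (haB : 1 / (B : ℝ) ≤ a) (u : ℤ)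
    (hu : |(u : ℝ)| * (B ^ r : ℕ) ≤ a * m) :
    ∃ c : ℕ, 1 ≤ c ∧ c ≤ B ^ r ∧ ∃ x, IsLift m α (c * u) x ∧ ‖x‖ ≤ a := by
  obtain ⟨x, hx, y, hy, hxy, h⟩ := Finset.exists_ne_map_eq_of_card_lt_of_maps_to
    (s := Finset.range (B ^ r + 1)) (t := Fintype.piFinset (fun _ : Fin r => Finset.Ico (0 : ℤ) B))
    (f := fun c : ℕ => fun γ => ⌊(B : ℝ) * Int.fract (α γ * (c * u))⌋)
    (by rw [bin_card, Finset.card_range]; omega) (fun c _ => bin_mem B hB _)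
  wlog hlt : x < y generalizing x y
  · exact this y hy x hx hxy.symm h.symm (by omega)
  rw [Finset.mem_range] at hx hy
  refine ⟨y - x, by omega, by omega, ?_⟩
  have hcl := bin_close B hB (fun γ => α γ * (y * u)) (fun γ => α γ * (x * u)) h.symm
  have hsub : ((y - x : ℕ) : ℝ) = y - x := by push_cast [hlt.le]; ring
  refine IsLift.of_close hm ha.le ?_ fun γ => ?_
  · push_cast
    rw [hsub, abs_mul, ← hsub, Nat.abs_cast]
    have : ((y - x : ℕ) : ℝ) ≤ (B ^ r : ℕ) := by exact_mod_cast (by omega : y - x ≤ B ^ r)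
    have := mul_le_mul_of_nonneg_right this (abs_nonneg (u : ℝ))
    linarith
  · obtain ⟨t, ht⟩ := hcl γ
    refine ⟨t, le_trans (le_trans (le_of_eq ?_) ht) haB⟩
    congr 1
    push_cast
    rw [hsub]; ring

open Classical in
variable (m α) in
/-- Bohr set with divisibility -/
noncomputable def bohr (L : ℕ) (η : ℝ) : Finset ℤ :=
  (Finset.Icc (-(m : ℤ)) m).filter fun v => (L : ℤ) ∣ v ∧ ∃ x, IsLift m α v x ∧ ‖x‖ ≤ η

lemma mem_bohr (hm : 0 < m) {L : ℕ} {η : ℝ} (hη : η ≤ 1) {v : ℤ} :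
    v ∈ bohr m α L η ↔ (L : ℤ) ∣ v ∧ ∃ x, IsLift m α v x ∧ ‖x‖ ≤ η := by
  classical
  rw [bohr, Finset.mem_filter, Finset.mem_Icc]
  refine ⟨fun h => h.2, fun h => ⟨?_, h⟩⟩
  obtain ⟨_, x, hx, hxn⟩ := h
  have := (hx.close hm (hxn.trans hη)).1
  rw [one_mul, abs_le] at this
  exact ⟨by exact_mod_cast this.1, by exact_mod_cast this.2⟩

lemma bohr_mono {L : ℕ} {η η' : ℝ} (h : η ≤ η') : bohr m α L η ⊆ bohr m α L η' := by
  classical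
  intro v hv
  rw [bohr, Finset.mem_filter] at hv ⊢
  obtain ⟨h1, h2, x, h3, h4⟩ := hv
  exact ⟨h1, h2, x, h3, h4.trans h⟩

lemma bohr_card_le (hm : 0 < m) (L : ℕ) (η : ℝ) : ((bohr m α L η).card : ℝ) ≤ 3 * m := by
  classical
  have h1 : (bohr m α L η).card ≤ (Finset.Icc (-(m : ℤ)) m).card := Finset.card_filter_le _ _
  rw [Int.card_Icc] at h1
  have : (bohr m α L η).card ≤ 3 * m := by omega
  exact_mod_cast this

lemma bohr_card_ge (hm : 0 < m) (L : ℕ) (hL : 1 ≤ L) (η : ℝ) (hη : 0 < η) (hη1 : η ≤ 1) (B : ℕ) (hB : 0 < B)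
    (hBη : 1 / (B : ℝ) ≤ η) (hbig : L ≤ η * m) :
    η / (2 * L * (B ^ r : ℕ)) * m ≤ ((bohr m α L η).card : ℝ) := by
  have hLR : (0 : ℝ) < L := by exact_mod_cast hL
  have hmR : (0 : ℝ) < m := by exact_mod_cast hm
  have hBr : (0 : ℝ) < (B ^ r : ℕ) := by exact_mod_cast pow_pos hB r
  set Q : ℕ := ⌊η * m / L⌋₊ with hQ
  have hQ1 : (Q : ℝ) ≤ η * m / L := Nat.floor_le (by positivity)
  have hQ2 : η * m / L / 2 ≤ Q := by
    have h1 : 1 ≤ η * m / L := by rw [le_div_iff₀ hLR]; linarith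
    have h2 := Nat.lt_floor_add_one (η * m / L)
    have h3 : 1 ≤ Q := Nat.le_floor (by simpa using h1)
    have h4 : (1 : ℝ) ≤ Q := by exact_mod_cast h3
    rw [← hQ] at h2
    linarith
  obtain ⟨b, hb, hb2⟩ := Finset.exists_le_card_fiber_of_nsmul_le_card_of_maps_to
    (s := Finset.Icc 1 Q) (t := Fintype.piFinset (fun _ : Fin r => Finset.Ico (0 : ℤ) B))
    (f := fun u : ℕ => fun γ => ⌊(B : ℝ) * Int.fract (α γ * (L * u))⌋) (b := (Q : ℝ) / (B ^ r : ℕ))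
    (fun u _ => bin_mem B hB _) ⟨_, bin_mem B hB (fun _ => 0)⟩
    (by rw [bin_card, Nat.card_Icc, nsmul_eq_mul, mul_div_cancel₀ _ hBr.ne']; simp)
  set S := (Finset.Icc 1 Q).filter fun u : ℕ => (fun γ => ⌊(B : ℝ) * Int.fract (α γ * (L * u))⌋) = b with hS
  have hfin : (S.card : ℝ) ≤ (bohr m α L η).card := by
    rcases S.eq_empty_or_nonempty with he | ⟨u0, hu0⟩
    · rw [he]; simp
    · have : S.card ≤ (bohr m α L η).card := by
        refine Finset.card_le_card_of_injOn (fun u : ℕ => (L : ℤ) * ((u : ℤ) - u0)) ?_ ?_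
        · intro u hu
          rw [Finset.mem_coe] at hu ⊢
          rw [hS, Finset.mem_filter, Finset.mem_Icc] at hu hu0
          rw [mem_bohr hm hη1]
          refine ⟨dvd_mul_right _ _, ?_⟩
          have hcl := bin_close B hB (fun γ => α γ * (L * u)) (fun γ => α γ * (L * u0))
            (hu.2.trans hu0.2.symm)
          refine IsLift.of_close hm hη.le ?_ fun γ => ?_
          · push_cast
            rw [abs_mul, abs_of_pos hLR]
            have h1 : |(u : ℝ) - u0| ≤ Q := by
              have a1 : (u : ℝ) ≤ Q := by exact_mod_cast hu.1.2
              have a2 : (u0 : ℝ) ≤ Q := by exact_mod_cast hu0.1.2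
              rw [abs_le]
              have : (0 : ℝ) ≤ u := by positivity
              have : (0 : ℝ) ≤ u0 := by positivity
              constructor <;> linarith
            have h2 := h1.trans hQ1
            rw [le_div_iff₀ hLR] at h2
            linarith
          · obtain ⟨t, ht⟩ := hcl γ
            refine ⟨t, le_trans (le_trans (le_of_eq ?_) ht) hBη⟩
            congr 1; push_cast; ring
        · intro u _ u' _ h
          simp only at h
          have h' := mul_left_cancel₀ (by exact_mod_cast (by omega : L ≠ 0)) h
          omega
      exact_mod_cast this
  refine le_trans ?_ (hb2.trans hfin)
  rw [le_div_iff₀ hBr]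
  refine le_trans (le_of_eq ?_) hQ2
  field_simp

variable (m α) in
def VS (a : ℝ) : Submodule ℝ (ℝ × (Fin r → ℝ)) :=
  Submodule.span ℝ {x | ∃ v, IsLift m α v x ∧ ‖x‖ ≤ a}

lemma VS_mono {a b : ℝ} (h : a ≤ b) : VS m α a ≤ VS m α b :=
  Submodule.span_mono fun x ⟨v, hv, hx⟩ => ⟨v, hv, hx.trans h⟩

lemma division (a : ℝ) (ha : 0 ≤ a) (l : ℝ × (Fin r → ℝ)) (hl : l ∈ VS m α a) (n : ℕ) (hn : 1 ≤ n) :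
    ∃ (μ : ℤ) (y : ℝ × (Fin r → ℝ)), IsLift m α μ y ∧ ‖l - (n : ℝ) • y‖ ≤ n * ((r + 1) * a) := by
  obtain ⟨f, hf1, hf2, -⟩ := Submodule.exists_fun_fin_finrank_span_eq ℝ
    {x : ℝ × (Fin r → ℝ) | ∃ v, IsLift m α v x ∧ ‖x‖ ≤ a}
  have hl2 : l ∈ Submodule.span ℝ (Set.range f) := by rw [hf2]; exact hl
  rw [Submodule.mem_span_range_iff_exists_fun] at hl2
  obtain ⟨c, hc⟩ := hl2
  choose v hv hvn using hf1
  have hnR : (0 : ℝ) < n := by exact_mod_cast hn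
  refine ⟨_, _, IsLift.sum Finset.univ (fun j => round (c j / n) * v j) _
    (fun j _ => (hv j).smul (round (c j / n))), ?_⟩
  rw [← hc, Finset.smul_sum, ← Finset.sum_sub_distrib]
  have h1 : ∀ j ∈ Finset.univ, ‖c j • f j - (n : ℝ) • ((round (c j / n) : ℤ) : ℝ) • f j‖ ≤ n * a := by
    intro j _
    rw [smul_smul, ← sub_smul, norm_smul]
    have h2 := abs_sub_round (c j / n)
    have h3 : c j - n * ((round (c j / n) : ℤ) : ℝ) = n * (c j / n - round (c j / n)) := by
      field_simp
    rw [h3, Real.norm_eq_abs, abs_mul, abs_of_pos hnR]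
    have h4 : |c j / n - round (c j / n)| ≤ 1 := by linarith
    have := hvn j
    calc _ ≤ (n : ℝ) * 1 * a := by gcongr
      _ = _ := by ring
  refine (norm_sum_le_of_le _ h1).trans ?_
  rw [Finset.sum_const, nsmul_eq_mul, Finset.card_univ, Fintype.card_fin]
  have h5 : (Module.finrank ℝ (Submodule.span ℝ
    {x : ℝ × (Fin r → ℝ) | ∃ v, IsLift m α v x ∧ ‖x‖ ≤ a}) : ℝ) ≤ r + 1 := by
    have h6 := Submodule.finrank_le (Submodule.span ℝ
      {x : ℝ × (Fin r → ℝ) | ∃ v, IsLift m α v x ∧ ‖x‖ ≤ a})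
    have h7 : Module.finrank ℝ (ℝ × (Fin r → ℝ)) = r + 1 := by simp [add_comm]
    rw [h7] at h6
    exact_mod_cast h6
  have : 0 ≤ (n : ℝ) * a := by positivity
  nlinarith

end

end TwoK


namespace TwoK

section
variable {r m : ℕ} {α : Fin r → ℝ}

lemma lift_fact (hm : 0 < m) (a : ℝ) (ha : 0 < a) (B : ℕ) (hB : 0 < B) (haB : 1 / (B : ℝ) ≤ a)
    (u : ℤ) (hu : |(u : ℝ)| * (B ^ r : ℕ) ≤ a * m) :
    ∃ l, IsLift m α (((B ^ r).factorial : ℕ) * u) l ∧ l ∈ VS m α a ∧ ‖l‖ ≤ ((B ^ r).factorial : ℕ) * a := by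
  obtain ⟨c, hc1, hc2, x, hx, hxn⟩ := dirichlet (α := α) hm a ha B hB haB u hu
  obtain ⟨d, hd⟩ := Nat.dvd_factorial (by omega : 0 < c) hc2
  have h1 := hx.smul (d : ℤ)
  refine ⟨((d : ℤ) : ℝ) • x, ?_, ?_, ?_⟩
  · convert h1 using 1
    rw [hd]; push_cast; ring
  · exact Submodule.smul_mem _ _ (Submodule.subset_span ⟨_, hx, hxn⟩)
  · rw [norm_smul, hd]
    push_cast
    rw [Real.norm_eq_abs, Nat.abs_cast]
    have hcR : (1 : ℝ) ≤ c := by exact_mod_cast hc1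
    have hd0 : (0 : ℝ) ≤ d := by positivity
    have h2 : (d : ℝ) * ‖x‖ ≤ d * a := by gcongr
    have h3 : (1 : ℝ) * (d * a) ≤ c * (d * a) := by gcongr
    linarith

lemma bohr_add (hm : 0 < m) {L : ℕ} {η η' η'' : ℝ} (h : η + η' ≤ η'') (h1 : η'' ≤ 1) {v w : ℤ}
    (hη : 0 ≤ η) (hη' : 0 ≤ η')
    (hv : v ∈ bohr m α L η) (c : ℤ) (b : ℝ) (hw : w ∈ bohr m α L b) (hcb : |(c : ℝ)| * b ≤ η') :
    v + c * w ∈ bohr m α L η'' := by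
  classical
  rw [mem_bohr hm h1]
  rw [mem_bohr hm (by linarith)] at hv
  obtain ⟨a1, x, a2, a3⟩ := hv
  rw [bohr, Finset.mem_filter] at hw
  obtain ⟨-, b1, y, b2, b3⟩ := hw
  refine ⟨a1.add (b1.mul_left _), _, a2.add (b2.smul c), ?_⟩
  refine (norm_add_le _ _).trans ?_
  rw [norm_smul, Real.norm_eq_abs]
  have : |(c : ℝ)| * ‖y‖ ≤ |(c : ℝ)| * b := by gcongr
  linarith

open Classical in
/-- the ladder along a Bohr line -/
lemma spread_line {k : ℕ} (hk : 1 ≤ k) {R : Set ℤ} (hF : FOne k R) (hm : 0 < m) {L q K1 M1 : ℕ}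
    (hL : 1 ≤ L) (hq : 1 ≤ q) (hK1 : 1 ≤ K1) (hM1 : k ≤ M1) {a ap η' : ℝ} (ha : 0 < a) (hap : 0 ≤ ap)
    (hη' : 0 < η') (hη1 : η' ≤ 1)
    (hVS : VS m α a = VS m α ap)
    (hap2 : 16 * (K1 * M1 * L * ((r + 1) * ap)) ≤ η') (hK1' : 16 * L * a ≤ K1 * η')
    (x0 u w u'' : ℤ) (huw : u + w = q * u'')
    (hl : ∃ l, IsLift m α (L * u'') l ∧ l ∈ VS m α a ∧ ‖l‖ ≤ L * a)
    (hblue : ∀ ν ∈ bohr m α L η', x0 - L * u + q * ν ∉ R) :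
    M1 * ((bohr m α L (η' / 8)).filter fun τ => x0 + L * w + q * τ ∈ R).card
      ≤ (k + 2) ^ (2 * k * (K1 + 1)) * (bohr m α L (η' / 4)).card := by
  obtain ⟨l, hl1, hl2, hl3⟩ := hl
  have hM1' : 1 ≤ M1 := by omega
  rw [hVS] at hl2
  obtain ⟨μ, y, hy1, hy2⟩ := division ap hap l hl2 (K1 * M1 * L) (by
    have := Nat.mul_le_mul (Nat.mul_le_mul hK1 hM1') hL
    simpa using this)
  have hLR : (1 : ℝ) ≤ L := by exact_mod_cast hL
  have hKR : (1 : ℝ) ≤ K1 := by exact_mod_cast hK1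
  have hMR : (1 : ℝ) ≤ M1 := by exact_mod_cast hM1'
  set n : ℝ := ((K1 * M1 * L : ℕ) : ℝ) with hn
  have hnval : n = K1 * M1 * L := by rw [hn]; push_cast; ring
  have hn0 : 0 < n := by rw [hnval]; positivity
  have hy3 : ‖l - n • y‖ ≤ η' / 16 := by
    refine hy2.trans ?_
    rw [hnval]; linarith
  set σ : ℤ := L * u'' - (K1 * M1 * L : ℕ) * μ with hσ
  have hσl : IsLift m α σ (l - n • y) := by
    have := hl1.sub (hy1.smul ((K1 * M1 * L : ℕ) : ℤ))
    have h2 : n = (((K1 * M1 * L : ℕ) : ℤ) : ℝ) := by rw [hn]; push_cast; ring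
    rw [h2]; exact this
  have hny : n * ‖y‖ ≤ L * a + η' / 16 := by
    have h1 : n • y = l - (l - n • y) := by abel
    have h2 : ‖n • y‖ = n * ‖y‖ := by rw [norm_smul, Real.norm_eq_abs, abs_of_pos hn0]
    rw [← h2, h1]
    exact (norm_sub_le _ _).trans (by linarith)
  have hjy : M1 * L * ‖y‖ ≤ η' / 8 := by
    have h1 : K1 * (M1 * L * ‖y‖) ≤ K1 * (η' / 8) := by
      have : K1 * (M1 * L * ‖y‖) = n * ‖y‖ := by rw [hnval]; ring
      rw [this]
      nlinarith
    exact le_of_mul_le_mul_left h1 (by linarith)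
  have hjy' : ∀ j : ℤ, 0 ≤ j → j ≤ M1 → ‖((j * L : ℤ) : ℝ) • y‖ ≤ η' / 8 := by
    intro j hj0 hj
    refine le_trans ?_ hjy
    rw [norm_smul, Real.norm_eq_abs]
    have h1 : (0 : ℝ) ≤ j := by exact_mod_cast hj0
    have h2 : (j : ℝ) ≤ M1 := by exact_mod_cast hj
    push_cast
    rw [abs_of_nonneg (by positivity)]
    gcongr
  -- each line has few reds
  have hline : ∀ τ ∈ bohr m α L (η' / 4),
      ((Finset.Icc (1 : ℤ) M1).filter fun j => x0 + L * w + q * (τ + j * L * μ) ∈ R).card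
      ≤ (k + 2) ^ (2 * k * (K1 + 1)) := by
    intro τ hτ
    rw [mem_bohr hm (by linarith)] at hτ
    obtain ⟨hτ1, xτ, hτ2, hτ3⟩ := hτ
    set v : ℤ := q * L * μ with hv
    set b : ℤ := x0 + L * w + q * τ - (K1 * M1 : ℕ) * v with hb
    have hlad := ladder hk (hF.affine b v) M1 hM1 (by
      intro j hj1 hj2
      show b + j * v ∉ R
      have hν := hblue (τ + σ + j * L * μ) (by
        rw [mem_bohr hm hη1]
        refine ⟨?_, _, (hτ2.add hσl).add (hy1.smul (j * L)), ?_⟩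
        · refine (hτ1.add ?_).add ?_
          · refine ⟨u'' - K1 * M1 * μ, ?_⟩
            rw [hσ]; push_cast; ring
          · exact ⟨j * μ, by ring⟩
        · refine (norm_add₃_le).trans ?_
          have := hjy' j (by omega) hj2
          linarith)
      convert hν using 2
      rw [hb, hv, hσ]; push_cast
      linear_combination (L : ℤ) * huw) (K1 + 1)
    refine le_trans ?_ hlad
    refine Finset.card_le_card_of_injOn (fun j => (K1 * M1 : ℕ) + j) ?_ ?_
    · intro j hj
      rw [Finset.mem_coe, Finset.mem_filter, Finset.mem_Icc] at hj
      rw [Finset.mem_coe, mem_red, Finset.mem_Icc]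
      obtain ⟨⟨h1, h2⟩, h3⟩ := hj
      refine ⟨⟨?_, ?_⟩, ?_⟩
      · have : (0 : ℤ) ≤ (K1 * M1 : ℕ) := by positivity
        simp only; linarith
      · push_cast; linarith
      · show b + ((K1 * M1 : ℕ) + j) * v ∈ R
        convert h3 using 1
        rw [hb, hv]; push_cast; ring
    · intro j _ j' _ h
      simp only at h; linarith
  -- double counting
  set S := (bohr m α L (η' / 8)).filter fun τ => x0 + L * w + q * τ ∈ R with hS
  have h1 : S.card * M1 = (S ×ˢ Finset.Icc (1 : ℤ) M1).card := by
    rw [Finset.card_product]; simp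
  have h2 : (S ×ˢ Finset.Icc (1 : ℤ) M1).card ≤ ((bohr m α L (η' / 4)).sigma fun τ =>
      (Finset.Icc (1 : ℤ) M1).filter fun j => x0 + L * w + q * (τ + j * L * μ) ∈ R).card := by
    refine Finset.card_le_card_of_injOn (fun p => ⟨p.1 - p.2 * L * μ, p.2⟩) ?_ ?_
    · rintro ⟨τ, j⟩ hp
      rw [Finset.mem_coe, Finset.mem_product, hS, Finset.mem_filter, Finset.mem_Icc] at hp
      obtain ⟨⟨h1, h2⟩, h3, h4⟩ := hp
      simp only at h1 h2 h3 h4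
      rw [Finset.mem_coe, Finset.mem_sigma, Finset.mem_filter, Finset.mem_Icc]
      refine ⟨?_, ⟨h3, h4⟩, ?_⟩
      · rw [mem_bohr hm (by linarith)] at h1 ⊢
        obtain ⟨a1, x, a2, a3⟩ := h1
        refine ⟨a1.sub ⟨j * μ, by ring⟩, _, a2.sub (hy1.smul (j * L)), ?_⟩
        refine (norm_sub_le _ _).trans ?_
        have := hjy' j (by omega) h4
        linarith
      · simp only
        convert h2 using 1; ring
    · rintro ⟨τ, j⟩ _ ⟨τ', j'⟩ _ h
      simp only [Sigma.mk.injEq, heq_eq_eq] at h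
      obtain ⟨h3, h4⟩ := h
      subst h4
      rw [Prod.mk.injEq]
      exact ⟨by linarith, rfl⟩
  rw [Finset.card_sigma] at h2
  have h3 := h2.trans (Finset.sum_le_sum hline)
  rw [← h1, Finset.sum_const, smul_eq_mul] at h3
  linarith

open Classical in
/-- the spread statement -/
lemma spread {k : ℕ} (hk : 1 ≤ k) {R : Set ℤ} (hF : FOne k R) (hm : 0 < m) {q K1 M1 B : ℕ}
    (hB : 0 < B) (hq : 1 ≤ q) (hK1 : 1 ≤ K1) (hM1 : k ≤ M1) {a ap η η' ηp e1 κ : ℝ}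
    (ha : 0 < a) (haB : 1 / (B : ℝ) ≤ a)
    (hap : 0 ≤ ap) (hη' : 0 < η') (hη1 : η' ≤ 1) (hη : 0 ≤ η) (hηp : η + q * η' ≤ ηp) (hηp1 : ηp ≤ 1)
    (hVS : VS m α a = VS m α ap) {L : ℕ} (hLdef : L = (B ^ r).factorial)
    (hap2 : 16 * (K1 * M1 * L * ((r + 1) * ap)) ≤ η') (hK1' : 16 * L * a ≤ K1 * η')
    (hηpa : ηp * (B ^ r : ℕ) * 2 ≤ a)
    (x0 : ℤ) (ρ : ℤ) (hκ : 0 < κ)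
    (hreg : ((bohr m α L ηp).card : ℝ) ≤ 2 * (bohr m α L η).card)
    (hκ8 : κ * m ≤ (bohr m α L (η' / 8)).card)
    (hX : ((bohr m α L η).card : ℝ) ≤ 4 * k * q *
      ((bohr m α L η).filter fun ω : ℤ => x0 + ω ∈ R ∧ ∃ w : ℤ, ω = L * w ∧ (q : ℤ) ∣ w - ρ).card)
    (hne : 0 < (bohr m α L η).card)
    (hM1' : 24 * k * q * ((k + 2) ^ (2 * k * (K1 + 1)) : ℕ) < M1 * κ)
    (u : ℤ) (hu : |(u : ℝ)| * (B ^ r : ℕ) * 2 ≤ a * m) (huρ : (q : ℤ) ∣ u + ρ) :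
    ∃ ν ∈ bohr m α L η', x0 - L * u + q * ν ∈ R := by
  by_contra hcon
  push Not at hcon
  have hL : 1 ≤ L := by rw [hLdef]; exact Nat.factorial_pos _
  have hLR : (1 : ℝ) ≤ L := by exact_mod_cast hL
  have hmR : (0 : ℝ) < m := by exact_mod_cast hm
  set f : ℕ := (k + 2) ^ (2 * k * (K1 + 1)) with hf
  set X := (bohr m α L η).filter fun ω : ℤ => x0 + ω ∈ R ∧ ∃ w : ℤ, ω = L * w ∧ (q : ℤ) ∣ w - ρ with hXdef
  set Ωp := (bohr m α L ηp).filter fun ω : ℤ => ∃ w : ℤ, ω = L * w ∧ (q : ℤ) ∣ w - ρ with hΩp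
  have h1 : ∀ ω ∈ Ωp, M1 * ((bohr m α L (η' / 8)).filter fun τ => x0 + ω + q * τ ∈ R).card
      ≤ f * (bohr m α L (η' / 4)).card := by
    intro ω hω
    rw [hΩp, Finset.mem_filter] at hω
    obtain ⟨hω1, w, rfl, hw⟩ := hω
    obtain ⟨u'', hu''⟩ : (q : ℤ) ∣ u + w := by
      have := huρ.add hw
      have e : u + w = u + ρ + (w - ρ) := by ring
      rw [e]; exact this
    refine spread_line hk hF hm hL hq hK1 hM1 ha hap hη' hη1 hVS hap2 hK1' x0 u w u'' hu'' ?_ hcon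
    rw [hLdef]
    refine lift_fact hm a ha B hB haB u'' ?_
    rw [mem_bohr hm hηp1] at hω1
    obtain ⟨-, x, hx1, hx2⟩ := hω1
    have h2 := (hx1.close hm hx2).1
    push_cast at h2
    rw [abs_mul, Nat.abs_cast] at h2
    have h3 : |(w : ℝ)| ≤ ηp * m := by
      have := abs_nonneg (w : ℝ)
      nlinarith
    have h4 : |(u'' : ℝ)| ≤ |(u : ℝ)| + |(w : ℝ)| := by
      have h5 : (q : ℝ) * u'' = u + w := by exact_mod_cast hu''.symm
      have hqR : (1 : ℝ) ≤ q := by exact_mod_cast hq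
      have h6 : (q : ℝ) * |(u'' : ℝ)| = |(u : ℝ) + w| := by
        rw [← h5, abs_mul, Nat.abs_cast]
      have h7 := abs_add_le (u : ℝ) w
      have := abs_nonneg (u'' : ℝ)
      nlinarith
    have hBr : (0 : ℝ) ≤ (B ^ r : ℕ) := by positivity
    have h5 : |(u'' : ℝ)| * (B ^ r : ℕ) ≤ (|(u : ℝ)| + ηp * m) * (B ^ r : ℕ) := by
      gcongr; linarith
    have h6 : ηp * m * (B ^ r : ℕ) * 2 ≤ a * m := by
      have : (ηp * (B ^ r : ℕ) * 2) * m ≤ a * m := by gcongr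
      linarith
    linarith
  have h2 : X.card * (bohr m α L (η' / 8)).card ≤ ∑ ω ∈ Ωp,
      ((bohr m α L (η' / 8)).filter fun τ => x0 + ω + q * τ ∈ R).card := by
    rw [← Finset.card_product, ← Finset.card_sigma]
    refine Finset.card_le_card_of_injOn (fun p => ⟨p.1 - q * p.2, p.2⟩) ?_ ?_
    · rintro ⟨ω, τ⟩ hp
      rw [Finset.mem_coe, Finset.mem_product, hXdef, Finset.mem_filter] at hp
      obtain ⟨⟨p1, p2, w, p3, p4⟩, p5⟩ := hp
      simp only at p1 p2 p3 p5
      rw [Finset.mem_coe, Finset.mem_sigma, hΩp, Finset.mem_filter, Finset.mem_filter]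
      refine ⟨⟨?_, ?_⟩, p5, ?_⟩
      · have := bohr_add hm hηp hηp1 hη (by positivity) p1 (-(q : ℤ)) (η' / 8) p5 (by
          push_cast
          rw [abs_neg, Nat.abs_cast]
          have : (0 : ℝ) ≤ q := by positivity
          nlinarith)
        convert this using 1
        ring
      · rw [mem_bohr hm (by linarith)] at p5
        obtain ⟨⟨t, ht⟩, -⟩ := p5
        refine ⟨w - q * t, ?_, ?_⟩
        · simp only; rw [p3, ht]; ring
        · have : w - q * t - ρ = (w - ρ) - q * t := by ring
          rw [this]
          exact p4.sub (dvd_mul_right _ _)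
      · simp only
        convert p2 using 1; ring
    · rintro ⟨ω, τ⟩ _ ⟨ω', τ'⟩ _ h
      simp only [Sigma.mk.injEq, heq_eq_eq] at h
      obtain ⟨h3, h4⟩ := h
      subst h4
      rw [Prod.mk.injEq]
      exact ⟨by linarith, rfl⟩
  have h3 : M1 * (X.card * (bohr m α L (η' / 8)).card) ≤ Ωp.card * (f * (bohr m α L (η' / 4)).card) := by
    calc _ ≤ M1 * ∑ ω ∈ Ωp, ((bohr m α L (η' / 8)).filter fun τ => x0 + ω + q * τ ∈ R).card :=
          Nat.mul_le_mul_left _ h2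
      _ = ∑ ω ∈ Ωp, M1 * ((bohr m α L (η' / 8)).filter fun τ => x0 + ω + q * τ ∈ R).card :=
          Finset.mul_sum _ _ _
      _ ≤ ∑ ω ∈ Ωp, f * (bohr m α L (η' / 4)).card := Finset.sum_le_sum h1
      _ = _ := by rw [Finset.sum_const, smul_eq_mul]
  have h4 : (M1 : ℝ) * (X.card * (bohr m α L (η' / 8)).card)
      ≤ Ωp.card * (f * (bohr m α L (η' / 4)).card) := by exact_mod_cast h3
  have h5 : (Ωp.card : ℝ) ≤ 2 * (bohr m α L η).card := by
    refine le_trans ?_ hreg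
    exact_mod_cast Finset.card_le_card (Finset.filter_subset _ _)
  have h6 : ((bohr m α L (η' / 4)).card : ℝ) ≤ 3 * m := bohr_card_le hm L _
  set W : ℝ := ((bohr m α L η).card : ℝ) with hW
  have hWpos : 0 < W := by rw [hW]; exact_mod_cast hne
  have hkq : (0 : ℝ) ≤ 4 * k * q := by positivity
  have e1 : (M1 : ℝ) * (X.card * (κ * m)) ≤ 2 * W * (f * (3 * m)) := by
    calc (M1 : ℝ) * (X.card * (κ * m)) ≤ (M1 : ℝ) * (X.card * (bohr m α L (η' / 8)).card) := by gcongr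
      _ ≤ _ := h4
      _ ≤ _ := by gcongr
  have e2 : (M1 : ℝ) * κ * W ≤ M1 * κ * (4 * k * q * X.card) := by gcongr
  have e3 : (M1 : ℝ) * κ * W * m ≤ 24 * k * q * f * (W * m) := by
    calc (M1 : ℝ) * κ * W * m ≤ M1 * κ * (4 * k * q * X.card) * m := by gcongr
      _ = 4 * k * q * ((M1 : ℝ) * (X.card * (κ * m))) := by ring
      _ ≤ 4 * k * q * (2 * W * (f * (3 * m))) := by gcongr
      _ = _ := by ring
  have e4 : 24 * k * q * f * (W * m) < (M1 : ℝ) * κ * (W * m) := by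
    apply mul_lt_mul_of_pos_right hM1' (by positivity)
  linarith

lemma regular (J : ℕ) (c : ℕ → ℝ) (κ T : ℝ) (h0 : κ ≤ c 0) (hT : ∀ j, c j ≤ T) (hJ : T < 2 ^ J * κ) :
    ∃ j < J, c (j + 1) ≤ 2 * c j := by
  by_contra hcon
  push Not at hcon
  have : ∀ j ≤ J, 2 ^ j * κ ≤ c j := by
    intro j
    induction j with
    | zero => intro _; simpa using h0
    | succ j ih =>
      intro hj
      have h1 := ih (by omega)
      have h2 := hcon j (by omega)
      rw [pow_succ]; linarith
  have := this J le_rfl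
  linarith [hT J]

open Classical in
lemma counting {k : ℕ} (hk : 1 ≤ k) {R : Set ℤ} (hF : FOne k R) (hm : 0 < m) {q : ℕ} (hq : q = k.factorial)
    {η η' ηp : ℝ} (hη' : 0 < η') (hη : 0 ≤ η) (hηp : η + (k + 1) * q * η' ≤ ηp) (hηp1 : ηp ≤ 1)
    {L : ℕ} (x0 : ℤ) (P X : Finset ℤ) (hX : X ⊆ bohr m α L η) (hXR : ∀ ω ∈ X, x0 + ω ∈ R)
    (hP : ∀ u ∈ P, ∃ ν ∈ bohr m α L η', x0 - L * u + q * ν ∈ R) (Z : ℝ)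
    (hZ : ∀ i : ℕ, 1 ≤ i → i ≤ k → ∀ ω ∈ bohr m α L ηp,
      ((P.filter fun u => x0 - i * ω - (i + 1) * L * u ∈ R).card : ℝ) ≤ Z) :
    (P.card : ℝ) * X.card ≤ k * ((bohr m α L ηp).card * Z) := by
  choose! ν hν1 hν2 using hP
  have h1 : P ×ˢ X ⊆ (Finset.Icc 1 k).biUnion fun i => (P ×ˢ X).filter fun p =>
      (x0 - L * p.1 + q * ν p.1) + (i : ℤ) * ((x0 - L * p.1 + q * ν p.1) - (x0 + p.2)) ∈ R := by
    rintro ⟨u, ω⟩ hp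
    have hp' := Finset.mem_product.1 hp
    obtain ⟨i, hi1, hi2, hi3⟩ := hF _ (hXR ω hp'.2) _ (hν2 u hp'.1)
    rw [Finset.mem_biUnion]
    exact ⟨i, Finset.mem_Icc.2 ⟨hi1, hi2⟩, Finset.mem_filter.2 ⟨hp, hi3⟩⟩
  have h2 := (Finset.card_le_card h1).trans Finset.card_biUnion_le
  rw [Finset.card_product] at h2
  have h3 : ∀ i ∈ Finset.Icc 1 k, (((P ×ˢ X).filter fun p =>
      (x0 - L * p.1 + q * ν p.1) + (i : ℤ) * ((x0 - L * p.1 + q * ν p.1) - (x0 + p.2)) ∈ R).card : ℝ)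
      ≤ (bohr m α L ηp).card * Z := by
    intro i hi
    rw [Finset.mem_Icc] at hi
    obtain ⟨d, hd⟩ := Nat.dvd_factorial (by omega : 0 < i) hi.2
    rw [← hq] at hd
    have h4 : ((P ×ˢ X).filter fun p =>
      (x0 - L * p.1 + q * ν p.1) + (i : ℤ) * ((x0 - L * p.1 + q * ν p.1) - (x0 + p.2)) ∈ R).card
      ≤ ((bohr m α L ηp).sigma fun ω => P.filter fun u => x0 - i * ω - (i + 1) * L * u ∈ R).card := by
      refine Finset.card_le_card_of_injOn (fun p => ⟨p.2 + (-((i + 1) * d : ℤ)) * ν p.1, p.1⟩) ?_ ?_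
      · rintro ⟨u, ω⟩ hp
        rw [Finset.mem_coe, Finset.mem_filter, Finset.mem_product] at hp
        obtain ⟨⟨hu, hω⟩, hR⟩ := hp
        simp only at hu hω hR
        rw [Finset.mem_coe, Finset.mem_sigma, Finset.mem_filter]
        refine ⟨?_, hu, ?_⟩
        · refine bohr_add hm hηp hηp1 hη (by positivity) (hX hω) _ η' (hν1 u hu) ?_
          push_cast
          rw [abs_neg, abs_of_nonneg (by positivity)]
          have h5 : ((i + 1) * d : ℕ) ≤ (k + 1) * q := by
            have : d ≤ q := by rw [hd]; exact Nat.le_mul_of_pos_left d (by omega)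
            exact Nat.mul_le_mul (by omega) this
          have h6 : ((i : ℝ) + 1) * d ≤ (k + 1) * q := by exact_mod_cast h5
          gcongr
        · simp only
          convert hR using 1
          rw [hd]; push_cast; ring
      · rintro ⟨u, ω⟩ _ ⟨u', ω'⟩ _ h
        simp only [Sigma.mk.injEq, heq_eq_eq] at h
        obtain ⟨h3, h4⟩ := h
        subst h4
        rw [Prod.mk.injEq]
        exact ⟨rfl, by linarith⟩
    rw [Finset.card_sigma] at h4
    have h5 : (((P ×ˢ X).filter fun p =>
      (x0 - L * p.1 + q * ν p.1) + (i : ℤ) * ((x0 - L * p.1 + q * ν p.1) - (x0 + p.2)) ∈ R).card : ℝ)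
      ≤ ∑ ω ∈ bohr m α L ηp, ((P.filter fun u => x0 - i * ω - (i + 1) * L * u ∈ R).card : ℝ) := by
      exact_mod_cast h4
    refine h5.trans ((Finset.sum_le_sum fun ω hω => hZ i hi.1 hi.2 ω hω).trans ?_)
    rw [Finset.sum_const, nsmul_eq_mul]
  have h6 : (P.card : ℝ) * X.card ≤ ∑ i ∈ Finset.Icc 1 k, (((P ×ˢ X).filter fun p =>
      (x0 - L * p.1 + q * ν p.1) + (i : ℤ) * ((x0 - L * p.1 + q * ν p.1) - (x0 + p.2)) ∈ R).card : ℝ) := by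
    exact_mod_cast h2
  refine h6.trans ((Finset.sum_le_sum h3).trans ?_)
  rw [Finset.sum_const, nsmul_eq_mul, Nat.card_Icc]; simp

lemma residue_count (q U : ℕ) (hq : 1 ≤ q) (hU : q ≤ U) (ρ : ℤ) :
    (U : ℝ) ≤ 2 * q * ((Finset.Icc (1 : ℤ) U).filter fun u => (q : ℤ) ∣ u + ρ).card := by
  have hq' : (0 : ℤ) < q := by exact_mod_cast hq
  have h1 : U / q ≤ ((Finset.Icc (1 : ℤ) U).filter fun u => (q : ℤ) ∣ u + ρ).card := by
    set e : ℤ := (-ρ - 1) % q with he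
    have he0 : 0 ≤ e := Int.emod_nonneg _ hq'.ne'
    have he1 : e < q := Int.emod_lt_of_pos _ hq'
    have he2 := Int.emod_add_mul_ediv (-ρ - 1) q
    have : (Finset.range (U / q)).card ≤ ((Finset.Icc (1 : ℤ) U).filter fun u => (q : ℤ) ∣ u + ρ).card := by
      refine Finset.card_le_card_of_injOn (fun t : ℕ => e + 1 + q * t) ?_ ?_
      · intro t ht
        rw [Finset.mem_coe, Finset.mem_range] at ht
        rw [Finset.mem_coe, Finset.mem_filter, Finset.mem_Icc]
        have h3 : q * (t + 1) ≤ U := by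
          calc q * (t + 1) ≤ q * (U / q) := Nat.mul_le_mul_left _ (by omega)
            _ ≤ U := Nat.mul_div_le U q
        have h4 : (q : ℤ) * (t + 1) ≤ U := by exact_mod_cast h3
        have h5 : (0 : ℤ) ≤ q * t := by positivity
        refine ⟨⟨by simp only; linarith, by simp only; linarith⟩, ?_⟩
        refine ⟨t - (-ρ - 1) / q, ?_⟩
        rw [← he] at he2
        simp only
        linear_combination he2
      · intro t _ t' _ h
        simp only at h
        have h6 := mul_left_cancel₀ hq'.ne' (add_left_cancel h)
        exact_mod_cast h6
    simpa using this
  have h2 : U ≤ 2 * q * (U / q) := by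
    have h3 := Nat.div_add_mod U q
    have h4 := Nat.mod_lt U (by omega : q > 0)
    have h5 : 1 ≤ U / q := (Nat.one_le_div_iff (by omega)).2 hU
    nlinarith
  have h3 : U ≤ 2 * q * ((Finset.Icc (1 : ℤ) U).filter fun u => (q : ℤ) ∣ u + ρ).card :=
    h2.trans (Nat.mul_le_mul_left _ h1)
  exact_mod_cast h3

end

end TwoK


namespace TwoK

open Classical in
def DenseHyp (k : ℕ) {r : ℕ} (N : ℕ) (α : Fin r → ℝ) (ε1 : ℝ) (R : Set ℤ) : Prop :=
  ∀ Ω : Finset ℤ, (∀ ω ∈ Ω, 10 * |ω| ≤ N ∧ ∀ γ, ∃ t : ℤ, |α γ * ω - t| ≤ ε1) →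
    ∃ x0 : ℤ, 40 * (k + 1) * N ≤ 80 * (k + 1) * x0 + N ∧ 80 * (k + 1) * x0 ≤ 80 * (k + 1) * N + N ∧
      (Ω.card : ℝ) ≤ 4 * k * (Ω.filter fun ω => x0 + ω ∈ R).card

open Classical in
def SparseHyp (k N H U : ℕ) (R : Set ℤ) : Prop :=
  ∀ s h : ℤ, 1 ≤ h → h ≤ H → 40 * ((k : ℤ) + 1) * s ≤ 40 * (k + 1) * N + N → 2 * (N : ℤ) ≤ 5 * s →
    32 * (k : ℝ) ^ 2 * k.factorial * ((Finset.Icc (1 : ℤ) U).filter fun u => s - h * u ∈ R).card ≤ U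

open Classical in
lemma residue_choice {m r : ℕ} {α : Fin r → ℝ} {L q : ℕ} (hq : 1 ≤ q) (hL : 1 ≤ L) (X : Finset ℤ)
    (hX : ∀ ω ∈ X, (L : ℤ) ∣ ω) :
    ∃ ρ : ℤ, (X.card : ℝ) ≤ q * (X.filter fun ω : ℤ => ∃ w : ℤ, ω = L * w ∧ (q : ℤ) ∣ w - ρ).card := by
  have hq' : (0 : ℤ) < q := by exact_mod_cast hq
  have hqR : (0 : ℝ) < q := by exact_mod_cast hq
  obtain ⟨ρ, hρ, h⟩ := Finset.exists_le_card_fiber_of_nsmul_le_card_of_maps_to (s := X)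
    (t := Finset.Ico (0 : ℤ) q) (f := fun ω => (ω / L) % q) (b := (X.card : ℝ) / q)
    (fun ω _ => Finset.mem_Ico.2 ⟨Int.emod_nonneg _ hq'.ne', Int.emod_lt_of_pos _ hq'⟩)
    ⟨0, Finset.mem_Ico.2 ⟨le_rfl, hq'⟩⟩
    (by rw [Int.card_Ico, nsmul_eq_mul]; simp; rw [mul_div_cancel₀ _ hqR.ne'])
  refine ⟨ρ, ?_⟩
  rw [div_le_iff₀ hqR] at h
  have h2 : (X.filter fun ω => (ω / L) % q = ρ) ⊆
      X.filter fun ω : ℤ => ∃ w : ℤ, ω = L * w ∧ (q : ℤ) ∣ w - ρ := by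
    intro ω hω
    rw [Finset.mem_filter] at hω ⊢
    refine ⟨hω.1, ω / L, (Int.mul_ediv_cancel' (hX ω hω.1)).symm, ?_⟩
    rw [← hω.2]
    exact Int.dvd_self_sub_emod
  have h3 : ((X.filter fun ω => (ω / L) % q = ρ).card : ℝ) ≤
      (X.filter fun ω : ℤ => ∃ w : ℤ, ω = L * w ∧ (q : ℤ) ∣ w - ρ).card := by
    exact_mod_cast Finset.card_le_card h2
  nlinarith

set_option maxHeartbeats 4000000 in
theorem level (k r : ℕ) (hk : 1 ≤ k) (ε1 a : ℝ) (hε1 : 0 < ε1) (ha : 0 < a) (ha1 : a ≤ 1) :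
    ∃ ap : ℝ, 0 < ap ∧ ap ≤ a ∧ ∃ (H : ℕ) (ξ : ℝ) (m0 : ℕ), 0 < ξ ∧ 1 ≤ H ∧ ξ * (160 * (k + 1) * H) ≤ 1 ∧
      ∀ (m N : ℕ) (α : Fin r → ℝ) (R : Set ℤ), m0 ≤ m → m ≤ 4 * N → FOne k R →
        DenseHyp k N α ε1 R → SparseHyp k N H ⌊ξ * m⌋₊ R → VS m α a = VS m α ap → False := by
  classical
  have hkR : (1 : ℝ) ≤ k := by exact_mod_cast hk
  -- constants
  obtain ⟨q, hq⟩ : ∃ q, q = k.factorial := ⟨_, rfl⟩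
  have hq1 : 1 ≤ q := by rw [hq]; exact Nat.factorial_pos _
  have hqR : (1 : ℝ) ≤ q := by exact_mod_cast hq1
  obtain ⟨B, hB, haB⟩ : ∃ B : ℕ, 0 < B ∧ 1 / (B : ℝ) ≤ a := by
    obtain ⟨n, hn⟩ := exists_nat_one_div_lt ha
    exact ⟨n + 1, by omega, by push_cast; exact hn.le⟩
  obtain ⟨L, hL⟩ : ∃ L, L = (B ^ r).factorial := ⟨_, rfl⟩
  have hL1 : 1 ≤ L := by rw [hL]; exact Nat.factorial_pos _
  have hLR : (1 : ℝ) ≤ L := by exact_mod_cast hL1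
  obtain ⟨C, hC⟩ : ∃ C : ℕ, C = B ^ r := ⟨_, rfl⟩
  have hC1 : 1 ≤ C := by rw [hC]; exact pow_pos hB r
  have hCR : (1 : ℝ) ≤ C := by exact_mod_cast hC1
  obtain ⟨e1, he0, he1, he2, he3⟩ : ∃ e1 : ℝ, 0 < e1 ∧ e1 ≤ ε1 ∧ e1 ≤ a / (4 * C) ∧
      e1 ≤ 1 / (640 * k * (k + 1)) := by
    refine ⟨min ε1 (min (a / (4 * C)) (1 / (640 * k * (k + 1)))), by positivity, ?_, ?_, ?_⟩
    · exact min_le_left _ _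
    · exact (min_le_right _ _).trans (min_le_left _ _)
    · exact (min_le_right _ _).trans (min_le_right _ _)
  have he3' : e1 * (640 * k * (k + 1)) ≤ 1 := by rwa [le_div_iff₀ (by positivity)] at he3
  have he2' : e1 * (4 * C) ≤ a := by rwa [le_div_iff₀ (by positivity)] at he2
  have he11 : e1 ≤ 1 := by nlinarith
  -- Bohr lower bounds
  have hlow : ∀ η : ℝ, 0 < η → η ≤ 1 → ∃ κ : ℝ, 0 < κ ∧ ∃ m1 : ℕ, ∀ m : ℕ, m1 ≤ m → 0 < m →
      ∀ α : Fin r → ℝ, κ * m ≤ (bohr m α L η).card := by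
    intro η h0 h1
    obtain ⟨n, hn⟩ := exists_nat_one_div_lt h0
    obtain ⟨m1, hm1⟩ := exists_nat_ge (L / η)
    have hp : (0 : ℝ) < ((n + 1) ^ r : ℕ) := by exact_mod_cast pow_pos (Nat.succ_pos n) r
    refine ⟨η / (2 * L * ((n + 1) ^ r : ℕ)), by positivity, m1, ?_⟩
    intro m hm hm0 α
    refine bohr_card_ge hm0 L hL1 η h0 h1 (n + 1) (by omega) (by push_cast; exact hn.le) ?_
    rw [div_le_iff₀ h0] at hm1
    have : (m1 : ℝ) ≤ m := by exact_mod_cast hm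
    nlinarith
  obtain ⟨κ1, hκ1, m1, hm1⟩ := hlow (e1 / 2) (by positivity) (by linarith)
  obtain ⟨J, hJ⟩ : ∃ J : ℕ, 3 < 2 ^ J * κ1 := by
    obtain ⟨J, hJ⟩ := pow_unbounded_of_one_lt (3 / κ1) (by norm_num : (1 : ℝ) < 2)
    exact ⟨J, by rwa [div_lt_iff₀ hκ1] at hJ⟩
  have hJ0 : (0 : ℝ) < J + 1 := by positivity
  obtain ⟨st, hst⟩ : ∃ st : ℝ, st = e1 / (2 * (J + 1)) := ⟨_, rfl⟩
  have hst0 : 0 < st := by rw [hst]; positivity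
  have hstJ : st * (J + 1) = e1 / 2 := by rw [hst]; field_simp
  obtain ⟨η', hη'⟩ : ∃ η' : ℝ, η' = st / ((k + 1) * q) := ⟨_, rfl⟩
  have hη'0 : 0 < η' := by rw [hη']; positivity
  have hη'e : (k + 1) * q * η' = st := by rw [hη']; field_simp
  have hst1 : st ≤ 1 := by nlinarith
  have hη'1 : η' ≤ 1 := by
    have : (1 : ℝ) ≤ (k + 1) * q := by nlinarith
    nlinarith
  obtain ⟨κ2, hκ2, m2, hm2⟩ := hlow (η' / 8) (by positivity) (by linarith)
  obtain ⟨K1, hK11, hK1⟩ : ∃ K1 : ℕ, 1 ≤ K1 ∧ 16 * L * a ≤ K1 * η' := by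
    obtain ⟨n, hn⟩ := exists_nat_ge (16 * L * a / η')
    rw [div_le_iff₀ hη'0] at hn
    refine ⟨n + 1, by omega, ?_⟩
    push_cast; nlinarith
  obtain ⟨M1, hM11, hM1⟩ : ∃ M1 : ℕ, k ≤ M1 ∧
      24 * k * q * ((k + 2) ^ (2 * k * (K1 + 1)) : ℕ) < M1 * κ2 := by
    obtain ⟨n, hn⟩ := exists_nat_gt (24 * k * q * ((k + 2) ^ (2 * k * (K1 + 1)) : ℕ) / κ2)
    rw [div_lt_iff₀ hκ2] at hn
    refine ⟨n + k, by omega, ?_⟩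
    push_cast at hn ⊢; nlinarith
  have hM1R : (1 : ℝ) ≤ M1 := by exact_mod_cast (by omega : 1 ≤ M1)
  have hK1R : (1 : ℝ) ≤ K1 := by exact_mod_cast hK11
  obtain ⟨ap, hap0, hapa, hap⟩ : ∃ ap : ℝ, 0 < ap ∧ ap ≤ a ∧
      16 * (K1 * M1 * L * ((r + 1) * ap)) ≤ η' := by
    refine ⟨min a (η' / (16 * (K1 * M1 * L * (r + 1)))), by positivity, min_le_left _ _, ?_⟩
    have h1 := min_le_right a (η' / (16 * (K1 * M1 * L * (r + 1))))
    rw [le_div_iff₀ (by positivity)] at h1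
    linarith
  obtain ⟨H, hH⟩ : ∃ H, H = (k + 1) * L := ⟨_, rfl⟩
  have hH1 : 1 ≤ H := by rw [hH]; exact Nat.mul_le_mul (by omega : 1 ≤ k + 1) hL1
  have hHR : (1 : ℝ) ≤ H := by exact_mod_cast hH1
  obtain ⟨ξ, hξ0, hξ1, hξ2⟩ : ∃ ξ : ℝ, 0 < ξ ∧ ξ * (2 * C) ≤ a ∧ ξ * (160 * (k + 1) * H) ≤ 1 := by
    refine ⟨min (a / (2 * C)) (1 / (160 * (k + 1) * H)), by positivity, ?_, ?_⟩
    · have h1 := min_le_left (a / (2 * C)) (1 / (160 * ((k : ℝ) + 1) * H))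
      rwa [le_div_iff₀ (by positivity)] at h1
    · have h1 := min_le_right (a / (2 * C)) (1 / (160 * ((k : ℝ) + 1) * H))
      rwa [le_div_iff₀ (by positivity)] at h1
  obtain ⟨m3, hm3⟩ := exists_nat_ge (q / ξ)
  rw [div_le_iff₀ hξ0] at hm3
  refine ⟨ap, hap0, hapa, H, ξ, m1 + m2 + m3 + 1, hξ0, hH1, hξ2, ?_⟩
  intro m N α R hm hmN hF hD hS hV
  have hm0 : 0 < m := by omega
  have hmR : (0 : ℝ) < m := by exact_mod_cast hm0
  have hmNR : (m : ℝ) ≤ 4 * N := by exact_mod_cast hmN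
  obtain ⟨U, hU⟩ : ∃ U, U = ⌊ξ * m⌋₊ := ⟨_, rfl⟩
  rw [← hU] at hS
  have hUle : (U : ℝ) ≤ ξ * m := by rw [hU]; exact Nat.floor_le (by positivity)
  have hUq : q ≤ U := by
    rw [hU]
    refine Nat.le_floor (hm3.trans ?_)
    rw [mul_comm]
    have : (m3 : ℝ) ≤ m := by exact_mod_cast (by omega : m3 ≤ m)
    gcongr
  have hUR : (0 : ℝ) < U := by exact_mod_cast (by omega : 0 < U)
  -- regular scale
  obtain ⟨j, hj, hreg⟩ := regular J (fun j => ((bohr m α L (e1 / 2 + j * st)).card : ℝ)) (κ1 * m) (3 * m)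
    (by simpa using hm1 m (by omega) hm0 α) (fun j => bohr_card_le hm0 L _) (by nlinarith)
  obtain ⟨η, hη⟩ : ∃ η : ℝ, η = e1 / 2 + j * st := ⟨_, rfl⟩
  have hjR : (j : ℝ) + 1 ≤ J := by exact_mod_cast hj
  have hηp : η + st ≤ e1 := by rw [hη]; nlinarith
  have hη0 : 0 < η := by rw [hη]; positivity
  have hreg' : ((bohr m α L (η + st)).card : ℝ) ≤ 2 * (bohr m α L η).card := by
    have e : e1 / 2 + ((j + 1 : ℕ) : ℝ) * st = η + st := by rw [hη]; push_cast; ring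
    simp only [e] at hreg
    rw [hη]; rw [hη] at hreg; exact hreg
  -- size control
  have hsize : ∀ ω ∈ bohr m α L (η + st), |(ω : ℝ)| * (160 * k * (k + 1)) ≤ N := by
    intro ω hω
    rw [mem_bohr hm0 (by linarith)] at hω
    obtain ⟨-, x, hx, hxn⟩ := hω
    have h1 := (hx.close hm0 (hxn.trans hηp)).1
    have h2 : |(ω : ℝ)| ≤ e1 * (4 * N) := h1.trans (by gcongr)
    have h3 : |(ω : ℝ)| * (160 * k * (k + 1)) ≤ e1 * (4 * N) * (160 * k * (k + 1)) := by gcongr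
    have h4 : e1 * (4 * N) * (160 * k * (k + 1)) = (e1 * (640 * k * (k + 1))) * N := by ring
    have h5 : (e1 * (640 * k * (k + 1))) * (N : ℝ) ≤ 1 * N := by gcongr
    linarith
  have hsub : bohr m α L η ⊆ bohr m α L (η + st) := bohr_mono (by linarith)
  have hne : 0 < (bohr m α L η).card := by
    rw [Finset.card_pos]
    refine ⟨0, ?_⟩
    rw [mem_bohr hm0 (by linarith)]
    exact ⟨dvd_zero _, 0, IsLift.zero, by simpa using hη0.le⟩
  obtain ⟨x0, hx1, hx2, hx3⟩ := hD (bohr m α L η) (by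
    intro ω hω
    constructor
    · have h1 := hsize ω (hsub hω)
      have h2 : 10 * |(ω : ℝ)| ≤ N := by
        have : (10 : ℝ) ≤ 160 * k * (k + 1) := by nlinarith
        have := mul_le_mul_of_nonneg_left this (abs_nonneg (ω : ℝ))
        linarith
      exact_mod_cast h2
    · rw [mem_bohr hm0 (by linarith)] at hω
      obtain ⟨-, x, hx, hxn⟩ := hω
      exact (hx.close hm0 (hxn.trans (by linarith : η ≤ ε1))).2)
  set X := (bohr m α L η).filter fun ω => x0 + ω ∈ R with hX
  obtain ⟨ρ, hρ⟩ := residue_choice (m := m) (α := α) hq1 hL1 X (by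
    intro ω hω
    have := (Finset.mem_filter.1 hω).1
    rw [mem_bohr hm0 (by linarith)] at this
    exact this.1)
  set P := (Finset.Icc (1 : ℤ) U).filter fun u => (q : ℤ) ∣ u + ρ with hP
  have hPcard := residue_count q U hq1 hUq ρ
  rw [← hP] at hPcard
  have hspread : ∀ u ∈ P, ∃ ν ∈ bohr m α L η', x0 - L * u + q * ν ∈ R := by
    intro u hu
    rw [hP, Finset.mem_filter, Finset.mem_Icc] at hu
    refine spread hk hF hm0 hB hq1 hK11 hM11 (η := η) (ηp := η + st) (e1 := e1) (κ := κ2) ha haB hap0.le hη'0 hη'1 hη0.le ?_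
      (by linarith) hV hL hap hK1 ?_ x0 ρ hκ2 hreg' (hm2 m (by omega) hm0 α) ?_ hne hM1 u ?_ hu.2
    · have : (q : ℝ) * η' ≤ (k + 1) * q * η' := by
        have : 0 ≤ (k : ℝ) * q * η' := by positivity
        linarith
      linarith
    · rw [← hC]
      have : (η + st) * C ≤ e1 * C := by gcongr
      have : 0 ≤ e1 * C := by positivity
      linarith
    · refine hx3.trans ?_
      have e : (X.filter fun ω : ℤ => ∃ w : ℤ, ω = L * w ∧ (q : ℤ) ∣ w - ρ) =
          (bohr m α L η).filter fun ω : ℤ => x0 + ω ∈ R ∧ ∃ w : ℤ, ω = L * w ∧ (q : ℤ) ∣ w - ρ := by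
        rw [hX, Finset.filter_filter]
      rw [← e]
      have := mul_le_mul_of_nonneg_left hρ (by positivity : (0 : ℝ) ≤ 4 * k)
      linarith
    · rw [← hC]
      have h1 : |(u : ℝ)| ≤ U := by
        rw [abs_of_nonneg (by exact_mod_cast (by omega : (0 : ℤ) ≤ u))]
        exact_mod_cast hu.1.2
      have h2 : |(u : ℝ)| * C * 2 ≤ (ξ * m) * C * 2 := by gcongr; exact h1.trans hUle
      have h3 : (ξ * (2 * C)) * m ≤ a * m := by gcongr
      linarith
  have hfin := counting hk hF hm0 hq hη'0 hη0.le (ηp := η + st) (by linarith) (by linarith) x0 P X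
    (Finset.filter_subset _ _) (fun ω hω => (Finset.mem_filter.1 hω).2) hspread
    (U / (32 * (k : ℝ) ^ 2 * q)) (by
      intro i hi1 hi2 ω hω
      rw [le_div_iff₀ (by positivity)]
      have hsz := hsize ω hω
      have hiR : (i : ℝ) ≤ k := by exact_mod_cast hi2
      have hb : |(i : ℝ) * ω| * (160 * (k + 1)) ≤ N := by
        rw [abs_mul, Nat.abs_cast]
        have : (i : ℝ) * |(ω : ℝ)| * (160 * (k + 1)) ≤ k * |(ω : ℝ)| * (160 * (k + 1)) := by gcongr
        linarith
      have hb' : |(i : ℤ) * ω| * (160 * (k + 1)) ≤ N := by exact_mod_cast hb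
      have hbl : -((i : ℤ) * ω) * (160 * (k + 1)) ≤ N := by
        refine le_trans ?_ hb'
        exact mul_le_mul_of_nonneg_right (neg_le_abs _) (by positivity)
      have hbu : ((i : ℤ) * ω) * (160 * (k + 1)) ≤ N := by
        refine le_trans ?_ hb'
        exact mul_le_mul_of_nonneg_right (le_abs_self _) (by positivity)
      have hN0 : (0 : ℤ) ≤ N := by positivity
      have hk1 : (1 : ℤ) ≤ k := by exact_mod_cast hk
      have hs := hS (x0 - i * ω) ((i + 1) * L) (by
          have : (1 : ℤ) ≤ L := by exact_mod_cast hL1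
          nlinarith) (by
          rw [hH]; push_cast
          have : (i : ℤ) ≤ k := by exact_mod_cast hi2
          gcongr) (by nlinarith) (by
          have h1 : 80 * ((k : ℤ) + 1) * (2 * N) ≤ 80 * ((k : ℤ) + 1) * (5 * (x0 - i * ω)) := by
            nlinarith
          exact le_of_mul_le_mul_left h1 (by positivity))
      rw [← hq] at hs
      have hPs : ((P.filter fun u => x0 - i * ω - (i + 1) * L * u ∈ R).card : ℝ) ≤
          ((Finset.Icc (1 : ℤ) U).filter fun u => x0 - i * ω - ((i + 1) * L) * u ∈ R).card := by
        exact_mod_cast Finset.card_le_card (Finset.filter_subset_filter _ (Finset.filter_subset _ _))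
      have := mul_le_mul_of_nonneg_left hPs (by positivity : (0 : ℝ) ≤ 32 * (k : ℝ) ^ 2 * q)
      linarith)
  set W : ℝ := ((bohr m α L η).card : ℝ) with hW
  have hW0 : 0 < W := by rw [hW]; exact_mod_cast hne
  have hZ0 : 0 ≤ (U : ℝ) / (32 * (k : ℝ) ^ 2 * q) := by positivity
  have f1 : (k : ℝ) * ((bohr m α L (η + st)).card * (U / (32 * (k : ℝ) ^ 2 * q)))
      ≤ k * (2 * W * (U / (32 * (k : ℝ) ^ 2 * q))) := by gcongr
  have f2 : k * (2 * W * (U / (32 * (k : ℝ) ^ 2 * q))) = U * W / (16 * k * q) := by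
    field_simp; norm_num
  have f3 : (U : ℝ) * W ≤ (2 * q * P.card) * (4 * k * X.card) := by gcongr
  have f4 : (2 * q * (P.card : ℝ)) * (4 * k * X.card) = 8 * k * q * (P.card * X.card) := by ring
  have f5 : 8 * k * q * ((P.card : ℝ) * X.card) ≤ 8 * k * q * (U * W / (16 * k * q)) := by
    gcongr; linarith
  have f6 : 8 * k * q * (U * W / (16 * k * q)) = U * W / 2 := by
    field_simp; norm_num
  have f7 : 0 < (U : ℝ) * W := by positivity
  linarith

end TwoK


namespace TwoK

lemma iter_aux (k r : ℕ) (hk : 1 ≤ k) (ε1 : ℝ) (hε1 : 0 < ε1) (n : ℕ) :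
    ∀ a : ℝ, 0 < a → a ≤ 1 → ∃ (H m0 : ℕ) (ξ0 : ℝ), 0 < ξ0 ∧
      ∀ (m N : ℕ) (α : Fin r → ℝ) (R : Set ℤ), m0 ≤ m → m ≤ 4 * N → FOne k R →
        DenseHyp k N α ε1 R →
        (∀ (h : ℕ) (ξ : ℝ), 1 ≤ h → h ≤ H → ξ0 ≤ ξ → ξ * (160 * (k + 1) * h) ≤ 1 →
          SparseHyp k N h ⌊ξ * m⌋₊ R) →
        Module.finrank ℝ (VS m α a) < n → False := by
  induction n with
  | zero =>
    intro a ha ha1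
    refine ⟨0, 0, 1, one_pos, ?_⟩
    intro m N α R _ _ _ _ _ h
    omega
  | succ n ih =>
    intro a ha ha1
    obtain ⟨ap, hap, hapa, H', ξ', m0', hξ', hH', hξH, hlev⟩ := level k r hk ε1 a hε1 ha ha1
    obtain ⟨H, m0, ξ0, hξ0, hi⟩ := ih ap hap (hapa.trans ha1)
    refine ⟨max H H', max m0 m0', min ξ0 ξ', lt_min hξ0 hξ', ?_⟩
    intro m N α R hm hmN hF hD hS hr
    by_cases heq : VS m α a = VS m α ap
    · exact hlev m N α R ((le_max_right _ _).trans hm) hmN hF hD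
        (hS H' ξ' hH' (le_max_right _ _) (min_le_right _ _) hξH) heq
    · have hlt : VS m α ap < VS m α a := lt_of_le_of_ne (VS_mono hapa) (Ne.symm heq)
      have := Submodule.finrank_lt_finrank_of_lt hlt
      exact hi m N α R ((le_max_left _ _).trans hm) hmN hF hD
        (fun h ξ h1 h2 h3 h4 => hS h ξ h1 (h2.trans (le_max_left _ _)) ((min_le_left _ _).trans h3) h4)
        (by omega)

lemma iter (k r : ℕ) (hk : 1 ≤ k) (ε1 : ℝ) (hε1 : 0 < ε1) :
    ∃ (H m0 : ℕ) (ξ0 : ℝ), 0 < ξ0 ∧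
      ∀ (m N : ℕ) (α : Fin r → ℝ) (R : Set ℤ), m0 ≤ m → m ≤ 4 * N → FOne k R →
        DenseHyp k N α ε1 R →
        (∀ (h : ℕ) (ξ : ℝ), 1 ≤ h → h ≤ H → ξ0 ≤ ξ → ξ * (160 * (k + 1) * h) ≤ 1 →
          SparseHyp k N h ⌊ξ * m⌋₊ R) → False := by
  obtain ⟨H, m0, ξ0, hξ0, hi⟩ := iter_aux k r hk ε1 hε1
    (Module.finrank ℝ (ℝ × (Fin r → ℝ)) + 1) 1 one_pos le_rfl
  refine ⟨H, m0, ξ0, hξ0, ?_⟩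
  intro m N α R hm hmN hF hD hS
  exact hi m N α R hm hmN hF hD hS (Nat.lt_succ_of_le (Submodule.finrank_le _))

lemma red_mono {R : Set ℤ} {F G : Finset ℤ} (h : F ⊆ G) : red R F ⊆ red R G := by
  intro z hz
  rw [mem_red] at hz ⊢
  exact ⟨h hz.1, hz.2⟩

/-- Sparseness along short progressions. -/
lemma sparse_hyp {k : ℕ} (hk : 1 ≤ k) {R : Set ℤ} (hF : FOne k R) (M N m h0 H : ℕ) (ξ0 ξ θ : ℝ)
    (hθ : θ * (240 * k * (k + 1) ^ 2 * (32 * k ^ 2 * k.factorial)) ≤ 1) (hθ0 : 0 < θ)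
    (hh0 : h0 ≤ H) (hM : 1 ≤ M)
    (hMcond : ∀ h : ℤ, 1 ≤ h → h ≤ H → ∀ y : ℤ, ∃ n : ℕ, n ≤ M ∧ y + n * h ∈ R)
    (hR : ((red R (Finset.Icc 1 (N : ℤ))).card : ℝ) ≤ 2 * θ * N)
    (hξ0 : 0 < ξ0) (hξ : ξ0 ≤ ξ) (hξh : ξ * (160 * (k + 1) * h0) ≤ 1)
    (hNM : (M : ℝ) ≤ ξ0 * N) (hNk : 100 * (k + 1) ≤ N) (hm : 2 * N < m) (hm4 : m ≤ 4 * N) :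
    SparseHyp k N h0 ⌊ξ * m⌋₊ R := by
  classical
  intro s h h1 h2 h3 h4
  have hξp : 0 < ξ := hξ0.trans_le hξ
  have hmR : (2 : ℝ) * N ≤ m := by exact_mod_cast hm.le
  have hm4R : (m : ℝ) ≤ 4 * N := by exact_mod_cast hm4
  have hN0 : (0 : ℝ) ≤ N := by positivity
  obtain ⟨U, hUdef⟩ : ∃ U, U = ⌊ξ * m⌋₊ := ⟨_, rfl⟩
  rw [← hUdef]
  have hMU : 2 * M ≤ U := by
    rw [hUdef]
    apply Nat.le_floor
    push_cast
    calc (2 : ℝ) * M ≤ ξ0 * (2 * N) := by linarith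
      _ ≤ ξ * m := by gcongr
  have hUle : (U : ℝ) ≤ ξ * m := by rw [hUdef]; exact Nat.floor_le (by positivity)
  obtain ⟨T, hT⟩ : ∃ T, T = N / (40 * (k + 1)) + 1 := ⟨_, rfl⟩
  have hT1 : N < 40 * (k + 1) * T := by
    rw [hT]; exact Nat.lt_mul_div_succ N (by positivity)
  have hT2 : 40 * (k + 1) * T ≤ N + 40 * (k + 1) := by
    rw [hT]
    have := Nat.mul_div_le N (40 * (k + 1))
    rw [mul_add, mul_one]
    omega
  have hhR : (h : ℝ) ≤ h0 := by exact_mod_cast h2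
  have hh1R : (1 : ℝ) ≤ h := by exact_mod_cast h1
  have hU : 40 * ((k : ℝ) + 1) * (h * U) ≤ N := by
    calc 40 * ((k : ℝ) + 1) * (h * U) ≤ 40 * ((k : ℝ) + 1) * (h0 * (ξ * (4 * N))) := by
          gcongr
          exact hUle.trans (by gcongr)
      _ = (ξ * (160 * (k + 1) * h0)) * N := by ring
      _ ≤ 1 * N := by gcongr
      _ = N := one_mul _
  have hUZ : 40 * ((k : ℤ) + 1) * (h * U) ≤ N := by exact_mod_cast hU
  have hT1Z : (N : ℤ) < 40 * ((k : ℤ) + 1) * T := by exact_mod_cast hT1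
  have hT2Z : 40 * ((k : ℤ) + 1) * T ≤ N + 40 * (k + 1) := by exact_mod_cast hT2
  have hNkZ : 100 * ((k : ℤ) + 1) ≤ N := by exact_mod_cast hNk
  have hkZ : (0 : ℤ) < 40 * ((k : ℤ) + 1) := by positivity
  have hsp := sparse hF M U N T θ s h h1 (hMcond h h1 (h2.trans (by exact_mod_cast hh0))) hR
    (by omega) hMU (by exact_mod_cast hT1.le) (by rw [hT]; exact Nat.le_add_left 1 _)
    (by
      have : 40 * ((k : ℤ) + 1) * s ≤ 40 * ((k : ℤ) + 1) * (N + T) := by linarith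
      exact le_of_mul_le_mul_left this hkZ)
    (by
      have e : ((k : ℤ) + 1) * (2 * h * U + 2 * T) + 1 =
        2 * (((k : ℤ) + 1) * (h * U)) + 2 * (((k : ℤ) + 1) * T) + 1 := by ring
      rw [e]
      rw [mul_assoc] at hUZ hT2Z
      generalize ((k : ℤ) + 1) * (h * U) = A at *
      generalize ((k : ℤ) + 1) * T = B at *
      omega)
    (by omega)
  have hcard : ((Finset.Icc (1 : ℤ) U).filter fun u => s - h * u ∈ R).card ≤
      (red R ((Finset.Icc (1 : ℤ) U).image (fun n => s - h * n))).card := by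
    apply Finset.card_le_card_of_injOn (fun n => s - h * n)
    · intro u hu
      have hu' := Finset.mem_filter.1 hu
      exact mem_red.2 ⟨Finset.mem_image_of_mem _ hu'.1, hu'.2⟩
    · intro u _ v _ huv
      have h5 : h * u = h * v := by
        have : s - h * u = s - h * v := huv
        linarith
      exact mul_left_cancel₀ (by omega) h5
  have hcR : (((Finset.Icc (1 : ℤ) U).filter fun u => s - h * u ∈ R).card : ℝ) ≤
      240 * k * (k + 1) ^ 2 * θ * U := le_trans (by exact_mod_cast hcard) hsp
  calc 32 * (k : ℝ) ^ 2 * k.factorial * ((Finset.Icc (1 : ℤ) U).filter fun u => s - h * u ∈ R).card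
      ≤ 32 * (k : ℝ) ^ 2 * k.factorial * (240 * k * (k + 1) ^ 2 * θ * U) := by gcongr
    _ = (θ * (240 * k * (k + 1) ^ 2 * (32 * k ^ 2 * k.factorial))) * U := by ring
    _ ≤ 1 * U := by gcongr
    _ = U := one_mul _

theorem core (k : ℕ) (hk : 1 ≤ k) (δ : ℝ) (hδ : 0 < δ) :
    ∃ M0 H : ℕ, ∀ (R : Set ℤ) (M p : ℕ), M0 ≤ M → FOne k R → (∀ n : ℤ, 1 ≤ n → n ≤ M → n ∉ R) →
      (∀ h : ℤ, 1 ≤ h → h ≤ H → ∀ y : ℤ, ∃ n : ℕ, n ≤ M ∧ y + n * h ∈ R) → 1 ≤ p →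
      δ * p ≤ (red R (Finset.Icc 1 (p : ℤ))).card → False := by
  classical
  have hkR : (1 : ℝ) ≤ k := by exact_mod_cast hk
  have hfac : (0 : ℝ) < k.factorial := by exact_mod_cast Nat.factorial_pos k
  obtain ⟨C, hC⟩ : ∃ C : ℝ, C = 240 * k * (k + 1) ^ 2 * (32 * k ^ 2 * k.factorial) := ⟨_, rfl⟩
  have hC0 : 0 < C := by rw [hC]; positivity
  obtain ⟨θ, hθ0, hθδ, hθC⟩ : ∃ θ : ℝ, 0 < θ ∧ θ ≤ δ ∧ θ * C ≤ 1 := by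
    refine ⟨min δ (1 / C), lt_min hδ (by positivity), min_le_left _ _, ?_⟩
    rw [← le_div_iff₀ hC0]; exact min_le_right _ _
  obtain ⟨ε1, r, hε1, hdense⟩ := dense k hk θ hθ0
  obtain ⟨H, m0, ξ0, hξ0, hit⟩ := iter k r hk ε1 hε1
  obtain ⟨K, hK⟩ := exists_nat_gt (1 / ξ0)
  have hK1 : 1 ≤ ξ0 * K := by
    rw [div_lt_iff₀ hξ0] at hK; linarith
  obtain ⟨Q, hQ⟩ := exists_nat_gt (((k : ℝ) + 2) ^ (2 * k * K) / θ)
  refine ⟨Q + m0 + 100 * (k + 1), H, ?_⟩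
  intro R M p hM hF hblue hMcond hp hcnt
  have hP : ∃ n : ℕ, 1 ≤ n ∧ θ * n ≤ (red R (Finset.Icc 1 (n : ℤ))).card :=
    ⟨p, hp, le_trans (by gcongr) hcnt⟩
  obtain ⟨N, ⟨hN1, hN⟩, hmin⟩ : ∃ N : ℕ, (1 ≤ N ∧ θ * N ≤ (red R (Finset.Icc 1 (N : ℤ))).card) ∧
      ∀ n : ℕ, n < N → 1 ≤ n → ((red R (Finset.Icc 1 (n : ℤ))).card : ℝ) < θ * n := by
    refine ⟨Nat.find hP, Nat.find_spec hP, fun n hn h1 => ?_⟩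
    have := Nat.find_min hP hn
    by_contra hc
    exact this ⟨h1, not_lt.1 hc⟩
  have hN1R : (1 : ℝ) ≤ N := by exact_mod_cast hN1
  have hMN : M < N := by
    by_contra hc
    have : red R (Finset.Icc 1 (N : ℤ)) = ∅ := by
      apply Finset.eq_empty_of_forall_notMem
      intro z hz
      rw [mem_red, Finset.mem_Icc] at hz
      exact hblue z hz.1.1 (by omega) hz.2
    rw [this] at hN
    simp at hN
    nlinarith
  rw [div_lt_iff₀ hθ0] at hQ
  have hpow : (1 : ℝ) ≤ ((k : ℝ) + 2) ^ (2 * k * K) := one_le_pow₀ (by linarith)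
  have hQN : (Q : ℝ) ≤ N := by
    have : Q ≤ N := by omega
    exact_mod_cast this
  have hθN : ((k : ℝ) + 2) ^ (2 * k * K) < θ * N := by nlinarith
  have hKM : K * M ≤ N := by
    by_contra hc
    have h1 := ladder hk hF M (by omega) hblue K
    have h2 : red R (Finset.Icc 1 (N : ℤ)) ⊆ red R (Finset.Icc 1 ((K : ℤ) * M)) := by
      apply red_mono
      apply Finset.Icc_subset_Icc_right
      have : N ≤ K * M := by omega
      exact_mod_cast this
    have h3 : ((red R (Finset.Icc 1 (N : ℤ))).card : ℝ) ≤ ((k : ℝ) + 2) ^ (2 * k * K) := by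
      exact_mod_cast (Finset.card_le_card h2).trans h1
    linarith
  have hNM : (M : ℝ) ≤ ξ0 * N := by
    have h1 : (K : ℝ) * M ≤ N := by exact_mod_cast hKM
    have h2 : (0 : ℝ) ≤ M := by positivity
    nlinarith
  have hup : ((red R (Finset.Icc 1 (N : ℤ))).card : ℝ) ≤ 2 * θ * N := by
    have h1 := hmin (N - 1) (by omega) (by omega)
    have h2 : red R (Finset.Icc 1 (N : ℤ)) ⊆ insert (N : ℤ) (red R (Finset.Icc 1 ((N - 1 : ℕ) : ℤ))) := by
      intro z hz
      rw [Finset.mem_insert, mem_red, Finset.mem_Icc]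
      rw [mem_red, Finset.mem_Icc] at hz
      by_cases hzN : z = N
      · exact Or.inl hzN
      · exact Or.inr ⟨⟨hz.1.1, by omega⟩, hz.2⟩
    have h3 := (Finset.card_le_card h2).trans (Finset.card_insert_le _ _)
    have h4 : ((red R (Finset.Icc 1 (N : ℤ))).card : ℝ) ≤
      (red R (Finset.Icc 1 ((N - 1 : ℕ) : ℤ))).card + 1 := by exact_mod_cast h3
    have h5 : ((N - 1 : ℕ) : ℝ) ≤ N := by exact_mod_cast Nat.sub_le _ _
    nlinarith
  have hhalf : θ * N / 2 ≤ (red R (Finset.Ioc ((N : ℤ) / 2) N)).card := by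
    have h1 := hmin (N / 2) (by omega) (by omega)
    have h2 : red R (Finset.Icc 1 (N : ℤ)) ⊆ red R (Finset.Icc 1 ((N / 2 : ℕ) : ℤ)) ∪
        red R (Finset.Ioc ((N : ℤ) / 2) N) := by
      intro z hz
      rw [Finset.mem_union, mem_red, mem_red, Finset.mem_Icc, Finset.mem_Ioc]
      rw [mem_red, Finset.mem_Icc] at hz
      by_cases hzN : z ≤ (N : ℤ) / 2
      · exact Or.inl ⟨⟨hz.1.1, by omega⟩, hz.2⟩
      · exact Or.inr ⟨⟨by omega, by omega⟩, hz.2⟩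
    have h3 := (Finset.card_le_card h2).trans (Finset.card_union_le _ _)
    have h4 : ((red R (Finset.Icc 1 (N : ℤ))).card : ℝ) ≤
      (red R (Finset.Icc 1 ((N / 2 : ℕ) : ℤ))).card + (red R (Finset.Ioc ((N : ℤ) / 2) N)).card := by
      exact_mod_cast h3
    have h5 : ((N / 2 : ℕ) : ℝ) ≤ N / 2 := Nat.cast_div_le
    nlinarith
  obtain ⟨m, α, hm1, hm2, hD⟩ := hdense R N hF (by omega) hhalf
  refine hit m N α R (by omega) hm2 hF hD ?_
  intro h ξ h1 h2 h3 h4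
  exact sparse_hyp hk hF M N m h H ξ0 ξ θ (by rw [← hC]; exact hθC) hθ0 h2 (by omega) hMcond hup hξ0 h3 h4
    hNM (by omega) hm1 hm2

end TwoK

theorem TwoK.zmod_case (k : ℕ) (hk : 0 < k) (H M0 : ℕ) (p : ℕ) (hp : p.Prime) (hHp : H < p)
    (A : Set (ZMod p)) (hA : A.Nonempty) (hno : ¬ HasAP A 2 k)
    (hsz : ∃ x d : ZMod p, d ≠ 0 ∧ ∀ i : ℕ, i < M0 → x + (i : ZMod p) * d ∈ Aᶜ) :
    ∃ (R : Set ℤ) (M : ℕ), M0 ≤ M ∧ TwoK.FOne k R ∧ (∀ n : ℤ, 1 ≤ n → n ≤ M → n ∉ R) ∧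
      (∀ h : ℤ, 1 ≤ h → h ≤ H → ∀ y : ℤ, ∃ n : ℕ, n ≤ M ∧ y + n * h ∈ R) ∧
      Nat.card A ≤ (TwoK.red R (Finset.Icc 1 (p : ℤ))).card := by
  classical
  have : Fact p.Prime := ⟨hp⟩
  have : NeZero p := ⟨hp.ne_zero⟩
  have hlen : ∀ L : ℕ, (∃ x d : ZMod p, d ≠ 0 ∧ ∀ i : ℕ, i < L → x + (i : ZMod p) * d ∈ Aᶜ) → L ≤ p := by
    rintro L ⟨x, d, hd, h⟩
    by_contra hc
    obtain ⟨a, ha⟩ := hA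
    have h1 := h ((a - x) / d).val ((ZMod.val_lt _).trans (by omega))
    rw [ZMod.natCast_zmod_val, div_mul_cancel₀ _ hd] at h1
    apply h1
    simpa using ha
  obtain ⟨M, hM0, ⟨x, d, hd, hM⟩, hmax⟩ : ∃ M, M0 ≤ M ∧
      (∃ x d : ZMod p, d ≠ 0 ∧ ∀ i : ℕ, i < M → x + (i : ZMod p) * d ∈ Aᶜ) ∧
      ¬ (∃ x d : ZMod p, d ≠ 0 ∧ ∀ i : ℕ, i < M + 1 → x + (i : ZMod p) * d ∈ Aᶜ) := by
    let P : ℕ → Prop := fun L => ∃ x d : ZMod p, d ≠ 0 ∧ ∀ i : ℕ, i < L → x + (i : ZMod p) * d ∈ Aᶜ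
    refine ⟨Nat.findGreatest P p, Nat.le_findGreatest (hlen _ hsz) hsz,
      Nat.findGreatest_spec (P := P) (hlen _ hsz) hsz, fun hc => ?_⟩
    have : Nat.findGreatest P p + 1 ≤ Nat.findGreatest P p := Nat.le_findGreatest (hlen _ hc) hc
    omega
  refine ⟨{n : ℤ | x + ((n : ZMod p) - 1) * d ∈ A}, M, hM0, ?_, ?_, ?_, ?_⟩
  · intro u hu v hv
    simp only [Set.mem_setOf_eq] at hu hv ⊢
    by_cases he : ((v : ZMod p) - u) * d = 0
    · refine ⟨1, le_rfl, hk, ?_⟩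
      have : x + (((v + ((1 : ℕ) : ℤ) * (v - u) : ℤ) : ZMod p) - 1) * d =
          x + ((v : ZMod p) - 1) * d + ((v : ZMod p) - u) * d := by push_cast; ring
      rw [this, he, add_zero]
      exact hv
    · by_contra hc
      push Not at hc
      apply hno
      refine ⟨x + ((u : ZMod p) - 1) * d, ((v : ZMod p) - u) * d, he, ?_, ?_⟩
      · intro i hi
        interval_cases i
        · simpa using hu
        · convert hv using 1
          push_cast; ring
      · intro i hi1 hi2
        obtain ⟨j, rfl⟩ : ∃ j, i = j + 1 := ⟨i - 1, by omega⟩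
        have := hc j (by omega) (by omega)
        convert this using 2
        push_cast; ring
  · intro n hn1 hn2 hn
    simp only [Set.mem_setOf_eq] at hn
    obtain ⟨j, rfl⟩ : ∃ j : ℕ, n = j + 1 := ⟨(n - 1).toNat, by omega⟩
    apply hM j (by omega)
    convert hn using 1
    push_cast; ring
  · intro h h1 h2 y
    by_contra hc
    push Not at hc
    apply hmax
    refine ⟨x + ((y : ZMod p) - 1) * d, (h : ZMod p) * d, mul_ne_zero ?_ hd, ?_⟩
    · intro h0
      rw [ZMod.intCast_zmod_eq_zero_iff_dvd] at h0
      have := Int.le_of_dvd (by omega) h0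
      omega
    · intro i hi
      have := hc i (by omega)
      simp only [Set.mem_setOf_eq] at this
      rw [Set.mem_compl_iff]
      convert this using 2
      push_cast; ring
  · rw [Nat.card_eq_card_toFinset]
    apply Finset.card_le_card_of_injOn (fun a => (((a - x) / d).val : ℤ) + 1)
    · intro a ha
      have ha' : a ∈ A := by simpa using ha
      have hlt := ZMod.val_lt ((a - x) / d)
      refine TwoK.mem_red.2 ⟨Finset.mem_Icc.2 ⟨by beta_reduce; omega, by beta_reduce; omega⟩, ?_⟩
      simp only [Set.mem_setOf_eq]
      push_cast
      rw [ZMod.natCast_zmod_val, add_sub_cancel_right, div_mul_cancel₀ _ hd]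
      simpa using ha'
    · intro a _ b _ hab
      have h1 : ((a - x) / d).val = ((b - x) / d).val := by
        have : (((a - x) / d).val : ℤ) + 1 = (((b - x) / d).val : ℤ) + 1 := hab
        omega
      have h2 := ZMod.val_injective p h1
      rw [div_left_inj' hd] at h2
      exact sub_left_injective h2

/-- For every positive integer k, the pair (2, k) is findable. -/
theorem statement1 (k : ℕ) (hk : 0 < k) : Findable 2 k := by
  intro δ hδ
  obtain ⟨M0, H, hcore⟩ := TwoK.core k hk δ hδ
  obtain ⟨p0, hszem⟩ := TwoK.szem δ hδ M0
  refine ⟨p0 + H + 1, fun p hp hp0 A hA hAc => ?_⟩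
  by_contra hno
  have hpR : (0 : ℝ) < p := by exact_mod_cast hp.pos
  have hne : A.Nonempty := by
    by_contra hc
    rw [Set.not_nonempty_iff_eq_empty] at hc
    subst hc
    have : (0 : ℝ) < δ * p := by positivity
    simp at hA
    linarith
  obtain ⟨R, M, h1, h2, h3, h4, h5⟩ := TwoK.zmod_case k hk H M0 p hp (by omega) A hne hno
    (hszem p hp (by omega) Aᶜ hAc)
  exact hcore R M p h1 h2 h3 h4 hp.one_le (hA.trans (by exact_mod_cast h5))
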